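/- For every integer r ≥ 1 there exists a constant c > 0 such that for every ε > 0 there exists C > 0 with: for all real Y ≥ 1, | ∑_{Δ fundamental discriminant, 0 < Δ ≤ Y} (NumberField.classNumber K_Δ)^r · (NumberField.Units.regulator K_Δ)^r − c · Y^{r/2+1} | ≤ C · Y^{r/2 + 2/3 + ε}. -/

import Mathlib

/-!
Statement 2: moments of (class number × regulator) of real quadratic fields
(Theorem `cor:classnumbers`, real case).
-/

/-- `Δ` is a fundamental discriminant. -/
def IsFundamentalDiscriminant (Δ : ℤ) : Prop :=
  Δ ≠ 1 ∧ ((Δ % 4 = 1 ∧ Squarefree Δ) ∨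
    ∃ m : ℤ, Δ = 4 * m ∧ Squarefree m ∧ (m % 4 = 2 ∨ m % 4 = 3))

namespace Mom
open Finset

/-- divisor bound -/
theorem divisor_bound (η : ℝ) (hη : 0 < η) :
    ∃ C : ℝ, 1 ≤ C ∧ ∀ n : ℕ, n ≠ 0 → (n.divisors.card : ℝ) ≤ C * (n : ℝ) ^ η := by
  -- a constant for a single prime
  obtain ⟨C0, hC01, hC0⟩ : ∃ C0 : ℝ, 1 ≤ C0 ∧ ∀ v : ℕ, (v + 1 : ℝ) ≤ C0 * (2 : ℝ) ^ (η * v) := by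
    refine ⟨1 + 1 / (η * Real.log 2), ?_, fun v => ?_⟩
    · have := Real.log_pos (one_lt_two)
      have : 0 < 1 / (η * Real.log 2) := by positivity
      linarith
    · have hl := Real.log_pos (one_lt_two)
      have h1 : Real.log 2 * (η * v) + 1 ≤ (2 : ℝ) ^ (η * v) := by
        rw [Real.rpow_def_of_pos two_pos]
        exact Real.add_one_le_exp _
      have h2 : (1 : ℝ) ≤ (2 : ℝ) ^ (η * v) := by
        apply Real.one_le_rpow one_le_two; positivity
      have h3 : (v : ℝ) ≤ 1 / (η * Real.log 2) * (2 : ℝ) ^ (η * v) := by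
        rw [div_mul_eq_mul_div, one_mul, le_div_iff₀ (by positivity)]
        nlinarith
      nlinarith
  set P : ℕ := ⌈(2 : ℝ) ^ (1 / η)⌉₊ with hP
  refine ⟨C0 ^ P, one_le_pow₀ hC01, fun n hn => ?_⟩
  rw [Nat.card_divisors hn]
  push_cast
  have key : ∀ p ∈ n.primeFactors, ((n.factorization p : ℝ) + 1) ≤
      (if p < P then C0 else 1) * ((p : ℝ) ^ (n.factorization p)) ^ η := by
    intro p hp
    have hpp := Nat.prime_of_mem_primeFactors hp
    have hp2 : (2 : ℝ) ≤ p := by exact_mod_cast hpp.two_le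
    have e : ((p : ℝ) ^ (n.factorization p)) ^ η = (p : ℝ) ^ (η * (n.factorization p : ℕ)) := by
      rw [← Real.rpow_natCast, ← Real.rpow_mul (by positivity), mul_comm]
    rw [e]
    split_ifs with h
    · refine (hC0 _).trans ?_
      gcongr
    · rw [one_mul]
      have h1 : (2 : ℝ) ≤ (p : ℝ) ^ η := by
        have : (2 : ℝ) ^ (1 / η) ≤ p := by
          refine (Nat.le_ceil _).trans ?_
          exact_mod_cast not_lt.mp h
        calc (2 : ℝ) = ((2 : ℝ) ^ (1 / η)) ^ η := by
              rw [← Real.rpow_mul (by norm_num)]; field_simp; simp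
          _ ≤ _ := by gcongr
      rw [Real.rpow_mul (by positivity), Real.rpow_natCast]
      calc ((n.factorization p : ℝ) + 1) ≤ 2 ^ (n.factorization p) := by
            exact_mod_cast Nat.succ_le_of_lt (Nat.lt_two_pow_self)
        _ ≤ _ := by gcongr
  calc ∏ p ∈ n.primeFactors, ((n.factorization p : ℝ) + 1)
      ≤ ∏ p ∈ n.primeFactors, ((if p < P then C0 else 1) * ((p : ℝ) ^ (n.factorization p)) ^ η) :=
        Finset.prod_le_prod (fun _ _ => by positivity) key
    _ = (∏ p ∈ n.primeFactors, (if p < P then C0 else 1)) *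
          (∏ p ∈ n.primeFactors, ((p : ℝ) ^ (n.factorization p))) ^ η := by
        rw [Finset.prod_mul_distrib, Real.finset_prod_rpow]
        intros; positivity
    _ ≤ C0 ^ P * (n : ℝ) ^ η := by
        have : (∏ p ∈ n.primeFactors, ((p : ℝ) ^ (n.factorization p))) = n := by
          conv_rhs => rw [← Nat.prod_factorization_pow_eq_self hn]
          rw [Finsupp.prod]; push_cast; rfl
        rw [this]
        gcongr
        rw [Finset.prod_ite]
        simp only [Finset.prod_const, Finset.prod_const_one, mul_one, one_pow]
        refine pow_le_pow_right₀ hC01 ?_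
        calc _ ≤ (Finset.range P).card := by
              apply Finset.card_le_card
              intro x hx
              simp only [Finset.mem_filter] at hx
              simpa using hx.2
          _ = P := by simp

end Mom

namespace Mom
open Finset ZMod

/-- Jacobi symbol as a function on `ZMod s` -/
noncomputable def jz (s : ℕ) (x : ZMod s) : ℂ := (jacobiSym (x.val : ℤ) s : ℤ)

lemma jz_coe (s : ℕ) [NeZero s] (k : ℤ) : jz s (k : ZMod s) = (jacobiSym k s : ℤ) := by
  unfold jz
  rw [ZMod.val_intCast, ← jacobiSym.mod_left]

lemma jz_mul (s : ℕ) [NeZero s] (x y : ZMod s) : jz s (x * y) = jz s x * jz s y := by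
  obtain ⟨a, rfl⟩ := ZMod.intCast_surjective x
  obtain ⟨b, rfl⟩ := ZMod.intCast_surjective y
  rw [← Int.cast_mul, jz_coe, jz_coe, jz_coe, jacobiSym.mul_left]; push_cast; rfl

lemma jz_unit (s : ℕ) [NeZero s] (x : ZMod s) (hx : IsUnit x) : jz s x = 1 ∨ jz s x = -1 := by
  unfold jz
  have h : (x.val).Coprime s := by
    obtain ⟨u, rfl⟩ := hx
    exact ZMod.val_coe_unit_coprime u
  have h2 : jacobiSym (x.val : ℤ) s ≠ 0 := by
    rw [Ne, jacobiSym.eq_zero_iff_not_coprime]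
    push Not
    exact_mod_cast h
  rcases jacobiSym.trichotomy (x.val : ℤ) s with h | h | h
  · exact absurd h h2
  · left; rw [h]; simp
  · right; rw [h]; simp

lemma jz_nonunit (s : ℕ) [NeZero s] (x : ZMod s) (hx : ¬ IsUnit x) : jz s x = 0 := by
  unfold jz
  rw [show jacobiSym (x.val : ℤ) s = 0 from ?_]; · simp
  rw [jacobiSym.eq_zero_iff_not_coprime]
  intro h
  apply hx
  have : (x.val).Coprime s := by
    rw [Nat.Coprime]; exact_mod_cast h
  rw [← ZMod.natCast_zmod_val x]
  exact (ZMod.isUnit_iff_coprime _ _).2 this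

lemma jz_conj (s : ℕ) (x : ZMod s) : (starRingEnd ℂ) (jz s x) = jz s x := by
  unfold jz; simp

lemma exists_twist (s : ℕ) [NeZero s] (hs : Odd s) (hsf : Squarefree s) (h : ZMod s) (hh : ¬ IsUnit h) :
    ∃ y : ZMod s, IsUnit y ∧ jz s y = -1 ∧ h * y = h := by
  have hc : ¬ (h.val).Coprime s := by
    intro hc
    apply hh
    rw [← ZMod.natCast_zmod_val h]
    exact (ZMod.isUnit_iff_coprime _ _).2 hc
  obtain ⟨p, hp, hph, hps⟩ := Nat.Prime.not_coprime_iff_dvd.1 hc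
  haveI := Fact.mk hp
  obtain ⟨s', rfl⟩ := hps
  have hcop : p.Coprime s' := Nat.coprime_of_squarefree_mul hsf
  have hp2 : p ≠ 2 := by
    rintro rfl
    rw [Nat.odd_mul] at hs
    exact absurd hs.1 (by decide)
  obtain ⟨a, ha⟩ := FiniteField.exists_nonsquare (F := ZMod p) (by rwa [ZMod.ringChar_zmod_n])
  have ha0 : a ≠ 0 := by rintro rfl; exact ha (by simp)
  obtain ⟨y, hy1, hy2⟩ := Nat.chineseRemainder hcop a.val 1
  have e1 : jacobiSym (y : ℤ) p = -1 := by
    rw [← jacobiSym.legendreSym.to_jacobiSym, legendreSym.eq_neg_one_iff]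
    have : ((y : ℤ) : ZMod p) = a := by
      push_cast
      rw [(ZMod.natCast_eq_natCast_iff _ _ _).2 hy1]; simp
    rwa [this]
  have e2 : jacobiSym (y : ℤ) s' = 1 := by
    have : (y : ℤ) % s' = 1 % s' := by exact_mod_cast hy2
    rw [jacobiSym.mod_left, this, ← jacobiSym.mod_left, jacobiSym.one_left]
  have hs'0 : s' ≠ 0 := by rintro rfl; exact (NeZero.ne (p * 0)) (by simp)
  haveI : NeZero s' := ⟨hs'0⟩
  have e3 : jacobiSym (y : ℤ) (p * s') = -1 := by
    rw [jacobiSym.mul_right, e1, e2]; simp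
  have e4 : jz (p * s') (y : ZMod (p * s')) = -1 := by
    have := jz_coe (p * s') (y : ℤ)
    push_cast at this
    rw [this, e3]; simp
  refine ⟨(y : ZMod (p * s')), ?_, e4, ?_⟩
  · by_contra hu
    rw [jz_nonunit _ _ hu] at e4
    norm_num at e4
  · obtain ⟨t, ht⟩ := hph
    rw [← ZMod.natCast_zmod_val h, ht, ← Nat.cast_mul, ZMod.natCast_eq_natCast_iff]
    have : t * y ≡ t * 1 [MOD s'] := Nat.ModEq.mul_left t hy2
    have := Nat.ModEq.mul_left' p this
    simpa [mul_assoc] using this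

noncomputable def gz (s : ℕ) [NeZero s] (h : ZMod s) : ℂ := ∑ x : ZMod s, jz s x * stdAddChar (h * x)

lemma gz_nonunit (s : ℕ) [NeZero s] (hs : Odd s) (hsf : Squarefree s) (h : ZMod s) (hh : ¬ IsUnit h) :
    gz s h = 0 := by
  obtain ⟨y, hyu, hy, hhy⟩ := exists_twist s hs hsf h hh
  have : gz s h = - gz s h := by
    conv_lhs => unfold gz
    obtain ⟨u, rfl⟩ := hyu
    rw [← Equiv.sum_comp (Units.mulRight u)]
    simp only [Units.mulRight_apply]
    unfold gz
    rw [← Finset.sum_neg_distrib]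
    refine Finset.sum_congr rfl fun x _ => ?_
    rw [jz_mul, hy, show h * (x * (u : ZMod s)) = (h * u) * x by ring, hhy]; ring
  have h2 : (2 : ℂ) * gz s h = 0 := by linear_combination this
  simpa using h2

lemma gz_unit (s : ℕ) [NeZero s] (h : ZMod s) (hh : IsUnit h) : ‖gz s h‖ = ‖gz s 1‖ := by
  have : gz s 1 = jz s h * gz s h := by
    obtain ⟨u, rfl⟩ := hh
    conv_lhs => unfold gz
    rw [← Equiv.sum_comp (Units.mulRight u)]
    simp only [Units.mulRight_apply]
    unfold gz
    rw [Finset.mul_sum]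
    refine Finset.sum_congr rfl fun x _ => ?_
    rw [jz_mul, show (1 : ZMod s) * (x * (u : ZMod s)) = u * x by ring]; ring
  rw [this, norm_mul]
  rcases jz_unit s h hh with h | h <;> simp [h]

lemma std_sum (s : ℕ) [NeZero s] (a : ZMod s) :
    ∑ h : ZMod s, stdAddChar (h * a) = if a = 0 then (s : ℂ) else 0 := by
  have := AddChar.sum_mulShift (R := ZMod s) (R' := ℂ) a (ZMod.isPrimitive_stdAddChar s)
  rw [this]
  split_ifs <;> simp

lemma gz_inv (s : ℕ) [NeZero s] (l : ZMod s) :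
    ∑ h : ZMod s, gz s h * stdAddChar (-(h * l)) = s * jz s l := by
  unfold gz
  simp_rw [Finset.sum_mul]
  rw [Finset.sum_comm]
  have : ∀ x : ZMod s, ∑ h : ZMod s, jz s x * stdAddChar (h * x) * stdAddChar (-(h * l)) =
      jz s x * (if x - l = 0 then (s : ℂ) else 0) := by
    intro x
    rw [← std_sum, Finset.mul_sum]
    refine Finset.sum_congr rfl fun h _ => ?_
    rw [mul_assoc, ← AddChar.map_add_eq_mul]
    congr 3; ring
  simp_rw [this, sub_eq_zero]
  simp [mul_comm]

lemma gz_parseval (s : ℕ) [NeZero s] :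
    ∑ h : ZMod s, gz s h * (starRingEnd ℂ) (gz s h) = s * ∑ x : ZMod s, jz s x * jz s x := by
  have h1 : ∀ h : ZMod s, gz s h * (starRingEnd ℂ) (gz s h) =
      ∑ x : ZMod s, jz s x * (gz s h * stdAddChar (-(h * x))) := by
    intro h
    conv_lhs => rw [show (starRingEnd ℂ) (gz s h) = ∑ x : ZMod s, jz s x * stdAddChar (-(h * x)) by
      unfold gz
      rw [map_sum]
      refine Finset.sum_congr rfl fun x _ => ?_
      rw [map_mul, jz_conj, AddChar.map_neg_eq_conj]]
    rw [Finset.mul_sum]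
    refine Finset.sum_congr rfl fun x _ => by ring
  simp_rw [h1]
  rw [Finset.sum_comm]
  simp_rw [← Finset.mul_sum, gz_inv]
  rw [Finset.mul_sum]
  refine Finset.sum_congr rfl fun x _ => by ring

lemma gz_bound (s : ℕ) [NeZero s] (hs : Odd s) (hsf : Squarefree s) (h : ZMod s) :
    ‖gz s h‖ ≤ Real.sqrt s := by
  classical
  by_cases hh : IsUnit h
  swap
  · rw [gz_nonunit s hs hsf h hh]; simp
  rw [gz_unit s h hh]
  set U : Finset (ZMod s) := Finset.univ.filter (fun x => IsUnit x) with hU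
  have hUpos : 0 < U.card := Finset.card_pos.2 ⟨1, by simp [hU]⟩
  have key : ((U.card : ℝ)) * ‖gz s 1‖ ^ 2 = s * U.card := by
    have hp := gz_parseval s
    have l1 : ∑ h : ZMod s, gz s h * (starRingEnd ℂ) (gz s h) = ((U.card * ‖gz s 1‖ ^ 2 : ℝ) : ℂ) := by
      have : ∀ h : ZMod s, gz s h * (starRingEnd ℂ) (gz s h) =
          if IsUnit h then ((‖gz s 1‖ ^ 2 : ℝ) : ℂ) else 0 := by
        intro h
        split_ifs with hh
        · rw [Complex.mul_conj, Complex.normSq_eq_norm_sq, gz_unit s h hh]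
        · rw [gz_nonunit s hs hsf h hh]; simp
      simp_rw [this]
      rw [← Finset.sum_filter]
      simp [hU]
    have l2 : ∑ x : ZMod s, jz s x * jz s x = U.card := by
      have : ∀ x : ZMod s, jz s x * jz s x = if IsUnit x then 1 else 0 := by
        intro x
        split_ifs with hx
        · rcases jz_unit s x hx with h | h <;> simp [h]
        · rw [jz_nonunit s x hx]; simp
      simp_rw [this]
      rw [← Finset.sum_filter]
      simp [hU]
    rw [l1, l2] at hp
    exact_mod_cast hp
  have : ‖gz s 1‖ ^ 2 = s := by
    have h0 : (U.card : ℝ) ≠ 0 := by exact_mod_cast hUpos.ne'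
    apply mul_left_cancel₀ h0
    rw [key]; ring
  rw [← this, Real.sqrt_sq (norm_nonneg _)]

end Mom

namespace Mom
open Finset ZMod

lemma std_sub_one_lower (s : ℕ) [NeZero s] (h : ZMod s) (hh : h ≠ 0) :
    4 * min (h.val : ℝ) (s - h.val) / s ≤ ‖stdAddChar h - 1‖ := by
  have hs : (0 : ℝ) < s := by exact_mod_cast NeZero.pos s
  have hv : h.val < s := ZMod.val_lt h
  have hvs : (h.val : ℝ) < s := by exact_mod_cast hv
  have e : stdAddChar h = Complex.exp (Complex.I * ((2 * Real.pi * h.val / s : ℝ) : ℂ)) := by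
    have := ZMod.stdAddChar_coe (N := s) (h.val : ℤ)
    push_cast at this
    rw [ZMod.natCast_zmod_val] at this
    rw [this]; congr 1; push_cast; ring
  rw [e, Complex.norm_exp_I_mul_ofReal_sub_one, norm_mul, Real.norm_eq_abs, Real.norm_eq_abs]
  have h2 : |(2 : ℝ)| = 2 := abs_of_pos two_pos
  rw [h2]
  have hx : 2 * Real.pi * h.val / s / 2 = Real.pi * (h.val / s) := by field_simp
  rw [hx]
  have key : ∀ y : ℝ, 0 ≤ y → y ≤ 1/2 → 2 * y ≤ Real.sin (Real.pi * y) := by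
    intro y h0 h1
    have := Real.mul_le_sin (x := Real.pi * y) (by positivity) (by nlinarith [Real.pi_pos])
    refine le_trans (le_of_eq ?_) this
    field_simp
  rcases le_total (h.val : ℝ) (s - h.val) with hle | hle
  · rw [min_eq_left hle]
    have := key (h.val / s) (by positivity) (by rw [div_le_iff₀ hs]; linarith)
    calc 4 * (h.val : ℝ) / s = 2 * (2 * (h.val / s)) := by ring
      _ ≤ 2 * |Real.sin (Real.pi * (h.val / s))| := by
        gcongr; exact this.trans (le_abs_self _)
  · rw [min_eq_right hle]
    have := key (1 - h.val / s) (by rw [sub_nonneg, div_le_one hs]; exact hvs.le)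
      (by have : 1/2 ≤ (h.val : ℝ)/s := by rw [le_div_iff₀ hs]; linarith
          linarith)
    rw [show Real.pi * (1 - h.val / s) = Real.pi - Real.pi * (h.val / s) by ring, Real.sin_pi_sub] at this
    calc 4 * ((s : ℝ) - h.val) / s = 2 * (2 * (1 - h.val / s)) := by field_simp; ring
      _ ≤ 2 * |Real.sin (Real.pi * (h.val / s))| := by
        gcongr; exact this.trans (le_abs_self _)

lemma harmonic_bd (s : ℕ) [NeZero s] :
    ∑ h : ZMod s, (1 / (h.val : ℝ)) ≤ 1 + Real.log s := by
  have h1 : ∑ h : ZMod s, (1 / (h.val : ℝ)) = ∑ i ∈ range s, 1 / (i : ℝ) := by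
    refine Finset.sum_bij' (fun h _ => h.val) (fun i _ => (i : ZMod s)) ?_ ?_ ?_ ?_ ?_
    · intro a _; simpa using ZMod.val_lt a
    · intro a _; simp
    · intro a _; simp
    · intro a ha; simp at ha; exact ZMod.val_cast_of_lt ha
    · intro a _; rfl
  rw [h1]
  refine le_trans ?_ (harmonic_le_one_add_log s)
  rw [harmonic]
  push_cast
  calc ∑ i ∈ range s, 1 / (i : ℝ) ≤ ∑ i ∈ range (s + 1), 1 / (i : ℝ) := by
        apply Finset.sum_le_sum_of_subset_of_nonneg
        · intro x; simp; omega
        · intros; positivity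
    _ = _ := by
        rw [Finset.sum_range_succ']
        simp

lemma pv_interval (s : ℕ) (hs : Odd s) (hsf : Squarefree s) (hs1 : s ≠ 1) (u : ℤ) (L : ℕ) :
    |∑ i ∈ range L, (jacobiSym (u + i) s : ℝ)| ≤ Real.sqrt s * (1 + Real.log s) := by
  have hs0 : s ≠ 0 := by rintro rfl; simp at hs
  haveI : NeZero s := ⟨hs0⟩
  have hspos : (0 : ℝ) < s := by exact_mod_cast NeZero.pos s
  set S : ℂ := ∑ i ∈ range L, jz s ((u + i : ℤ) : ZMod s) with hS
  have hSr : S = ((∑ i ∈ range L, (jacobiSym (u + i) s : ℝ) : ℝ) : ℂ) := by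
    rw [hS]; push_cast
    refine Finset.sum_congr rfl fun i _ => ?_
    rw [← jz_coe]; push_cast; rfl
  have hn : |∑ i ∈ range L, (jacobiSym (u + i) s : ℝ)| = ‖S‖ := by
    rw [hSr, Complex.norm_real, Real.norm_eq_abs]
  rw [hn]
  have hmain : (s : ℂ) * S = ∑ h : ZMod s, gz s h * ∑ i ∈ range L, stdAddChar (-(h * ((u + i : ℤ) : ZMod s))) := by
    rw [hS, Finset.mul_sum]
    simp_rw [← gz_inv, Finset.mul_sum]
    rw [Finset.sum_comm]
  have hterm : ∀ h : ZMod s, ‖gz s h * ∑ i ∈ range L, stdAddChar (-(h * ((u + i : ℤ) : ZMod s)))‖ ≤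
      Real.sqrt s * (s / 2 * (1 / (h.val : ℝ) + 1 / ((-h).val : ℝ))) := by
    intro h
    by_cases hh : h = 0
    · subst hh
      rw [gz_nonunit s hs hsf 0]
      · simp
      · rw [isUnit_zero_iff]
        intro h01
        have : (s : ℕ) ∣ 1 := by
          rw [← ZMod.natCast_eq_zero_iff]; push_cast; exact h01.symm
        exact hs1 (Nat.dvd_one.1 this)
    · rw [norm_mul]
      gcongr
      · exact gz_bound s hs hsf h
      have hnv : ((-h).val : ℝ) = s - h.val := by
        haveI : NeZero h := ⟨hh⟩
        rw [ZMod.val_neg_of_ne_zero, Nat.cast_sub (ZMod.val_lt h).le]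
      have hnh : -h ≠ 0 := neg_ne_zero.2 hh
      have hlow := std_sub_one_lower s (-h) hnh
      have hv0 : (0 : ℝ) < h.val := by
        have : h.val ≠ 0 := by rwa [Ne, ZMod.val_eq_zero]
        exact_mod_cast Nat.pos_of_ne_zero this
      have hv1 : (0 : ℝ) < s - h.val := by
        rw [sub_pos]; exact_mod_cast ZMod.val_lt h
      rw [hnv] at hlow ⊢
      rw [show (s : ℝ) - (s - h.val) = h.val by ring] at hlow
      set z : ℂ := stdAddChar (-h) with hz
      have hgeom : ∑ i ∈ range L, stdAddChar (-(h * ((u + i : ℤ) : ZMod s))) =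
          stdAddChar (-(h * (u : ZMod s))) * ∑ i ∈ range L, z ^ i := by
        rw [Finset.mul_sum]
        refine Finset.sum_congr rfl fun i _ => ?_
        rw [hz, ← AddChar.map_nsmul_eq_pow, ← AddChar.map_add_eq_mul]
        congr 1; push_cast; rw [nsmul_eq_mul]; ring
      have hmpos : 0 < min ((s : ℝ) - h.val) h.val := lt_min hv1 hv0
      have hzpos : 0 < ‖z - 1‖ := lt_of_lt_of_le (by positivity) hlow
      have hz1 : z ≠ 1 := by intro h; rw [h] at hzpos; simp at hzpos
      rw [hgeom, norm_mul, AddChar.norm_apply, one_mul, geom_sum_eq hz1, norm_div]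
      have hnum : ‖z ^ L - 1‖ ≤ 2 := by
        calc _ ≤ ‖z ^ L‖ + ‖(1 : ℂ)‖ := norm_sub_le _ _
          _ = 2 := by rw [norm_pow, hz, AddChar.norm_apply]; norm_num
      calc ‖z ^ L - 1‖ / ‖z - 1‖ ≤ 2 / (4 * min ((s : ℝ) - h.val) h.val / s) := by gcongr
        _ = s / 2 * (1 / min ((s : ℝ) - h.val) h.val) := by field_simp; norm_num
        _ ≤ s / 2 * (1 / (h.val : ℝ) + 1 / ((s : ℝ) - h.val)) := by
          gcongr
          rcases min_choice ((s : ℝ) - h.val) (h.val : ℝ) with h | h <;> rw [h]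
          · have : 0 ≤ 1 / (ZMod.val ‹ZMod s› : ℝ) := by positivity
            linarith
          · have : 0 ≤ 1 / ((s : ℝ) - ZMod.val ‹ZMod s›) := by positivity
            linarith
  have hfin : s * ‖S‖ ≤ s * (Real.sqrt s * (1 + Real.log s)) := by
    calc s * ‖S‖ = ‖(s : ℂ) * S‖ := by rw [norm_mul]; simp
      _ ≤ ∑ h : ZMod s, Real.sqrt s * (s / 2 * (1 / (h.val : ℝ) + 1 / ((-h).val : ℝ))) := by
        rw [hmain]
        exact (norm_sum_le _ _).trans (Finset.sum_le_sum fun h _ => hterm h)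
      _ = Real.sqrt s * (s / 2 * (∑ h : ZMod s, 1 / (h.val : ℝ) + ∑ h : ZMod s, 1 / ((-h).val : ℝ))) := by
        rw [← Finset.sum_add_distrib, Finset.mul_sum, Finset.mul_sum]
      _ = Real.sqrt s * (s / 2 * (∑ h : ZMod s, 1 / (h.val : ℝ) + ∑ h : ZMod s, 1 / (h.val : ℝ))) := by
        congr 3
        exact Equiv.sum_comp (Equiv.neg (ZMod s)) (fun h => 1 / (h.val : ℝ))
      _ = s * (Real.sqrt s * (∑ h : ZMod s, 1 / (h.val : ℝ))) := by ring
      _ ≤ _ := by gcongr; exact harmonic_bd s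
  exact le_of_mul_le_mul_left hfin hspos

lemma filter_mod8 (X b : ℕ) (hb : b < 8) : ∃ L, ∀ F : ℕ → ℝ,
    ∑ k ∈ (range X).filter (fun k => k % 8 = b), F k = ∑ i ∈ range L, F (b + 8 * i) := by
  refine ⟨(X + 7 - b) / 8, fun F => ?_⟩
  symm
  refine Finset.sum_bij' (fun i _ => b + 8 * i) (fun k _ => k / 8) ?_ ?_ ?_ ?_ ?_
  · intro i hi; simp at hi ⊢; omega
  · intro k hk; simp at hk ⊢; omega
  · intro i hi; simp at hi ⊢; omega
  · intro k hk; simp at hk ⊢; omega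
  · intros; rfl

lemma pv_mod8 (s : ℕ) (hs : Odd s) (hsf : Squarefree s) (hs1 : s ≠ 1) (b X : ℕ) :
    |∑ k ∈ (range X).filter (fun k => k % 8 = b), (jacobiSym k s : ℝ)| ≤
      Real.sqrt s * (1 + Real.log s) := by
  by_cases hb : b < 8
  swap
  · rw [Finset.filter_false_of_mem (by intro x _; omega)]
    have : 0 ≤ Real.log s := Real.log_natCast_nonneg s
    simp; positivity
  obtain ⟨L, hL⟩ := filter_mod8 X b hb
  rw [hL]
  have hcop : IsCoprime (8 : ℤ) s := by
    rw [Int.isCoprime_iff_gcd_eq_one]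
    have : Nat.Coprime (2 ^ 3) s := Nat.Coprime.pow_left 3 (Nat.coprime_two_left.2 hs)
    exact_mod_cast this
  obtain ⟨v, w, hvw⟩ := hcop
  have hJ : ∀ i : ℕ, jacobiSym ((b + 8 * i : ℕ) : ℤ) s = jacobiSym 8 s * jacobiSym (v * b + i) s := by
    intro i
    rw [← jacobiSym.mul_left, jacobiSym.mod_left, jacobiSym.mod_left (8 * (v * b + i))]
    congr 1
    apply Int.emod_emod_of_dvd _ (dvd_refl (s : ℤ)) |>.symm.trans
    rw [Int.emod_emod_of_dvd _ (dvd_refl (s : ℤ))]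
    apply Int.ModEq.eq
    rw [Int.modEq_iff_dvd]
    refine ⟨-(w * b), ?_⟩
    push_cast
    linear_combination (b : ℤ) * hvw
  simp_rw [hJ]
  push_cast
  rw [← Finset.mul_sum, abs_mul]
  have h1 : |(jacobiSym 8 s : ℝ)| ≤ 1 := by
    rcases jacobiSym.trichotomy 8 s with h | h | h <;> rw [h] <;> norm_num
  have := pv_interval s hs hsf hs1 (v * b) L
  calc _ ≤ 1 * |∑ i ∈ range L, (jacobiSym (v * b + i) s : ℝ)| := by gcongr
    _ ≤ _ := by rw [one_mul]; exact this

lemma jac_sq_right (k g : ℕ) (hg : g ≠ 0) : jacobiSym k (g ^ 2) = if k.Coprime g then 1 else 0 := by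
  have : NeZero g := ⟨hg⟩
  rw [sq, jacobiSym.mul_right, ← sq]
  split_ifs with h
  · exact jacobiSym.sq_one (by exact_mod_cast h)
  · rw [show jacobiSym (k : ℤ) g = 0 from ?_]; · simp
    rw [jacobiSym.eq_zero_iff_not_coprime]; exact_mod_cast h

lemma coprime_moebius (k g : ℕ) (hg : g ≠ 0) :
    (if k.Coprime g then (1 : ℤ) else 0) = ∑ e ∈ g.divisors.filter (· ∣ k), ArithmeticFunction.moebius e := by
  have h1 : g.divisors.filter (· ∣ k) = (k.gcd g).divisors := by
    ext e
    simp only [mem_filter, Nat.mem_divisors, Nat.dvd_gcd_iff]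
    have : k.gcd g ≠ 0 := by
      intro h; exact hg (Nat.eq_zero_of_gcd_eq_zero_right h)
    tauto
  rw [h1]
  have := ArithmeticFunction.coe_zeta_mul_moebius
  have h2 := congrArg (fun f : ArithmeticFunction ℤ => f (k.gcd g)) this
  simp only [ArithmeticFunction.coe_zeta_mul_apply, ArithmeticFunction.one_apply] at h2
  rw [h2]

lemma pv_imprim (s : ℕ) (hs : Odd s) (hsf : Squarefree s) (hs1 : s ≠ 1) (g : ℕ) (hg : Odd g) (b X : ℕ) :
    |∑ k ∈ (range X).filter (fun k => k % 8 = b), (jacobiSym k (s * g ^ 2) : ℝ)| ≤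
      g.divisors.card * (Real.sqrt s * (1 + Real.log s)) := by
  have hs0 : s ≠ 0 := by rintro rfl; simp at hs
  have hg0 : g ≠ 0 := by rintro rfl; simp at hg
  have h1 : ∀ k : ℕ, (jacobiSym k (s * g ^ 2) : ℝ) =
      ∑ e ∈ g.divisors, if e ∣ k then (ArithmeticFunction.moebius e : ℝ) * jacobiSym k s else 0 := by
    intro k
    haveI : NeZero s := ⟨hs0⟩
    haveI : NeZero (g ^ 2) := ⟨pow_ne_zero 2 hg0⟩
    rw [jacobiSym.mul_right, jac_sq_right k g hg0, coprime_moebius k g hg0, ← Finset.sum_filter]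
    push_cast
    rw [Finset.mul_sum]
    exact Finset.sum_congr rfl fun e _ => by ring
  simp_rw [h1]
  rw [Finset.sum_comm]
  refine (Finset.abs_sum_le_sum_abs _ _).trans ?_
  rw [← nsmul_eq_mul]
  refine Finset.sum_le_card_nsmul _ _ _ fun e he => ?_
  have heg : e ∣ g := Nat.dvd_of_mem_divisors he
  have heo : Odd e := Odd.of_dvd_nat hg heg
  have he0 : 0 < e := heo.pos
  rw [← Finset.sum_filter]
  have h2 : ∑ k ∈ ((range X).filter (fun k => k % 8 = b)).filter (fun k => e ∣ k),
      (ArithmeticFunction.moebius e : ℝ) * (jacobiSym k s : ℝ) =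
      ∑ k ∈ (range ((X + e - 1) / e)).filter (fun k => k % 8 = if b < 8 then (e * b) % 8 else 9),
        (ArithmeticFunction.moebius e * jacobiSym e s : ℝ) * (jacobiSym k s : ℝ) := by
    have e8 : e * e % 8 = 1 := by
      have : e % 8 = 1 ∨ e % 8 = 3 ∨ e % 8 = 5 ∨ e % 8 = 7 := by
        have := Nat.odd_iff.1 heo; omega
      rcases this with h | h | h | h <;> simp [Nat.mul_mod, h]
    have hcong : ∀ k, k % 8 = (if b < 8 then (e * b) % 8 else 9) ↔ (e * k) % 8 = b := by
      intro k
      split_ifs with hb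
      · constructor
        · intro h
          calc (e * k) % 8 = (e * (k % 8)) % 8 := by simp [Nat.mul_mod]
            _ = ((e * e % 8) * b) % 8 := by rw [h]; simp only [Nat.mul_mod_mod, Nat.mod_mul_mod, mul_assoc]
            _ = b := by rw [e8, one_mul]; exact Nat.mod_eq_of_lt hb
        · intro h
          calc k % 8 = ((e * e % 8) * k) % 8 := by rw [e8, one_mul]
            _ = (e * ((e * k) % 8)) % 8 := by simp only [Nat.mul_mod_mod, Nat.mod_mul_mod, mul_assoc]
            _ = _ := by rw [h]
      · omega
    symm
    refine Finset.sum_bij' (fun k _ => e * k) (fun k _ => k / e) ?_ ?_ ?_ ?_ ?_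
    · intro k hk
      simp only [mem_filter, mem_range] at hk ⊢
      refine ⟨⟨?_, (hcong k).1 hk.2⟩, Dvd.intro _ rfl⟩
      have := hk.1
      rw [Nat.lt_div_iff_mul_lt he0] at this
      rw [mul_comm]; omega
    · intro k hk
      simp only [mem_filter, mem_range] at hk ⊢
      obtain ⟨⟨hk1, hk2⟩, j, rfl⟩ := hk
      rw [Nat.mul_div_cancel_left _ he0]
      refine ⟨?_, (hcong j).2 hk2⟩
      rw [Nat.lt_div_iff_mul_lt he0, mul_comm]; omega
    · intro k hk; exact Nat.mul_div_cancel_left _ he0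
    · intro k hk
      simp only [mem_filter] at hk
      exact Nat.mul_div_cancel' hk.2
    · intro k hk
      push_cast
      rw [jacobiSym.mul_left]; push_cast; ring
  rw [h2, ← Finset.mul_sum, abs_mul]
  have hm : |(ArithmeticFunction.moebius e * jacobiSym e s : ℝ)| ≤ 1 := by
    rw [abs_mul]
    have a1 : |(ArithmeticFunction.moebius e : ℝ)| ≤ 1 := by
      exact_mod_cast ArithmeticFunction.abs_moebius_le_one
    have a2 : |(jacobiSym e s : ℝ)| ≤ 1 := by
      rcases jacobiSym.trichotomy e s with h | h | h <;> rw [h] <;> norm_num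
    exact mul_le_one₀ a1 (abs_nonneg _) a2
  calc _ ≤ 1 * |∑ k ∈ (range ((X + e - 1) / e)).filter (fun k => k % 8 = if b < 8 then (e * b) % 8 else 9), (jacobiSym k s : ℝ)| := by gcongr
    _ ≤ _ := by rw [one_mul]; exact pv_mod8 s hs hsf hs1 _ _

/-- Pólya–Vinogradov in the form used. -/
theorem pv (η : ℝ) (hη : 0 < η) : ∃ C : ℝ, 1 ≤ C ∧ ∀ n d b X : ℕ, Odd n → ¬ IsSquare n → Odd d →
    |∑ k ∈ (range X).filter (fun k => k % 8 = b), (jacobiSym k (n * d ^ 2) : ℝ)| ≤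
      C * (n : ℝ) ^ (1 / 2 + η) * (d : ℝ) ^ η := by
  obtain ⟨C, hC1, hC⟩ := divisor_bound η hη
  refine ⟨C * (1 + 1 / η), ?_, ?_⟩
  · have : 0 < 1 / η := by positivity
    nlinarith
  intro n d b X hn hns hd
  obtain ⟨s, f, hsf, hs⟩ := Nat.sq_mul_squarefree n
  have hs1 : s ≠ 1 := by
    rintro rfl
    exact hns ⟨f, by rw [← hsf]; ring⟩
  have hso : Odd s := by rw [← hsf, Nat.odd_mul] at hn; exact hn.2
  have hfo : Odd f := by rw [← hsf, Nat.odd_mul, Nat.odd_pow_iff two_ne_zero] at hn; exact hn.1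
  have hfd : Odd (f * d) := hfo.mul hd
  have := pv_imprim s hso hs hs1 (f * d) hfd b X
  rw [show s * (f * d) ^ 2 = n * d ^ 2 by rw [← hsf]; ring] at this
  refine this.trans ?_
  have hfd0 : f * d ≠ 0 := hfd.pos.ne'
  have hf1 : (1 : ℝ) ≤ f := by exact_mod_cast hfo.pos
  have hs1' : (1 : ℝ) ≤ s := by exact_mod_cast hso.pos
  have h1 := hC (f * d) hfd0
  have hlog : 1 + Real.log s ≤ (1 + 1 / η) * (s : ℝ) ^ η := by
    have h1 := Real.log_le_rpow_div (x := (s : ℝ)) (by positivity) hη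
    have h2 : (1 : ℝ) ≤ (s : ℝ) ^ η := Real.one_le_rpow hs1' hη.le
    calc _ ≤ (s : ℝ) ^ η + (s : ℝ) ^ η / η := by linarith
      _ = _ := by ring
  have hnr : (n : ℝ) = (f : ℝ) ^ 2 * s := by rw [← hsf]; push_cast; ring
  have hl0 : 0 ≤ Real.log s := Real.log_nonneg hs1'
  calc ((f * d).divisors.card : ℝ) * (Real.sqrt s * (1 + Real.log s))
      ≤ (C * ((f * d : ℕ) : ℝ) ^ η) * (Real.sqrt s * ((1 + 1 / η) * (s : ℝ) ^ η)) := by gcongr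
    _ = C * (1 + 1 / η) * ((s : ℝ) ^ (1 / 2 : ℝ) * ((f : ℝ) ^ η * (s : ℝ) ^ η)) * (d : ℝ) ^ η := by
        push_cast
        rw [Real.mul_rpow (by positivity) (by positivity), Real.sqrt_eq_rpow]; ring
    _ ≤ C * (1 + 1 / η) * ((n : ℝ) ^ (1 / 2 + η)) * (d : ℝ) ^ η := by
        gcongr
        rw [Real.rpow_add (by rw [hnr]; positivity), ← Real.mul_rpow (by positivity) (by positivity)]
        have hsn : (s : ℝ) ≤ n := by
          rw [hnr]; exact le_mul_of_one_le_left (by positivity) (one_le_pow₀ hf1)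
        have hfn : (f : ℝ) * s ≤ n := by
          rw [hnr]; gcongr; exact le_self_pow₀ hf1 two_ne_zero
        gcongr

end Mom

namespace Mom
open Finset

lemma jac_abs_le (a : ℤ) (n : ℕ) : |(jacobiSym a n : ℝ)| ≤ 1 := by
  rcases jacobiSym.trichotomy a n with h | h | h <;> rw [h] <;> norm_num

/-- finite Abel summation bound -/
lemma abel_bound (a g : ℕ → ℝ) (A M : ℕ) (hAM : A ≤ M) (B : ℝ)
    (hB : ∀ N, |∑ i ∈ range N, a i| ≤ B) (hg0 : ∀ n, A ≤ n → 0 ≤ g n)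
    (hg : ∀ n, A ≤ n → g (n + 1) ≤ g n) :
    |∑ n ∈ Ico A M, a n * g n| ≤ 2 * B * g A := by
  have key : ∀ M, A ≤ M → ∑ n ∈ Ico A M, a n * g n =
      (∑ i ∈ range M, a i) * g M - (∑ i ∈ range A, a i) * g A +
        ∑ n ∈ Ico A M, (∑ i ∈ range (n + 1), a i) * (g n - g (n + 1)) := by
    intro M hM
    induction M, hM using Nat.le_induction with
    | base => simp
    | succ n hn ih =>
      rw [Finset.sum_Ico_succ_top hn, Finset.sum_Ico_succ_top hn, ih, Finset.sum_range_succ]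
      ring
  have hB0 : 0 ≤ B := (abs_nonneg _).trans (hB 0)
  rw [key M hAM]
  have h1 : |∑ n ∈ Ico A M, (∑ i ∈ range (n + 1), a i) * (g n - g (n + 1))| ≤ B * (g A - g M) := by
    refine (Finset.abs_sum_le_sum_abs _ _).trans ?_
    have : ∀ n ∈ Ico A M, |(∑ i ∈ range (n + 1), a i) * (g n - g (n + 1))| ≤ B * (g n - g (n + 1)) := by
      intro n hn
      rw [mem_Ico] at hn
      have := hg n hn.1
      rw [abs_mul, abs_of_nonneg (by linarith : 0 ≤ g n - g (n + 1))]
      exact mul_le_mul_of_nonneg_right (hB _) (by linarith)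
    refine (Finset.sum_le_sum this).trans ?_
    rw [← Finset.mul_sum]
    have := Finset.sum_Ico_sub g hAM
    rw [← neg_sub (g M), ← this, ← Finset.sum_neg_distrib]
    simp
  have h2 : |(∑ i ∈ range M, a i) * g M| ≤ B * g M := by
    rw [abs_mul, abs_of_nonneg (hg0 M hAM)]
    exact mul_le_mul_of_nonneg_right (hB _) (hg0 M hAM)
  have h3 : |(∑ i ∈ range A, a i) * g A| ≤ B * g A := by
    rw [abs_mul, abs_of_nonneg (hg0 A le_rfl)]
    exact mul_le_mul_of_nonneg_right (hB _) (hg0 A le_rfl)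
  rw [abs_le] at h1 h2 h3 ⊢
  constructor <;> linarith [h1.1, h1.2, h2.1, h2.2, h3.1, h3.2]

lemma jac_mod8 (v : ℕ) (hv : v = 1 ∨ v = 2) (m n : ℕ) (hn : Odd n) (hm : Odd m) :
    jacobiSym ((v * m : ℕ) : ℤ) n =
      (jacobiSym v (n % 8) * (-1) ^ (m / 2 * (n % 8 / 2))) * jacobiSym n m := by
  have hn8 : Odd (n % 8) := by rw [Nat.odd_iff] at hn ⊢; omega
  push_cast
  rw [jacobiSym.mul_left, jacobiSym.quadratic_reciprocity hm hn]
  have e1 : jacobiSym v n = jacobiSym v (n % 8) := by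
    rcases hv with rfl | rfl
    · simp
    · push_cast
      rw [jacobiSym.at_two hn, jacobiSym.at_two hn8]
      congr 1
      exact (ZMod.natCast_mod n 8).symm
  have e2 : ((-1 : ℤ)) ^ (m / 2 * (n / 2)) = (-1) ^ (m / 2 * (n % 8 / 2)) := by
    rw [pow_mul', pow_mul']
    congr 1
    have : n / 2 = n % 8 / 2 + 2 * (2 * (n / 8)) := by omega
    rw [this, pow_add, pow_mul]; simp
  rw [e1, e2]; ring

/-- PV in the denominator variable -/
theorem pv_dual (η : ℝ) (hη : 0 < η) : ∃ C : ℝ, 1 ≤ C ∧ ∀ v k d N : ℕ, (v = 1 ∨ v = 2) → Odd k →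
    ¬ IsSquare k → Odd d →
    |∑ n ∈ range N, if Odd n then (jacobiSym ((v * (k * d ^ 2) : ℕ) : ℤ) n : ℝ) else 0| ≤
      C * (k : ℝ) ^ (1 / 2 + η) * (d : ℝ) ^ η := by
  obtain ⟨C, hC1, hC⟩ := pv η hη
  refine ⟨4 * C, by linarith, ?_⟩
  intro v k d N hv hk hks hd
  have hm : Odd (k * d ^ 2) := hk.mul hd.pow
  have : (∑ n ∈ range N, if Odd n then (jacobiSym ((v * (k * d ^ 2) : ℕ) : ℤ) n : ℝ) else 0) =
      ∑ b ∈ ({1, 3, 5, 7} : Finset ℕ), ((jacobiSym v b * (-1) ^ ((k * d ^ 2) / 2 * (b / 2)) : ℤ) : ℝ) *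
        ∑ n ∈ (range N).filter (fun n => n % 8 = b), (jacobiSym n (k * d ^ 2) : ℝ) := by
    simp_rw [Finset.mul_sum, Finset.sum_filter]
    rw [Finset.sum_comm]
    refine Finset.sum_congr rfl fun n _ => ?_
    rw [Finset.sum_ite_eq]
    have : n % 8 ∈ ({1, 3, 5, 7} : Finset ℕ) ↔ Odd n := by
      rw [Nat.odd_iff]; simp; omega
    simp only [this]
    split_ifs with ho
    · rw [jac_mod8 v hv _ n ho hm]; push_cast; rfl
    · rfl
  rw [this]
  refine (Finset.abs_sum_le_sum_abs _ _).trans ?_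
  have hb : ∀ b ∈ ({1, 3, 5, 7} : Finset ℕ), |((jacobiSym v b * (-1) ^ ((k * d ^ 2) / 2 * (b / 2)) : ℤ) : ℝ) *
        ∑ n ∈ (range N).filter (fun n => n % 8 = b), (jacobiSym n (k * d ^ 2) : ℝ)| ≤
        C * (k : ℝ) ^ (1 / 2 + η) * (d : ℝ) ^ η := by
    intro b _
    rw [abs_mul]
    have h1 : |((jacobiSym v b * (-1) ^ ((k * d ^ 2) / 2 * (b / 2)) : ℤ) : ℝ)| ≤ 1 := by
      push_cast
      rw [abs_mul, abs_pow, abs_neg, abs_one, one_pow, mul_one]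
      exact jac_abs_le _ _
    calc _ ≤ 1 * _ := mul_le_mul_of_nonneg_right h1 (abs_nonneg _)
      _ ≤ _ := by rw [one_mul]; exact hC k d b N hk hks hd
  refine (Finset.sum_le_card_nsmul _ _ _ hb).trans ?_
  simp only [nsmul_eq_mul]
  rw [show (#({1, 3, 5, 7} : Finset ℕ)) = 4 from rfl]
  push_cast
  linarith

/-- odd integers in a dyadic block -/
def blk (j : ℕ) : Finset ℕ := (Ico (2 ^ j) (2 ^ (j + 1))).filter Odd

noncomputable def T (v j m : ℕ) : ℝ := ∑ n ∈ blk j, (jacobiSym ((v * m : ℕ) : ℤ) n : ℝ) / n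

lemma mem_blk {j n : ℕ} : n ∈ blk j ↔ (2 ^ j ≤ n ∧ n < 2 ^ (j + 1)) ∧ Odd n := by
  simp [blk]

lemma card_blk (j : ℕ) : (blk j).card ≤ 2 ^ j := by
  refine (Finset.card_filter_le _ _).trans ?_
  rw [Nat.card_Ico, pow_succ]; omega

lemma T_le_one (v j m : ℕ) : |T v j m| ≤ 1 := by
  unfold T
  refine (Finset.abs_sum_le_sum_abs _ _).trans ?_
  have : ∀ n ∈ blk j, |(jacobiSym ((v * m : ℕ) : ℤ) n : ℝ) / n| ≤ 1 / 2 ^ j := by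
    intro n hn
    rw [mem_blk] at hn
    rw [abs_div, Nat.abs_cast]
    have : (2 : ℝ) ^ j ≤ n := by exact_mod_cast hn.1.1
    gcongr
    exact jac_abs_le _ _
  refine (Finset.sum_le_card_nsmul _ _ _ this).trans ?_
  rw [nsmul_eq_mul, mul_one_div, div_le_one (by positivity)]
  exact_mod_cast card_blk j

theorem T_pv (η : ℝ) (hη : 0 < η) : ∃ C : ℝ, 1 ≤ C ∧ ∀ v k d j : ℕ, (v = 1 ∨ v = 2) → Odd k →
    ¬ IsSquare k → Odd d → |T v j (k * d ^ 2)| ≤ C * (k : ℝ) ^ (1 / 2 + η) * (d : ℝ) ^ η / 2 ^ j := by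
  obtain ⟨C, hC1, hC⟩ := pv_dual η hη
  refine ⟨2 * C, by linarith, ?_⟩
  intro v k d j hv hk hks hd
  have := abel_bound (fun n => if Odd n then (jacobiSym ((v * (k * d ^ 2) : ℕ) : ℤ) n : ℝ) else 0)
    (fun n => 1 / (n : ℝ)) (2 ^ j) (2 ^ (j + 1)) (by rw [pow_succ]; omega) _
    (fun N => hC v k d N hv hk hks hd) (fun n _ => by positivity) (by
      intro n hn
      have : 0 < n := lt_of_lt_of_le (by positivity) hn
      have : (0 : ℝ) < n := by exact_mod_cast this
      push_cast
      gcongr; linarith)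
  have e : T v j (k * d ^ 2) = ∑ n ∈ Ico (2 ^ j) (2 ^ (j + 1)),
      (if Odd n then (jacobiSym ((v * (k * d ^ 2) : ℕ) : ℤ) n : ℝ) else 0) * (1 / (n : ℝ)) := by
    unfold T blk
    rw [Finset.sum_filter]
    refine Finset.sum_congr rfl fun n _ => ?_
    split_ifs <;> ring
  rw [e]
  refine this.trans (le_of_eq ?_)
  push_cast; ring

section box
variable {ι : Type} [Fintype ι] [DecidableEq ι]

def box (f : ι → ℕ) : Finset (ι → ℕ) := Fintype.piFinset (fun i => blk (f i))

lemma prod_T (v m : ℕ) (f : ι → ℕ) :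
    ∏ i, T v (f i) m = ∑ t ∈ box f, (jacobiSym ((v * m : ℕ) : ℤ) (∏ i, t i) : ℝ) / (∏ i, t i : ℕ) := by
  unfold T box
  rw [Finset.prod_univ_sum]
  refine Finset.sum_congr rfl fun t ht => ?_
  rw [Finset.prod_div_distrib]
  congr 1
  · have : ∀ s : Finset ι, (∏ i ∈ s, (jacobiSym ((v * m : ℕ) : ℤ) (t i) : ℝ)) =
        (jacobiSym ((v * m : ℕ) : ℤ) (∏ i ∈ s, t i) : ℝ) := by
      intro s
      induction s using Finset.induction_on with
      | empty => simp
      | insert a s ha ih =>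
        rw [Finset.prod_insert ha, Finset.prod_insert ha, ih]
        have hne : ∀ i, t i ≠ 0 := by
          intro i
          have := (Fintype.mem_piFinset.1 ht) i
          rw [mem_blk] at this
          exact this.2.pos.ne'
        have : NeZero (t a) := ⟨hne a⟩
        have : NeZero (∏ i ∈ s, t i) := ⟨Finset.prod_ne_zero_iff.2 fun i _ => hne i⟩
        rw [jacobiSym.mul_right]; push_cast; rfl
    exact this univ
  · push_cast; rfl

lemma card_box (f : ι → ℕ) : (box f).card ≤ 2 ^ (∑ i, f i) := by
  unfold box
  rw [Fintype.card_piFinset, ← Finset.prod_pow_eq_pow_sum]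
  exact Finset.prod_le_prod' fun i _ => card_blk _

lemma box_bounds {f t : ι → ℕ} (ht : t ∈ box f) :
    2 ^ (∑ i, f i) ≤ ∏ i, t i ∧ ∏ i, t i ≤ 2 ^ (∑ i, f i + Fintype.card ι) ∧ Odd (∏ i, t i) := by
  have h : ∀ i, t i ∈ blk (f i) := fun i => (Fintype.mem_piFinset.1 ht) i
  simp only [mem_blk] at h
  refine ⟨?_, ?_, ?_⟩
  · rw [← Finset.prod_pow_eq_pow_sum]
    exact Finset.prod_le_prod' fun i _ => (h i).1.1
  · rw [show ∑ i, f i + Fintype.card ι = ∑ i, (f i + 1) by simp [Finset.sum_add_distrib],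
      ← Finset.prod_pow_eq_pow_sum]
    exact Finset.prod_le_prod' fun i _ => (h i).1.2.le
  · exact Finset.prod_induction _ Odd (fun a b ha hb => ha.mul hb) odd_one (fun i _ => (h i).2)

lemma card_fiber (B : Finset (ι → ℕ)) (n : ℕ) (hn : n ≠ 0) :
    (B.filter (fun t => ∏ i, t i = n)).card ≤ n.divisors.card ^ Fintype.card ι := by
  classical
  calc _ ≤ (Fintype.piFinset (fun _ : ι => n.divisors)).card := by
        apply Finset.card_le_card
        intro t ht
        rw [mem_filter] at ht
        rw [Fintype.mem_piFinset]
        intro i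
        rw [Nat.mem_divisors]
        exact ⟨ht.2 ▸ Finset.dvd_prod_of_mem t (mem_univ i), hn⟩
    _ = _ := by rw [Fintype.card_piFinset]; simp

end box
end Mom

namespace Mom
open Finset

lemma div_pow_bound (η : ℝ) (hη : 0 < η) (R : ℕ) :
    ∃ C : ℝ, 1 ≤ C ∧ ∀ n : ℕ, n ≠ 0 → ((n.divisors.card : ℝ)) ^ R ≤ C * (n : ℝ) ^ η := by
  obtain ⟨C, hC1, hC⟩ := divisor_bound (η / (R + 1)) (by positivity)
  refine ⟨C ^ R, one_le_pow₀ hC1, fun n hn => ?_⟩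
  have hn1 : (1 : ℝ) ≤ n := by exact_mod_cast Nat.one_le_iff_ne_zero.2 hn
  calc ((n.divisors.card : ℝ)) ^ R ≤ (C * (n : ℝ) ^ (η / (R + 1))) ^ R := by
        gcongr; exact hC n hn
    _ = C ^ R * (n : ℝ) ^ (η / (R + 1) * R) := by
        rw [mul_pow, ← Real.rpow_natCast ((n : ℝ) ^ _), ← Real.rpow_mul (by positivity)]
    _ ≤ C ^ R * (n : ℝ) ^ η := by
        gcongr
        rw [div_mul_eq_mul_div, div_le_iff₀ (by positivity)]; nlinarith

section box
variable {ι : Type} [Fintype ι] [DecidableEq ι]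

/-- size of box, as a real -/
noncomputable def bN (f : ι → ℕ) : ℝ := 2 ^ (∑ i, f i)

lemma bN_one_le (f : ι → ℕ) : 1 ≤ bN f := one_le_pow₀ (by norm_num)

lemma bN_pos (f : ι → ℕ) : 0 < bN f := by unfold bN; positivity

lemma box_real {f t : ι → ℕ} (ht : t ∈ box f) :
    bN f ≤ ((∏ i, t i : ℕ) : ℝ) ∧ ((∏ i, t i : ℕ) : ℝ) ≤ 2 ^ (Fintype.card ι) * bN f := by
  obtain ⟨h1, h2, _⟩ := box_bounds ht
  unfold bN
  constructor
  · exact_mod_cast h1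
  · rw [← pow_add, add_comm]; exact_mod_cast h2

lemma box_pow {f t : ι → ℕ} (ht : t ∈ box f) {x : ℝ} (hx : 0 ≤ x) :
    (((∏ i, t i : ℕ) : ℝ)) ^ x ≤ (2 ^ (Fintype.card ι) : ℝ) ^ x * bN f ^ x := by
  rw [← Real.mul_rpow (by positivity) (bN_pos f).le]
  exact Real.rpow_le_rpow (by positivity) (box_real ht).2 hx

theorem card_sq (ι : Type) [Fintype ι] [DecidableEq ι] (η : ℝ) (hη : 0 < η) : ∃ C : ℝ, 1 ≤ C ∧ ∀ f : ι → ℕ,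
    (((box f).filter (fun t => IsSquare (∏ i, t i))).card : ℝ) ≤ C * bN f ^ (1 / 2 + η) := by
  obtain ⟨C, hC1, hC⟩ := div_pow_bound η hη (Fintype.card ι)
  set R := Fintype.card ι with hR
  refine ⟨C * (2 ^ R) ^ (1 / 2 + η), ?_, ?_⟩
  · have : (1 : ℝ) ≤ (2 ^ R) ^ (1 / 2 + η) := Real.one_le_rpow (one_le_pow₀ (by norm_num)) (by positivity)
    nlinarith
  intro f
  set Q := Nat.sqrt (2 ^ (∑ i, f i + R)) with hQ
  have hmap : ∀ t ∈ (box f).filter (fun t => IsSquare (∏ i, t i)), Nat.sqrt (∏ i, t i) ∈ Icc 1 Q := by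
    intro t ht
    rw [mem_filter] at ht
    obtain ⟨h1, h2, h3⟩ := box_bounds ht.1
    rw [mem_Icc]
    exact ⟨Nat.sqrt_pos.2 h3.pos, Nat.sqrt_le_sqrt h2⟩
  have hQr : (Q : ℝ) ≤ (2 ^ R * bN f) ^ (1 / 2 : ℝ) := by
    rw [← Real.sqrt_eq_rpow]
    apply Real.le_sqrt_of_sq_le
    have : Q ^ 2 ≤ 2 ^ (∑ i, f i + R) := Nat.sqrt_le' _
    unfold bN
    rw [← pow_add, add_comm R]
    exact_mod_cast this
  rw [Finset.card_eq_sum_card_fiberwise hmap]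
  push_cast
  have hfib : ∀ q ∈ Icc 1 Q, (#{a ∈ (box f).filter (fun t => IsSquare (∏ i, t i)) | Nat.sqrt (∏ i, a i) = q} : ℝ) ≤
      C * (2 ^ R * bN f) ^ η := by
    intro q hq
    rw [mem_Icc] at hq
    have hq0 : q * q ≠ 0 := by have := hq.1; positivity
    have h1 : #{a ∈ (box f).filter (fun t => IsSquare (∏ i, t i)) | Nat.sqrt (∏ i, a i) = q} ≤
        ((box f).filter (fun t => ∏ i, t i = q * q)).card := by
      apply Finset.card_le_card
      intro t
      simp only [mem_filter]
      rintro ⟨⟨h1, ⟨s, hs⟩⟩, h3⟩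
      rw [hs, Nat.sqrt_eq] at h3
      exact ⟨h1, by rw [hs, h3]⟩
    have h2 := h1.trans (card_fiber (box f) (q * q) hq0)
    have hqq : ((q * q : ℕ) : ℝ) ≤ 2 ^ R * bN f := by
      have : q * q ≤ 2 ^ (∑ i, f i + R) := Nat.le_sqrt.1 hq.2
      unfold bN
      rw [← pow_add, add_comm R]
      exact_mod_cast this
    calc _ ≤ (((q * q).divisors.card : ℝ)) ^ R := by exact_mod_cast h2
      _ ≤ C * ((q * q : ℕ) : ℝ) ^ η := hC _ hq0
      _ ≤ _ := by gcongr
  refine (Finset.sum_le_card_nsmul _ _ _ hfib).trans ?_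
  rw [nsmul_eq_mul, Nat.card_Icc, Nat.add_sub_cancel]
  have hp : 0 < 2 ^ R * bN f := mul_pos (by positivity) (bN_pos f)
  calc (Q : ℝ) * (C * (2 ^ R * bN f) ^ η) ≤ (2 ^ R * bN f) ^ (1 / 2 : ℝ) * (C * (2 ^ R * bN f) ^ η) := by
        gcongr
    _ = C * (2 ^ R * bN f) ^ (1 / 2 + η) := by rw [Real.rpow_add hp]; ring
    _ = _ := by rw [Real.mul_rpow (by positivity) (bN_pos f).le]; ring

lemma jac_split (v k d n : ℕ) : (jacobiSym ((v * (k * d ^ 2) : ℕ) : ℤ) n : ℝ) =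
    (jacobiSym (v * d ^ 2) n : ℝ) * (jacobiSym k n : ℝ) := by
  rw [← Int.cast_mul, ← jacobiSym.mul_left]
  congr 2; push_cast; ring

theorem nonsq_bound (ι : Type) [Fintype ι] [DecidableEq ι] (η : ℝ) (hη : 0 < η) : ∃ C : ℝ, 1 ≤ C ∧
    ∀ (f : ι → ℕ) (v d a Z : ℕ),
    ∑ t ∈ (box f).filter (fun t => ¬ IsSquare (∏ i, t i)),
      |∑ k ∈ (range Z).filter (fun k => k % 8 = a),
        (jacobiSym ((v * (k * d ^ 2) : ℕ) : ℤ) (∏ i, t i) : ℝ)| / (∏ i, t i : ℕ) ≤ C * bN f ^ (1 / 2 + η) := by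
  obtain ⟨C, hC1, hC⟩ := pv η hη
  set R := Fintype.card ι with hR
  refine ⟨C * (2 ^ R) ^ (1 / 2 + η), ?_, ?_⟩
  · have : (1 : ℝ) ≤ (2 ^ R) ^ (1 / 2 + η) := Real.one_le_rpow (one_le_pow₀ (by norm_num)) (by positivity)
    nlinarith
  intro f v d a Z
  have hb : ∀ t ∈ (box f).filter (fun t => ¬ IsSquare (∏ i, t i)),
      |∑ k ∈ (range Z).filter (fun k => k % 8 = a),
        (jacobiSym ((v * (k * d ^ 2) : ℕ) : ℤ) (∏ i, t i) : ℝ)| / (∏ i, t i : ℕ) ≤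
      (C * ((2 ^ R) ^ (1 / 2 + η) * bN f ^ (1 / 2 + η))) / bN f := by
    intro t ht
    rw [mem_filter] at ht
    have hB := bN_pos f
    gcongr
    · simp_rw [jac_split, ← Finset.mul_sum]
      rw [abs_mul]
      have h1 := hC (∏ i, t i) 1 a Z (box_bounds ht.1).2.2 ht.2 odd_one
      simp only [one_pow, mul_one, Nat.cast_one, Real.one_rpow] at h1
      calc _ ≤ 1 * _ := mul_le_mul_of_nonneg_right (jac_abs_le _ _) (abs_nonneg _)
        _ ≤ _ := by
          rw [one_mul]; refine h1.trans ?_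
          gcongr
          exact box_pow ht.1 (by positivity)
    · exact (box_real ht.1).1
  refine (Finset.sum_le_card_nsmul _ _ _ hb).trans ?_
  rw [nsmul_eq_mul]
  have hc : (((box f).filter (fun t => ¬ IsSquare (∏ i, t i))).card : ℝ) ≤ bN f := by
    have := (Finset.card_filter_le (box f) (fun t => ¬ IsSquare (∏ i, t i))).trans (card_box f)
    unfold bN; exact_mod_cast this
  have hB := bN_pos f
  calc _ ≤ bN f * ((C * ((2 ^ R) ^ (1 / 2 + η) * bN f ^ (1 / 2 + η))) / bN f) := by gcongr
    _ = _ := by field_simp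

end box

lemma jac_of_square (v m n : ℕ) (hv : v = 1 ∨ v = 2) (hn : Odd n) (hs : IsSquare n) :
    jacobiSym ((v * m : ℕ) : ℤ) n = if m.Coprime n then 1 else 0 := by
  obtain ⟨g, rfl⟩ := hs
  have hg0 : g ≠ 0 := by rintro rfl; simp at hn
  have hgo : Odd g := (Nat.odd_mul.1 hn).1
  rw [← pow_two, jac_sq_right _ _ hg0]
  have : (v * m).Coprime g ↔ m.Coprime (g ^ 2) := by
    rw [Nat.coprime_mul_iff_left, Nat.coprime_pow_right_iff (by norm_num)]
    constructor
    · exact fun h => h.2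
    · refine fun h => ⟨?_, h⟩
      rcases hv with rfl | rfl
      · exact Nat.coprime_one_left g
      · exact Nat.coprime_two_left.2 hgo
  simp only [this]

noncomputable def rho (n : ℕ) : ℝ := ∑ e ∈ n.divisors, (ArithmeticFunction.moebius e : ℝ) / e

lemma count_class (a e Z : ℕ) (ha : a < 8) (he : Odd e) (x : ℝ) (hx : (Z : ℝ) ≤ x) (hx2 : x < Z + 1) :
    |(((range (Z + 1)).filter (fun k => k % 8 = a ∧ e ∣ k)).card : ℝ) - x / (8 * e)| ≤ 2 := by
  have hco : Nat.Coprime 8 e := by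
    have : Nat.Coprime (2 ^ 3) e := Nat.Coprime.pow_left 3 (Nat.coprime_two_left.2 he)
    simpa using this
  obtain ⟨c, hc1, hc2⟩ := Nat.chineseRemainder hco a 0
  have e1 : (range (Z + 1)).filter (fun k => k % 8 = a ∧ e ∣ k) =
      (range (Z + 1)).filter (fun k => k ≡ c [MOD 8 * e]) := by
    apply Finset.filter_congr
    intro k _
    rw [← Nat.modEq_and_modEq_iff_modEq_mul hco]
    have : k % 8 = a ↔ k ≡ c [MOD 8] := by
      rw [Nat.ModEq] at hc1 ⊢; rw [hc1, Nat.mod_eq_of_lt ha]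
    have h2 : e ∣ k ↔ k ≡ c [MOD e] := by
      rw [← Nat.modEq_zero_iff_dvd]
      exact ⟨fun h => h.trans hc2.symm, fun h => h.trans hc2⟩
    rw [this, h2]
  have hr : 0 < 8 * e := by have := he.pos; positivity
  rw [e1, ← Nat.count_eq_card_filter_range, Nat.count_modEq_card _ hr]
  have hdm := Nat.div_add_mod (Z + 1) (8 * e)
  have hlt := Nat.mod_lt (Z + 1) hr
  set q := (Z + 1) / (8 * e)
  set s := (Z + 1) % (8 * e)
  have hr' : (0 : ℝ) < 8 * e := by exact_mod_cast hr
  have h8 : (8 : ℝ) ≤ 8 * e := by have := he.pos; have : (1 : ℝ) ≤ e := by exact_mod_cast this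
                                  linarith
  have hdm' : (8 * e : ℝ) * q + s = Z + 1 := by exact_mod_cast hdm
  have hlt' : (s : ℝ) < 8 * e := by exact_mod_cast hlt
  have hs0 : (0 : ℝ) ≤ s := by positivity
  have hb1 : x / (8 * e) ≤ q + 1 := by
    rw [div_le_iff₀ hr']; nlinarith
  have hb2 : (q : ℝ) - 1 ≤ x / (8 * e) := by
    rw [le_div_iff₀ hr']; nlinarith
  push_cast
  rw [abs_le]
  split_ifs <;> push_cast <;> constructor <;> linarith

lemma count_coprime (a n Z : ℕ) (ha : a < 8) (hn : Odd n) (x : ℝ) (hx : (Z : ℝ) ≤ x) (hx2 : x < Z + 1) :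
    |(∑ k ∈ (range (Z + 1)).filter (fun k => k % 8 = a), (if k.Coprime n then (1 : ℝ) else 0)) - x * (rho n / 8)|
      ≤ 2 * n.divisors.card := by
  have hn0 : n ≠ 0 := hn.pos.ne'
  have e1 : (∑ k ∈ (range (Z + 1)).filter (fun k => k % 8 = a), (if k.Coprime n then (1 : ℝ) else 0)) =
      ∑ e ∈ n.divisors, (ArithmeticFunction.moebius e : ℝ) *
        (((range (Z + 1)).filter (fun k => k % 8 = a ∧ e ∣ k)).card : ℝ) := by
    have : ∀ k, (if k.Coprime n then (1 : ℝ) else 0) =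
        ∑ e ∈ n.divisors, (ArithmeticFunction.moebius e : ℝ) * (if e ∣ k then 1 else 0) := by
      intro k
      have := coprime_moebius k n hn0
      have h2 : (((if k.Coprime n then (1:ℤ) else 0) : ℤ) : ℝ) = if k.Coprime n then (1 : ℝ) else 0 := by
        split_ifs <;> simp
      rw [← h2, this, Finset.sum_filter]
      push_cast
      refine Finset.sum_congr rfl fun e _ => ?_
      split_ifs <;> simp
    simp_rw [this]
    rw [Finset.sum_comm]
    refine Finset.sum_congr rfl fun e _ => ?_
    rw [← Finset.mul_sum]
    congr 1
    rw [Finset.sum_boole, Finset.filter_filter]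
  rw [e1, rho, Finset.sum_div, Finset.mul_sum, ← Finset.sum_sub_distrib]
  refine (Finset.abs_sum_le_sum_abs _ _).trans ?_
  have : ∀ e ∈ n.divisors, |(ArithmeticFunction.moebius e : ℝ) *
        (((range (Z + 1)).filter (fun k => k % 8 = a ∧ e ∣ k)).card : ℝ) -
        x * ((ArithmeticFunction.moebius e : ℝ) / e / 8)| ≤ 2 := by
    intro e he
    have heo : Odd e := Odd.of_dvd_nat hn (Nat.dvd_of_mem_divisors he)
    have := count_class a e Z ha heo x hx hx2
    rw [show (ArithmeticFunction.moebius e : ℝ) *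
        (((range (Z + 1)).filter (fun k => k % 8 = a ∧ e ∣ k)).card : ℝ) -
        x * ((ArithmeticFunction.moebius e : ℝ) / e / 8) = (ArithmeticFunction.moebius e : ℝ) *
        ((((range (Z + 1)).filter (fun k => k % 8 = a ∧ e ∣ k)).card : ℝ) - x / (8 * e)) by
        have : (e : ℝ) ≠ 0 := by have := heo.pos; positivity
        field_simp, abs_mul]
    have hm : |(ArithmeticFunction.moebius e : ℝ)| ≤ 1 := by
      exact_mod_cast ArithmeticFunction.abs_moebius_le_one (n := e)
    calc _ ≤ 1 * (2:ℝ) := by gcongr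
      _ = 2 := one_mul _
  refine (Finset.sum_le_card_nsmul _ _ _ this).trans ?_
  rw [nsmul_eq_mul, mul_comm]

lemma rho_nonneg (n : ℕ) (hn : Odd n) : 0 ≤ rho n := by
  by_contra h
  push Not at h
  obtain ⟨Z, hZ⟩ := exists_nat_gt ((2 * n.divisors.card : ℝ) / (-rho n / 8))
  have h1 := count_coprime 0 n Z (by norm_num) hn Z le_rfl (by linarith)
  have h2 : 0 ≤ (∑ k ∈ (range (Z + 1)).filter (fun k => k % 8 = 0), (if k.Coprime n then (1 : ℝ) else 0)) :=
    Finset.sum_nonneg fun k _ => by split_ifs <;> norm_num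
  rw [div_lt_iff₀ (by linarith)] at hZ
  rw [abs_le] at h1
  linarith [h1.2]

lemma rho_le (n : ℕ) : rho n ≤ n.divisors.card := by
  unfold rho
  have : ∀ e ∈ n.divisors, (ArithmeticFunction.moebius e : ℝ) / e ≤ 1 := by
    intro e he
    have h1 : 1 ≤ e := Nat.pos_of_mem_divisors he
    have h2 : (1 : ℝ) ≤ e := by exact_mod_cast h1
    have hm : (ArithmeticFunction.moebius e : ℝ) ≤ 1 := by
      exact_mod_cast (le_abs_self _).trans (ArithmeticFunction.abs_moebius_le_one (n := e))
    rw [div_le_one (by linarith)]; linarith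
  simpa using Finset.sum_le_card_nsmul _ _ _ this

end Mom

namespace Mom
open Finset

section box
variable {ι : Type} [Fintype ι] [DecidableEq ι]

noncomputable def Af (f : ι → ℕ) (d : ℕ) : ℝ :=
  ∑ t ∈ (box f).filter (fun t => IsSquare (∏ i, t i)),
    (if d.Coprime (∏ i, t i) then rho (∏ i, t i) / 8 / (∏ i, t i : ℕ) else 0)

lemma Af_nonneg (f : ι → ℕ) (d : ℕ) : 0 ≤ Af f d := by
  unfold Af
  refine Finset.sum_nonneg fun t ht => ?_
  rw [mem_filter] at ht
  have := rho_nonneg _ (box_bounds ht.1).2.2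
  split_ifs
  · positivity
  · exact le_rfl

theorem Af_le (ι : Type) [Fintype ι] [DecidableEq ι] (η : ℝ) (hη : 0 < η) : ∃ C : ℝ, 1 ≤ C ∧
    ∀ (f : ι → ℕ) (d : ℕ), Af f d ≤ C * bN f ^ (-(1 / 2) + η) := by
  obtain ⟨C1, hC1, h1⟩ := card_sq ι (η / 2) (by positivity)
  obtain ⟨C2, hC2, h2⟩ := divisor_bound (η / 2) (by positivity)
  set R := Fintype.card ι with hR
  have h2R : (1 : ℝ) ≤ (2 ^ R) ^ (η / 2) := Real.one_le_rpow (one_le_pow₀ (by norm_num)) (by positivity)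
  refine ⟨C1 * (C2 * (2 ^ R) ^ (η / 2)), ?_, ?_⟩
  · have : 1 ≤ C2 * (2 ^ R) ^ (η / 2) := by nlinarith
    nlinarith
  intro f d
  have hB := bN_pos f
  have hb : ∀ t ∈ (box f).filter (fun t => IsSquare (∏ i, t i)),
      (if d.Coprime (∏ i, t i) then rho (∏ i, t i) / 8 / (∏ i, t i : ℕ) else 0) ≤
        C2 * ((2 ^ R) ^ (η / 2) * bN f ^ (η / 2)) / bN f := by
    intro t ht
    rw [mem_filter] at ht
    have ho := (box_bounds ht.1).2.2
    have hr0 := rho_nonneg _ ho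
    split_ifs
    · have hn := (box_real ht.1).1
      gcongr
      calc rho (∏ i, t i) / 8 ≤ rho (∏ i, t i) := by linarith
        _ ≤ _ := rho_le _
        _ ≤ _ := h2 _ ho.pos.ne'
        _ ≤ _ := by gcongr; exact box_pow ht.1 (by positivity)
    · positivity
  unfold Af
  refine (Finset.sum_le_card_nsmul _ _ _ hb).trans ?_
  rw [nsmul_eq_mul]
  calc _ ≤ (C1 * bN f ^ (1 / 2 + η / 2)) * (C2 * ((2 ^ R) ^ (η / 2) * bN f ^ (η / 2)) / bN f) := by
        gcongr; exact h1 f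
    _ = C1 * (C2 * (2 ^ R) ^ (η / 2)) * (bN f ^ (1 / 2 + η / 2) * bN f ^ (η / 2) * bN f ^ (-1 : ℝ)) := by
        rw [Real.rpow_neg_one]; ring
    _ = _ := by
        rw [← Real.rpow_add hB, ← Real.rpow_add hB]; congr 2; ring

noncomputable def Wd (f : ι → ℕ) (v a Z d : ℕ) : ℝ :=
  ∑ k ∈ (range (Z + 1)).filter (fun k => k % 8 = a), ∏ i, T v (f i) (k * d ^ 2)

theorem W_main (ι : Type) [Fintype ι] [DecidableEq ι] (η : ℝ) (hη : 0 < η) : ∃ C : ℝ, 1 ≤ C ∧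
    ∀ (f : ι → ℕ) (v d a Z : ℕ) (x : ℝ), (v = 1 ∨ v = 2) → a < 8 → (Z : ℝ) ≤ x → x < Z + 1 →
      |Wd f v a Z d - x * Af f d| ≤ C * bN f ^ (1 / 2 + η) := by
  obtain ⟨C1, hC1, h1⟩ := card_sq ι η hη
  obtain ⟨C2, hC2, h2⟩ := nonsq_bound ι η hη
  refine ⟨2 * C1 + C2, by linarith, ?_⟩
  intro f v d a Z x hv ha hx hx2
  set K := (range (Z + 1)).filter (fun k => k % 8 = a) with hK
  have e1 : Wd f v a Z d = ∑ t ∈ box f, (∑ k ∈ K, (jacobiSym ((v * (k * d ^ 2) : ℕ) : ℤ) (∏ i, t i) : ℝ)) /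
      (∏ i, t i : ℕ) := by
    unfold Wd
    simp_rw [prod_T]
    rw [Finset.sum_comm]
    refine Finset.sum_congr rfl fun t _ => ?_
    rw [Finset.sum_div]
  rw [e1, ← Finset.sum_filter_add_sum_filter_not (box f) (fun t => IsSquare (∏ i, t i))]
  have hns : |∑ t ∈ (box f).filter (fun t => ¬ IsSquare (∏ i, t i)),
      (∑ k ∈ K, (jacobiSym ((v * (k * d ^ 2) : ℕ) : ℤ) (∏ i, t i) : ℝ)) / (∏ i, t i : ℕ)| ≤
      C2 * bN f ^ (1 / 2 + η) := by
    refine (Finset.abs_sum_le_sum_abs _ _).trans ((Finset.sum_le_sum fun t _ => ?_).trans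
      (h2 f v d a (Z + 1)))
    rw [abs_div, Nat.abs_cast]
  have hsq : |∑ t ∈ (box f).filter (fun t => IsSquare (∏ i, t i)),
      (∑ k ∈ K, (jacobiSym ((v * (k * d ^ 2) : ℕ) : ℤ) (∏ i, t i) : ℝ)) / (∏ i, t i : ℕ) - x * Af f d| ≤
      2 * (C1 * bN f ^ (1 / 2 + η)) := by
    unfold Af
    rw [Finset.mul_sum, ← Finset.sum_sub_distrib]
    refine (Finset.abs_sum_le_sum_abs _ _).trans ?_
    have hb : ∀ t ∈ (box f).filter (fun t => IsSquare (∏ i, t i)),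
        |(∑ k ∈ K, (jacobiSym ((v * (k * d ^ 2) : ℕ) : ℤ) (∏ i, t i) : ℝ)) / (∏ i, t i : ℕ) -
          x * (if d.Coprime (∏ i, t i) then rho (∏ i, t i) / 8 / (∏ i, t i : ℕ) else 0)| ≤ 2 := by
      intro t ht
      rw [mem_filter] at ht
      have ho := (box_bounds ht.1).2.2
      set n := ∏ i, t i with hn
      have hj : ∀ k ∈ K, (jacobiSym ((v * (k * d ^ 2) : ℕ) : ℤ) n : ℝ) =
          (if d.Coprime n then 1 else 0) * (if k.Coprime n then (1 : ℝ) else 0) := by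
        intro k _
        rw [jac_of_square v _ n hv ho ht.2]
        have : (k * d ^ 2).Coprime n ↔ d.Coprime n ∧ k.Coprime n := by
          rw [Nat.coprime_mul_iff_left, Nat.coprime_pow_left_iff (by norm_num)]; tauto
        simp only [this]
        by_cases h1 : d.Coprime n
        · by_cases h2 : k.Coprime n
          · rw [if_pos ⟨h1, h2⟩, if_pos h1, if_pos h2]; norm_num
          · rw [if_neg (fun h => h2 h.2), if_neg h2]; norm_num
        · rw [if_neg (fun h => h1 h.1), if_neg h1]; norm_num
      rw [Finset.sum_congr rfl hj, ← Finset.mul_sum]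
      have hc := count_coprime a n Z ha ho x hx hx2
      have hn0 : (0 : ℝ) < n := by exact_mod_cast ho.pos
      split_ifs
      · rw [one_mul, show ∀ S : ℝ, S / n - x * (rho n / 8 / n) = (S - x * (rho n / 8)) / n by intro S; ring,
          abs_div, Nat.abs_cast, div_le_iff₀ hn0]
        refine hc.trans ?_
        gcongr
        exact Nat.card_divisors_le_self n
      · simp
    refine (Finset.sum_le_card_nsmul _ _ _ hb).trans ?_
    rw [nsmul_eq_mul, mul_comm]
    gcongr
    exact h1 f
  rw [abs_le] at hns hsq ⊢
  constructor <;> nlinarith [hns.1, hns.2, hsq.1, hsq.2]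

/-- F3: second moment -/
theorem second_moment (ι : Type) [Fintype ι] [DecidableEq ι] (η : ℝ) (hη : 0 < η) : ∃ C : ℝ, 1 ≤ C ∧
    ∀ (f : ι → ℕ) (v a X : ℕ), (v = 1 ∨ v = 2) → a < 8 →
      ∑ m ∈ (range (X + 1)).filter (fun m => m % 8 = a), (∏ i, T v (f i) m) ^ 2 ≤
        C * (X / bN f + bN f) * bN f ^ η := by
  obtain ⟨C1, hC1, h1⟩ := W_main (ι ⊕ ι) (η / 2) (by positivity)
  obtain ⟨C2, hC2, h2⟩ := Af_le (ι ⊕ ι) (η / 2) (by positivity)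
  refine ⟨C1 + C2, by linarith, ?_⟩
  intro f v a X hv ha
  have hw := h1 (Sum.elim f f) v 1 a X X hv ha le_rfl (by linarith)
  have hA := h2 (Sum.elim f f) 1
  have hB := bN_pos f
  have e : bN (Sum.elim f f) = bN f ^ (2 : ℝ) := by
    unfold bN
    rw [Fintype.sum_sum_type]
    simp only [Sum.elim_inl, Sum.elim_inr]
    norm_cast
    rw [← pow_mul]; congr 1; ring
  have e2 : Wd (Sum.elim f f) v a X 1 =
      ∑ m ∈ (range (X + 1)).filter (fun m => m % 8 = a), (∏ i, T v (f i) m) ^ 2 := by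
    unfold Wd
    refine Finset.sum_congr rfl fun m _ => ?_
    rw [Fintype.prod_sum_type]
    simp only [Sum.elim_inl, Sum.elim_inr]
    rw [one_pow, mul_one, pow_two]
  rw [e2, e, ← Real.rpow_mul hB.le] at hw
  rw [e, ← Real.rpow_mul hB.le] at hA
  rw [abs_le] at hw
  have p1 : bN f ^ (2 * (1 / 2 + η / 2)) = bN f * bN f ^ η := by
    rw [show 2 * (1 / 2 + η / 2) = 1 + η by ring, Real.rpow_add hB, Real.rpow_one]
  have p2 : bN f ^ (2 * (-(1 / 2) + η / 2)) = (bN f)⁻¹ * bN f ^ η := by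
    rw [show 2 * (-(1 / 2) + η / 2) = -1 + η by ring, Real.rpow_add hB, Real.rpow_neg_one]
  rw [p1] at hw
  rw [p2] at hA
  have q : 0 < bN f ^ η := by positivity
  have hX : (0 : ℝ) ≤ X := by positivity
  have := mul_le_mul_of_nonneg_left hA hX
  have h3 : ∑ m ∈ (range (X + 1)).filter (fun m => m % 8 = a), (∏ i, T v (f i) m) ^ 2 ≤
    X * (C2 * ((bN f)⁻¹ * bN f ^ η)) + C1 * (bN f * bN f ^ η) := by linarith [hw.2]
  refine h3.trans ?_
  have u1 : 0 ≤ X * (bN f)⁻¹ * bN f ^ η := by positivity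
  have u2 : 0 ≤ bN f * bN f ^ η := by positivity
  rw [div_eq_mul_inv]
  nlinarith

end box
end Mom

namespace Mom
open Finset

lemma sq_dvd_sq_mul (d b a : ℕ) (ha : Squarefree a) (hb : b ≠ 0) : d ^ 2 ∣ b ^ 2 * a ↔ d ∣ b := by
  constructor
  · intro h
    have ha0 : a ≠ 0 := ha.ne_zero
    have hd0 : d ≠ 0 := by
      rintro rfl
      have : b ^ 2 * a = 0 := by simpa using h
      simp_all
    rw [← Nat.factorization_le_iff_dvd hd0 hb]
    rw [← Nat.factorization_le_iff_dvd (by positivity) (by positivity)] at h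
    intro p
    have h1 := h p
    rw [Nat.factorization_mul (by positivity) ha0] at h1
    simp only [Nat.factorization_pow, Finsupp.coe_smul, Finsupp.coe_add, Pi.add_apply, Pi.smul_apply,
      smul_eq_mul] at h1
    have := ha.natFactorization_le_one p
    omega
  · intro h
    exact Dvd.dvd.mul_right (pow_dvd_pow_of_dvd h 2) a

lemma sqfree_ind (m n : ℕ) (hm : Odd m) (hmn : m < n) :
    (if Squarefree m then (1 : ℝ) else 0) =
      ∑ d ∈ (range n).filter Odd, (ArithmeticFunction.moebius d : ℝ) * (if d ^ 2 ∣ m then 1 else 0) := by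
  obtain ⟨a, b, hab, ha⟩ := Nat.sq_mul_squarefree m
  have hb0 : b ≠ 0 := by rintro rfl; simp at hab; rw [← hab] at hm; simp at hm
  have hbm : b ≤ m := by
    rw [← hab]
    have := Nat.pos_of_ne_zero ha.ne_zero
    have := Nat.pos_of_ne_zero hb0
    nlinarith [Nat.mul_le_mul this this]
  have hbo : Odd b := by
    rw [← hab] at hm
    have := (Nat.odd_mul.1 hm).1
    exact (Nat.odd_pow_iff (by norm_num)).1 this
  simp_rw [mul_ite, mul_one, mul_zero]
  rw [← Finset.sum_filter]
  have : ((range n).filter Odd).filter (fun d => d ^ 2 ∣ m) = b.divisors := by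
    ext d
    rw [mem_filter, mem_filter, mem_range, Nat.mem_divisors, ← hab, sq_dvd_sq_mul d b a ha hb0]
    constructor
    · exact fun h => ⟨h.2, hb0⟩
    · exact fun h => ⟨⟨((Nat.le_of_dvd (Nat.pos_of_ne_zero hb0) h.1).trans hbm).trans_lt hmn,
        Odd.of_dvd_nat hbo h.1⟩, h.1⟩
  rw [this]
  have h1 : ∑ e ∈ b.divisors, ArithmeticFunction.moebius e = if b = 1 then 1 else 0 := by
    rw [← ArithmeticFunction.coe_mul_zeta_apply, ArithmeticFunction.moebius_mul_coe_zeta,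
      ArithmeticFunction.one_apply]
  have h2 : (∑ e ∈ b.divisors, (ArithmeticFunction.moebius e : ℝ)) = if b = 1 then 1 else 0 := by
    exact_mod_cast congrArg (Int.cast : ℤ → ℝ) h1
  rw [h2]
  have : Squarefree m ↔ b = 1 := by
    constructor
    · intro h
      have := h b ⟨a, by rw [← hab]; ring⟩
      exact Nat.isUnit_iff.1 this
    · rintro rfl; rw [← hab]; simpa using ha
  simp only [this]

lemma odd_sq_mod8 (d k : ℕ) (hd : Odd d) : (k * d ^ 2) % 8 = k % 8 := by
  have : d ^ 2 % 8 = 1 := by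
    have h : d % 8 = 1 ∨ d % 8 = 3 ∨ d % 8 = 5 ∨ d % 8 = 7 := by rw [Nat.odd_iff] at hd; omega
    rw [Nat.pow_mod]
    rcases h with h | h | h | h <;> rw [h]
  rw [Nat.mul_mod, this, mul_one, Nat.mod_mod]

lemma sieve_id (g : ℕ → ℝ) (X a n : ℕ) (ha : Odd a) (hn : X < n) :
    ∑ m ∈ (range (X + 1)).filter (fun m => m % 8 = a), (if Squarefree m then g m else 0) =
    ∑ d ∈ (range n).filter Odd, (ArithmeticFunction.moebius d : ℝ) *
      ∑ k ∈ (range (X / d ^ 2 + 1)).filter (fun k => k % 8 = a), g (k * d ^ 2) := by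
  have e1 : ∀ m ∈ (range (X + 1)).filter (fun m => m % 8 = a), (if Squarefree m then g m else 0) =
      ∑ d ∈ (range n).filter Odd, (ArithmeticFunction.moebius d : ℝ) * (if d ^ 2 ∣ m then g m else 0) := by
    intro m hm
    rw [mem_filter, mem_range] at hm
    have hmo : Odd m := by rw [Nat.odd_iff] at ha ⊢; omega
    have := sqfree_ind m n hmo (by omega)
    rw [show (if Squarefree m then g m else 0) = (if Squarefree m then (1:ℝ) else 0) * g m by
      split_ifs <;> simp, this, Finset.sum_mul]
    refine Finset.sum_congr rfl fun d _ => ?_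
    split_ifs <;> ring
  rw [Finset.sum_congr rfl e1, Finset.sum_comm]
  refine Finset.sum_congr rfl fun d hd => ?_
  rw [mem_filter] at hd
  have hd0 : 0 < d ^ 2 := by have := hd.2.pos; positivity
  rw [← Finset.mul_sum]
  congr 1
  rw [← Finset.sum_filter]
  refine Finset.sum_nbij' (fun m => m / d ^ 2) (fun k => k * d ^ 2) ?_ ?_ ?_ ?_ ?_
  · intro m hm
    simp only [mem_filter, mem_range] at hm ⊢
    obtain ⟨c, hc⟩ := hm.2
    have hmc : m = c * d ^ 2 := by rw [hc]; ring
    have : m / d ^ 2 = c := by rw [hmc]; exact Nat.mul_div_cancel _ hd0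
    rw [this]
    refine ⟨?_, ?_⟩
    · have : c ≤ X / d ^ 2 := by rw [Nat.le_div_iff_mul_le hd0]; omega
      omega
    · rw [← odd_sq_mod8 d c hd.2, ← hmc]; exact hm.1.2
  · intro k hk
    simp only [mem_filter, mem_range] at hk ⊢
    have : k ≤ X / d ^ 2 := by omega
    rw [Nat.le_div_iff_mul_le hd0] at this
    exact ⟨⟨by omega, by rw [odd_sq_mod8 d k hd.2]; exact hk.2⟩, Dvd.intro_left _ rfl⟩
  · intro m hm
    simp only [mem_filter] at hm
    exact Nat.div_mul_cancel hm.2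
  · intro k _
    exact Nat.mul_div_cancel _ hd0
  · intro m hm
    simp only [mem_filter] at hm
    rw [Nat.div_mul_cancel hm.2]

section box
variable {ι : Type} [Fintype ι] [DecidableEq ι]

noncomputable def cterm (f : ι → ℕ) (d : ℕ) : ℝ :=
  if Odd d then (ArithmeticFunction.moebius d : ℝ) / (d : ℝ) ^ 2 * Af f d else 0

noncomputable def Mf (f : ι → ℕ) : ℝ := ∑' d, cterm f d

lemma moebius_abs (d : ℕ) : |(ArithmeticFunction.moebius d : ℝ)| ≤ 1 := by
  exact_mod_cast ArithmeticFunction.abs_moebius_le_one (n := d)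

lemma cterm_abs (f : ι → ℕ) (B : ℝ) (hB : ∀ d, Af f d ≤ B) (d : ℕ) :
    |cterm f d| ≤ B * ((d : ℝ) ^ 2)⁻¹ := by
  have h0 := Af_nonneg f d
  have := hB d
  unfold cterm
  split_ifs
  · rw [abs_mul, abs_div, abs_of_nonneg h0, abs_of_nonneg (by positivity : (0:ℝ) ≤ (d:ℝ)^2)]
    calc |(ArithmeticFunction.moebius d : ℝ)| / (d : ℝ) ^ 2 * Af f d ≤ 1 / (d : ℝ) ^ 2 * B := by
          gcongr; exact moebius_abs d
      _ = _ := by ring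
  · rw [abs_zero]; have : 0 ≤ B := h0.trans this
    positivity

lemma cterm_summable (f : ι → ℕ) : Summable (cterm f) := by
  obtain ⟨C, _, hC⟩ := Af_le ι 1 one_pos
  refine Summable.of_norm_bounded (g := fun d : ℕ => (C * bN f ^ (-(1 / 2) + 1 : ℝ)) * ((d : ℝ) ^ 2)⁻¹)
    ?_ (fun d => cterm_abs f _ (fun d => hC f d) d)
  exact (Real.summable_nat_pow_inv.2 (by norm_num)).mul_left _

lemma Mf_tendsto (f : ι → ℕ) : Filter.Tendsto (fun n => ∑ d ∈ range n, cterm f d) Filter.atTop (nhds (Mf f)) :=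
  (cterm_summable f).hasSum.tendsto_sum_nat

lemma partial_moebius (n s : ℕ) (hn : 2 ≤ n) :
    1 / 3 ≤ ∑ d ∈ range n, if Odd d ∧ d.Coprime s then (ArithmeticFunction.moebius d : ℝ) / (d : ℝ) ^ 2 else 0 := by
  have h1 := sum_Ioo_inv_sq_le (α := ℝ) 2 n
  have h2 : ∀ d ∈ Ioo 2 n, |(if Odd d ∧ d.Coprime s then (ArithmeticFunction.moebius d : ℝ) / (d : ℝ) ^ 2 else 0)|
      ≤ ((d : ℝ) ^ 2)⁻¹ := by
    intro d _
    split_ifs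
    · rw [abs_div, abs_of_nonneg (by positivity : (0:ℝ) ≤ (d:ℝ)^2), ← one_div]
      gcongr; exact moebius_abs d
    · rw [abs_zero]; positivity
  have h3 := (Finset.abs_sum_le_sum_abs _ _).trans ((Finset.sum_le_sum h2).trans h1)
  rw [abs_le] at h3
  have hr : range n = insert 0 (insert 1 ((Ico 2 3 ∩ range n) ∪ Ioo 2 n)) := by
    ext d; simp; omega
  have : ∑ d ∈ range n, (if Odd d ∧ d.Coprime s then (ArithmeticFunction.moebius d : ℝ) / (d : ℝ) ^ 2 else 0) =
      1 + ∑ d ∈ Ioo 2 n, (if Odd d ∧ d.Coprime s then (ArithmeticFunction.moebius d : ℝ) / (d : ℝ) ^ 2 else 0) := by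
    rw [hr, Finset.sum_insert (by simp), Finset.sum_insert (by simp), Finset.sum_union]
    · rw [if_neg (by simp), if_pos (by simp)]
      have : ∑ x ∈ Ico 2 3 ∩ range n, (if Odd x ∧ x.Coprime s then (ArithmeticFunction.moebius x : ℝ) / (x : ℝ) ^ 2 else 0) = 0 := by
        refine Finset.sum_eq_zero fun x hx => ?_
        have : x = 2 := by simp at hx; omega
        subst this
        rw [if_neg]; rintro ⟨h, _⟩; exact absurd h (by decide)
      rw [this]; simp
    · rw [Finset.disjoint_left]; intro x; simp; omega
  rw [this]
  norm_num at h3 ⊢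
  linarith [h3.1]

lemma partial_cterm (f : ι → ℕ) (n : ℕ) : ∑ d ∈ range n, cterm f d =
    ∑ t ∈ (box f).filter (fun t => IsSquare (∏ i, t i)), rho (∏ i, t i) / 8 / (∏ i, t i : ℕ) *
      ∑ d ∈ range n, if Odd d ∧ d.Coprime (∏ i, t i) then (ArithmeticFunction.moebius d : ℝ) / (d : ℝ) ^ 2 else 0 := by
  simp_rw [Finset.mul_sum]
  rw [Finset.sum_comm]
  refine Finset.sum_congr rfl fun d _ => ?_
  unfold cterm Af
  by_cases h : Odd d
  · rw [if_pos h, Finset.mul_sum]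
    refine Finset.sum_congr rfl fun t _ => ?_
    by_cases h2 : d.Coprime (∏ i, t i)
    · rw [if_pos h2, if_pos ⟨h, h2⟩]; ring
    · rw [if_neg h2, if_neg (fun h => h2 h.2)]; ring
  · rw [if_neg h]
    symm
    refine Finset.sum_eq_zero fun t _ => ?_
    rw [if_neg (fun hh => h hh.1), mul_zero]

lemma Mf_nonneg (f : ι → ℕ) : 0 ≤ Mf f := by
  refine ge_of_tendsto (Mf_tendsto f) ?_
  filter_upwards [Filter.eventually_ge_atTop 2] with n hn
  rw [partial_cterm]
  refine Finset.sum_nonneg fun t ht => ?_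
  rw [mem_filter] at ht
  have h1 := rho_nonneg _ (box_bounds ht.1).2.2
  have h2 := partial_moebius n (∏ i, t i) hn
  refine mul_nonneg (by positivity) (by linarith)

lemma blk_zero : blk 0 = {1} := by
  ext n; rw [mem_blk, mem_singleton]
  constructor
  · rintro ⟨⟨h1, h2⟩, _⟩; norm_num at h1 h2; omega
  · rintro rfl; norm_num

lemma Mf_zero_pos (f : ι → ℕ) (hf : ∀ i, f i = 0) : 1 / 24 ≤ Mf f := by
  refine ge_of_tendsto (Mf_tendsto f) ?_
  filter_upwards [Filter.eventually_ge_atTop 2] with n hn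
  rw [partial_cterm]
  have hb : box f = {fun _ => 1} := by
    unfold box
    simp_rw [hf, blk_zero]
    ext t; simp [Fintype.mem_piFinset, funext_iff]
  rw [hb, Finset.filter_singleton]
  simp only [prod_const_one, IsSquare.one, if_true, sum_singleton]
  have h2 := partial_moebius n 1 hn
  have : rho 1 = 1 := by simp [rho]
  rw [this]
  push_cast
  linarith

theorem Mf_le (ι : Type) [Fintype ι] [DecidableEq ι] (η : ℝ) (hη : 0 < η) : ∃ C : ℝ, 1 ≤ C ∧
    ∀ (f : ι → ℕ), Mf f ≤ C * bN f ^ (-(1 / 2) + η) := by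
  obtain ⟨C, hC1, hC⟩ := Af_le ι η hη
  refine ⟨2 * C, by linarith, fun f => ?_⟩
  refine le_of_tendsto' (Mf_tendsto f) fun n => ?_
  have h1 := sum_Ioo_inv_sq_le (α := ℝ) 0 n
  have h2 : ∑ d ∈ range n, cterm f d = ∑ d ∈ Ioo 0 n, cterm f d := by
    symm
    apply Finset.sum_subset
    · intro d; simp
    · intro d hd hd2
      have : d = 0 := by simp at hd hd2; omega
      subst this; simp [cterm]
  rw [h2]
  have hB := bN_pos f
  calc _ ≤ ∑ d ∈ Ioo 0 n, (C * bN f ^ (-(1 / 2) + η)) * ((d : ℝ) ^ 2)⁻¹ :=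
        Finset.sum_le_sum fun d _ => (le_abs_self _).trans (cterm_abs f _ (fun d => hC f d) d)
    _ = (C * bN f ^ (-(1 / 2) + η)) * ∑ d ∈ Ioo 0 n, ((d : ℝ) ^ 2)⁻¹ := by rw [Finset.mul_sum]
    _ ≤ (C * bN f ^ (-(1 / 2) + η)) * 2 := by
        gcongr; norm_num at h1 ⊢; exact h1
    _ = _ := by ring

lemma div_bounds (X d : ℕ) (hd : 0 < d) : ((X / d ^ 2 : ℕ) : ℝ) ≤ X / (d : ℝ) ^ 2 ∧
    X / (d : ℝ) ^ 2 < ((X / d ^ 2 : ℕ) : ℝ) + 1 := by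
  have h0 : 0 < d ^ 2 := by positivity
  have h0' : (0 : ℝ) < (d : ℝ) ^ 2 := by positivity
  constructor
  · rw [le_div_iff₀ h0']; exact_mod_cast Nat.div_mul_le_self X (d ^ 2)
  · rw [div_lt_iff₀ h0']; exact_mod_cast Nat.lt_mul_of_div_lt (Nat.lt_succ_self _) h0

/-- sum over squarefree m of the box product -/
noncomputable def Sf (f : ι → ℕ) (v a X : ℕ) : ℝ :=
  ∑ m ∈ (range (X + 1)).filter (fun m => m % 8 = a), (if Squarefree m then ∏ i, T v (f i) m else 0)

theorem sieve_bound (ι : Type) [Fintype ι] [DecidableEq ι] (η : ℝ) (hη : 0 < η) : ∃ C : ℝ, 1 ≤ C ∧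
    ∀ (f : ι → ℕ) (v a X : ℕ) (D : ℝ), (v = 1 ∨ v = 2) → a < 8 → Odd a → 1 ≤ D →
      |Sf f v a X - X * Mf f| ≤ C * D * bN f ^ (1 / 2 + η) + C * (X / D) * bN f ^ (-(1 / 2) + η) +
        ∑ d ∈ (range (X + 1)).filter (fun d : ℕ => Odd d ∧ D < d), |Wd f v a (X / d ^ 2) d| := by
  obtain ⟨C1, hC1, h1⟩ := W_main ι η hη
  obtain ⟨C2, hC2, h2⟩ := Af_le ι η hη
  refine ⟨C1 + 2 * C2, by linarith, ?_⟩
  intro f v a X D hv ha hao hD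
  have hB := bN_pos f
  refine le_of_tendsto (((Mf_tendsto f).const_mul (X : ℝ)).const_sub (Sf f v a X)).abs ?_
  filter_upwards [Filter.eventually_gt_atTop X] with n hn
  have e1 : Sf f v a X - X * ∑ d ∈ range n, cterm f d =
      ∑ d ∈ (range n).filter Odd, (ArithmeticFunction.moebius d : ℝ) *
        (Wd f v a (X / d ^ 2) d - X / (d : ℝ) ^ 2 * Af f d) := by
    unfold Sf
    rw [sieve_id (fun m => ∏ i, T v (f i) m) X a n hao hn]
    simp_rw [mul_sub]
    rw [Finset.sum_sub_distrib]
    congr 1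
    unfold cterm
    rw [← Finset.sum_filter, Finset.mul_sum]
    refine Finset.sum_congr rfl fun d _ => ?_
    ring
  rw [e1]
  refine (Finset.abs_sum_le_sum_abs _ _).trans ?_
  rw [← Finset.sum_filter_add_sum_filter_not _ (fun d : ℕ => D < d), add_comm]
  have hsmall : ∑ d ∈ ((range n).filter Odd).filter (fun d : ℕ => ¬ D < d), |(ArithmeticFunction.moebius d : ℝ) *
        (Wd f v a (X / d ^ 2) d - X / (d : ℝ) ^ 2 * Af f d)| ≤ C1 * D * bN f ^ (1 / 2 + η) := by
    have hb : ∀ d ∈ ((range n).filter Odd).filter (fun d : ℕ => ¬ D < d), |(ArithmeticFunction.moebius d : ℝ) *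
        (Wd f v a (X / d ^ 2) d - X / (d : ℝ) ^ 2 * Af f d)| ≤ C1 * bN f ^ (1 / 2 + η) := by
      intro d hd
      simp only [mem_filter] at hd
      obtain ⟨b1, b2⟩ := div_bounds X d hd.1.2.pos
      rw [abs_mul]
      calc _ ≤ 1 * (C1 * bN f ^ (1 / 2 + η)) := by
            gcongr
            · exact moebius_abs d
            · exact h1 f v d a _ _ hv ha b1 b2
        _ = _ := one_mul _
    refine (Finset.sum_le_card_nsmul _ _ _ hb).trans ?_
    rw [nsmul_eq_mul]
    have hc : ((((range n).filter Odd).filter (fun d : ℕ => ¬ D < d)).card : ℝ) ≤ D := by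
      have : ((range n).filter Odd).filter (fun d : ℕ => ¬ D < d) ⊆ Icc 1 ⌊D⌋₊ := by
        intro d hd
        simp only [mem_filter, not_lt] at hd
        rw [mem_Icc]
        exact ⟨hd.1.2.pos, Nat.le_floor hd.2⟩
      have := Finset.card_le_card this
      rw [Nat.card_Icc, Nat.add_sub_cancel] at this
      calc _ ≤ (⌊D⌋₊ : ℝ) := by exact_mod_cast this
        _ ≤ D := Nat.floor_le (by linarith)
    calc _ ≤ D * (C1 * bN f ^ (1 / 2 + η)) := by gcongr
      _ = _ := by ring
  have hlarge : ∑ d ∈ ((range n).filter Odd).filter (fun d : ℕ => D < d), |(ArithmeticFunction.moebius d : ℝ) *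
        (Wd f v a (X / d ^ 2) d - X / (d : ℝ) ^ 2 * Af f d)| ≤
        ∑ d ∈ (range (X + 1)).filter (fun d : ℕ => Odd d ∧ D < d), |Wd f v a (X / d ^ 2) d| +
          2 * C2 * (X / D) * bN f ^ (-(1 / 2) + η) := by
    have hb : ∀ d ∈ ((range n).filter Odd).filter (fun d : ℕ => D < d), |(ArithmeticFunction.moebius d : ℝ) *
        (Wd f v a (X / d ^ 2) d - X / (d : ℝ) ^ 2 * Af f d)| ≤ |Wd f v a (X / d ^ 2) d| +
          X * (C2 * bN f ^ (-(1 / 2) + η)) * ((d : ℝ) ^ 2)⁻¹ := by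
      intro d hd
      rw [abs_mul]
      have hA := Af_nonneg f d
      calc _ ≤ 1 * (|Wd f v a (X / d ^ 2) d| + |X / (d : ℝ) ^ 2 * Af f d|) := by
            gcongr
            · exact moebius_abs d
            · exact abs_sub _ _
        _ = |Wd f v a (X / d ^ 2) d| + X / (d : ℝ) ^ 2 * Af f d := by
            rw [one_mul, abs_of_nonneg (a := X / (d : ℝ) ^ 2 * Af f d) (by positivity)]
        _ ≤ |Wd f v a (X / d ^ 2) d| + X / (d : ℝ) ^ 2 * (C2 * bN f ^ (-(1 / 2) + η)) := by
            gcongr; exact h2 f d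
        _ = _ := by ring
    refine (Finset.sum_le_sum hb).trans ?_
    rw [Finset.sum_add_distrib]
    refine add_le_add ?_ ?_
    · apply le_of_eq
      symm
      apply Finset.sum_subset
      · intro d hd
        simp only [mem_filter, mem_range] at hd ⊢
        exact ⟨⟨by omega, hd.2.1⟩, hd.2.2⟩
      · intro d hd hd2
        simp only [mem_filter, mem_range] at hd hd2
        have hdX : X < d := by
          by_contra hh
          exact hd2 ⟨by omega, hd.1.2, hd.2⟩
        have : X / d ^ 2 = 0 := by
          apply Nat.div_eq_of_lt
          nlinarith
        rw [this]
        unfold Wd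
        rw [Finset.sum_eq_zero, abs_zero]
        intro k hk
        simp only [mem_filter, mem_range] at hk
        exfalso
        rw [Nat.odd_iff] at hao; omega
    · rw [← Finset.mul_sum]
      have hs : ∑ d ∈ ((range n).filter Odd).filter (fun d : ℕ => D < d), ((d : ℝ) ^ 2)⁻¹ ≤ 2 / D := by
        have hsub : ((range n).filter Odd).filter (fun d : ℕ => D < d) ⊆ Ioo ⌊D⌋₊ n := by
          intro d hd
          simp only [mem_filter, mem_range] at hd
          rw [mem_Ioo]
          exact ⟨(Nat.floor_lt (by linarith)).2 hd.2, hd.1.1⟩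
        refine (Finset.sum_le_sum_of_subset_of_nonneg hsub fun d _ _ => by positivity).trans ?_
        refine (sum_Ioo_inv_sq_le (α := ℝ) _ _).trans ?_
        gcongr
        exact (Nat.lt_floor_add_one D).le
      calc _ ≤ X * (C2 * bN f ^ (-(1 / 2) + η)) * (2 / D) := by gcongr
        _ = _ := by ring
  refine (add_le_add hsmall hlarge).trans ?_
  have u1 : 0 ≤ D * bN f ^ (1 / 2 + η) := by positivity
  have u2 : 0 ≤ (X / D) * bN f ^ (-(1 / 2) + η) := by positivity
  nlinarith

end box
end Mom

namespace Mom
open Finset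

section comb
variable {ι : Type} [Fintype ι] [DecidableEq ι]

lemma greedy (f : ι → ℕ) (S : Finset ι) (w t : ℝ) (hw : ∀ i ∈ S, (f i : ℝ) ≤ w) (hw0 : 0 ≤ w) (ht0 : 0 ≤ t)
    (ht : t ≤ ∑ i ∈ S, (f i : ℝ)) : ∃ S' ⊆ S, t ≤ ∑ i ∈ S', (f i : ℝ) ∧ ∑ i ∈ S', (f i : ℝ) ≤ t + w := by
  induction S using Finset.induction_on with
  | empty =>
    refine ⟨∅, le_rfl, ht, ?_⟩
    simp; linarith
  | insert a S ha ih =>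
    by_cases h : t ≤ ∑ i ∈ S, (f i : ℝ)
    · obtain ⟨S', h1, h2⟩ := ih (fun i hi => hw i (mem_insert_of_mem hi)) h
      exact ⟨S', h1.trans (subset_insert _ _), h2⟩
    · refine ⟨insert a S, le_rfl, ht, ?_⟩
      rw [Finset.sum_insert ha]
      have := hw a (mem_insert_self _ _)
      push Not at h
      linarith

def pg (f : ι → ℕ) (L : ℝ) (S : Finset ι) : Prop :=
  (L / 3 ≤ ∑ i ∈ S, (f i : ℝ) ∧ ∑ i ∈ S, (f i : ℝ) ≤ 2 * L / 3) ∨ ∃ i, S = {i} ∧ 2 * L / 3 ≤ f i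

lemma pg_lower {f : ι → ℕ} {L : ℝ} (hL : 0 ≤ L) {S : Finset ι} (h : pg f L S) : L / 3 ≤ ∑ i ∈ S, (f i : ℝ) := by
  rcases h with h | ⟨i, rfl, h⟩
  · exact h.1
  · simp; linarith

lemma pg_single {f : ι → ℕ} {L : ℝ} {i : ι} (h : L / 3 ≤ f i) : pg f L {i} := by
  by_cases h2 : (f i : ℝ) ≤ 2 * L / 3
  · left; simpa using ⟨h, h2⟩
  · right; exact ⟨i, rfl, by linarith⟩

/-- any set of total at least L/3 has a good subset -/
lemma pg_sub {f : ι → ℕ} {L : ℝ} (hL : 0 ≤ L) {S : Finset ι} (h : L / 3 ≤ ∑ i ∈ S, (f i : ℝ)) :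
    ∃ S' ⊆ S, pg f L S' := by
  by_cases h2 : ∃ i ∈ S, L / 3 ≤ f i
  · obtain ⟨i, hi, h3⟩ := h2
    exact ⟨{i}, by simpa using hi, pg_single h3⟩
  · push Not at h2
    obtain ⟨S', h1, h3, h4⟩ := greedy f S (L / 3) (L / 3) (fun i hi => (h2 i hi).le) (by linarith) (by linarith) h
    exact ⟨S', h1, Or.inl ⟨h3, by linarith⟩⟩

lemma comb_cases (f : ι → ℕ) (L : ℝ) (hL : 0 ≤ L) :
    (∃ S S', Disjoint S S' ∧ pg f L S ∧ pg f L S') ∨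
    (∃ i, ∑ j ∈ univ.erase i, (f j : ℝ) ≤ L / 3) ∨
    (∑ i, (f i : ℝ) ≤ 2 * L / 3) ∨
    (2 * L / 3 ≤ ∑ i, (f i : ℝ) ∧ ∑ i, (f i : ℝ) ≤ L ∧
      ∃ S : Finset ι, |∑ i ∈ S, (f i : ℝ) - ∑ i ∈ Sᶜ, (f i : ℝ)| ≤ L / 3) := by
  by_cases h1 : ∃ i, L / 3 ≤ f i
  · obtain ⟨i, hi⟩ := h1
    by_cases h2 : ∑ j ∈ univ.erase i, (f j : ℝ) ≤ L / 3
    · exact Or.inr (Or.inl ⟨i, h2⟩)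
    · push Not at h2
      obtain ⟨S', hS, hp⟩ := pg_sub hL h2.le
      left
      refine ⟨{i}, S', ?_, pg_single hi, hp⟩
      rw [Finset.disjoint_singleton_left]
      intro h; simpa using hS h
  · push Not at h1
    by_cases h2 : ∑ i, (f i : ℝ) ≤ 2 * L / 3
    · exact Or.inr (Or.inr (Or.inl h2))
    push Not at h2
    by_cases h3 : ∑ i, (f i : ℝ) ≤ L
    · right; right; right
      refine ⟨h2.le, h3, ?_⟩
      obtain ⟨S, _, h4, h5⟩ := greedy f univ (L / 3) ((∑ i, (f i : ℝ)) / 2 - L / 6) (fun i _ => (h1 i).le)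
        (by linarith) (by linarith) (by linarith)
      refine ⟨S, ?_⟩
      have := Finset.sum_add_sum_compl S (fun i => (f i : ℝ))
      rw [abs_le]; constructor <;> linarith
    · push Not at h3
      left
      obtain ⟨S, _, h4, h5⟩ := greedy f univ (L / 3) (L / 3) (fun i _ => (h1 i).le)
        (by linarith) (by linarith) (by linarith)
      have := Finset.sum_add_sum_compl S (fun i => (f i : ℝ))
      obtain ⟨S', hS, hp⟩ := pg_sub (f := f) hL (S := Sᶜ) (by linarith)
      refine ⟨S, S', ?_, Or.inl ⟨h4, by linarith⟩, hp⟩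
      exact Finset.disjoint_of_subset_right hS disjoint_compl_right
end comb

section box
variable {ι : Type} [Fintype ι] [DecidableEq ι]

/-- second moment over a subset -/
noncomputable def Q2 (f : ι → ℕ) (S : Finset ι) (v a X : ℕ) : ℝ :=
  ∑ m ∈ (range (X + 1)).filter (fun m => m % 8 = a), (∏ i ∈ S, T v (f i) m) ^ 2

lemma prod_T_le (f : ι → ℕ) (S : Finset ι) (v m : ℕ) : |∏ i ∈ S, T v (f i) m| ≤ 1 := by
  rw [Finset.abs_prod]
  exact Finset.prod_le_one (fun i _ => abs_nonneg _) (fun i _ => T_le_one _ _ _)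

lemma Sf_cauchy (f : ι → ℕ) (S S' : Finset ι) (h : Disjoint S S') (v a X : ℕ) (B : ℝ) (hB : 0 ≤ B)
    (hQ : Q2 f S v a X * Q2 f S' v a X ≤ B ^ 2) : |Sf f v a X| ≤ B := by
  set K := (range (X + 1)).filter (fun m => m % 8 = a)
  have h1 : |Sf f v a X| ≤ ∑ m ∈ K, |∏ i ∈ S, T v (f i) m| * |∏ i ∈ S', T v (f i) m| := by
    unfold Sf
    refine (Finset.abs_sum_le_sum_abs _ _).trans (Finset.sum_le_sum fun m _ => ?_)
    split_ifs
    · have e : ∏ i, T v (f i) m = (∏ i ∈ S, T v (f i) m) * (∏ i ∈ S', T v (f i) m) *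
          ∏ i ∈ (S ∪ S')ᶜ, T v (f i) m := by
        rw [← Finset.prod_union h, Finset.prod_mul_prod_compl]
      rw [e, abs_mul, abs_mul]
      exact mul_le_of_le_one_right (by positivity) (prod_T_le _ _ _ _)
    · rw [abs_zero]; positivity
  have h2 := Finset.sum_mul_sq_le_sq_mul_sq K (fun m => |∏ i ∈ S, T v (f i) m|) (fun m => |∏ i ∈ S', T v (f i) m|)
  simp only [sq_abs] at h2
  have h3 : (∑ m ∈ K, |∏ i ∈ S, T v (f i) m| * |∏ i ∈ S', T v (f i) m|) ^ 2 ≤ B ^ 2 := h2.trans hQ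
  exact h1.trans (abs_le_of_sq_le_sq' h3 hB).2

lemma Q2_nonneg (f : ι → ℕ) (S : Finset ι) (v a X : ℕ) : 0 ≤ Q2 f S v a X :=
  Finset.sum_nonneg fun _ _ => by positivity

theorem Q2_bound (ι : Type) [Fintype ι] [DecidableEq ι] (η : ℝ) (hη : 0 < η) : ∃ C : ℝ, 1 ≤ C ∧
    ∀ (f : ι → ℕ) (S : Finset ι) (v a X : ℕ) (L : ℝ), (v = 1 ∨ v = 2) → a < 8 → (X : ℝ) = 2 ^ L →
      Q2 f S v a X ≤ C * ((2 : ℝ) ^ (L - ∑ i ∈ S, (f i : ℝ)) + (2 : ℝ) ^ (∑ i ∈ S, (f i : ℝ))) *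
        (2 : ℝ) ^ (η * ∑ i, (f i : ℝ)) := by
  choose C hC1 hC using fun S : Finset ι => second_moment (↥S) η hη
  refine ⟨1 + ∑ S, C S, ?_, ?_⟩
  · have : 0 ≤ ∑ S, C S := Finset.sum_nonneg fun S _ => by linarith [hC1 S]
    linarith
  intro f S v a X L hv ha hX
  have h1 := hC S (fun i => f i) v a X hv ha
  have e1 : bN (fun i : S => f i) = (2 : ℝ) ^ (∑ i ∈ S, (f i : ℝ)) := by
    unfold bN
    rw [Finset.sum_coe_sort S f, ← Real.rpow_natCast]; push_cast; rfl
  have e2 : ∑ m ∈ (range (X + 1)).filter (fun m => m % 8 = a), (∏ i : S, T v (f i) m) ^ 2 = Q2 f S v a X := by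
    unfold Q2
    refine Finset.sum_congr rfl fun m _ => ?_
    rw [Finset.prod_coe_sort S (fun i => T v (f i) m)]
  rw [e2, e1, hX, ← Real.rpow_sub (by norm_num), ← Real.rpow_mul (by norm_num)] at h1
  refine h1.trans ?_
  have hS : ∑ i ∈ S, (f i : ℝ) ≤ ∑ i, (f i : ℝ) :=
    Finset.sum_le_sum_of_subset_of_nonneg (subset_univ _) fun _ _ _ => by positivity
  have hCS : C S ≤ 1 + ∑ S, C S := by
    have := Finset.single_le_sum (f := C) (fun S _ => by linarith [hC1 S]) (mem_univ S)
    linarith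
  have := hC1 S
  refine mul_le_mul (mul_le_mul_of_nonneg_right hCS (by positivity))
    (Real.rpow_le_rpow_of_exponent_le (by norm_num) (by nlinarith)) (by positivity) ?_
  exact mul_nonneg (by linarith) (by positivity)

lemma sq_count (Z a : ℕ) (ha : Odd a) :
    (((range (Z + 1)).filter (fun k => k % 8 = a)).filter IsSquare).card ≤ Nat.sqrt Z := by
  calc _ ≤ ((Icc 1 (Nat.sqrt Z)).image (fun s => s * s)).card := by
        apply Finset.card_le_card
        intro k hk
        simp only [mem_filter, mem_range] at hk
        obtain ⟨⟨hk1, hk2⟩, s, rfl⟩ := hk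
        rw [mem_image]
        refine ⟨s, ?_, rfl⟩
        rw [mem_Icc]
        refine ⟨?_, Nat.le_sqrt.2 (by omega)⟩
        rcases Nat.eq_zero_or_pos s with rfl | h
        · rw [Nat.odd_iff] at ha; omega
        · exact h
    _ ≤ _ := Finset.card_image_le
    _ = _ := by simp

lemma class_count (Z a : ℕ) (ha : Odd a) :
    ((range (Z + 1)).filter (fun k => k % 8 = a)).card ≤ Z := by
  calc _ ≤ (Icc 1 Z).card := by
        apply Finset.card_le_card
        intro k hk
        simp only [mem_filter, mem_range] at hk
        rw [mem_Icc]
        rw [Nat.odd_iff] at ha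
        omega
    _ = _ := by simp

/-- trivial bound for Wd -/
lemma Wd_trivial (f : ι → ℕ) (v a X d : ℕ) (ha : Odd a) (hd : 0 < d) :
    |Wd f v a (X / d ^ 2) d| ≤ X * ((d : ℝ) ^ 2)⁻¹ := by
  unfold Wd
  refine (Finset.abs_sum_le_sum_abs _ _).trans ?_
  refine (Finset.sum_le_card_nsmul _ _ 1 fun k _ => prod_T_le f univ v _).trans ?_
  rw [nsmul_eq_mul, mul_one]
  calc _ ≤ ((X / d ^ 2 : ℕ) : ℝ) := by exact_mod_cast class_count _ a ha
    _ ≤ _ := (div_bounds X d hd).1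

lemma sqrt_div_le (X d : ℕ) (hd : 0 < d) : (Nat.sqrt (X / d ^ 2) : ℝ) ≤ (X : ℝ) ^ (1 / 2 : ℝ) * (d : ℝ)⁻¹ := by
  have hd' : (0 : ℝ) < d := by exact_mod_cast hd
  rw [← Real.sqrt_eq_rpow, ← div_eq_mul_inv, le_div_iff₀ hd']
  apply Real.le_sqrt_of_sq_le
  have h1 : Nat.sqrt (X / d ^ 2) ^ 2 ≤ X / d ^ 2 := Nat.sqrt_le' _
  have h2 := (Nat.le_div_iff_mul_le (by positivity : 0 < d ^ 2)).1 h1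
  rw [mul_pow]; exact_mod_cast h2

/-- F5-type bound for Wd -/
theorem Wd_pv (η : ℝ) (hη : 0 < η) : ∃ C : ℝ, 1 ≤ C ∧
    ∀ {ι : Type} [Fintype ι] [DecidableEq ι] (f : ι → ℕ) (i : ι) (v a X d : ℕ), (v = 1 ∨ v = 2) → Odd a → Odd d →
    |Wd f v a (X / d ^ 2) d| ≤ C * (X : ℝ) ^ (3 / 2 + η) / 2 ^ (f i) * ((d : ℝ)⁻¹ * ((d : ℝ) ^ 2)⁻¹)
      + (X : ℝ) ^ (1 / 2 : ℝ) * (d : ℝ)⁻¹ := by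
  obtain ⟨C, hC1, hC⟩ := T_pv η hη
  refine ⟨C, hC1, ?_⟩
  intro ι _ _ f i v a X d hv ha hd
  have hd1 : (1 : ℝ) ≤ d := by exact_mod_cast hd.pos
  unfold Wd
  refine (Finset.abs_sum_le_sum_abs _ _).trans ?_
  set Z := X / d ^ 2 with hZ
  rw [← Finset.sum_filter_add_sum_filter_not _ IsSquare, add_comm]
  refine add_le_add ?_ ?_
  · have hb : ∀ k ∈ ((range (Z + 1)).filter (fun k => k % 8 = a)).filter (fun k => ¬ IsSquare k),
        |∏ i, T v (f i) (k * d ^ 2)| ≤ C * (X : ℝ) ^ (1 / 2 + η) * (d : ℝ)⁻¹ / 2 ^ (f i) := by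
      intro k hk
      simp only [mem_filter, mem_range] at hk
      have hko : Odd k := by rw [Nat.odd_iff] at ha ⊢; omega
      have h1 := hC v k d (f i) hv hko hk.2 hd
      have h2 : |∏ i, T v (f i) (k * d ^ 2)| ≤ |T v (f i) (k * d ^ 2)| := by
        rw [← Finset.mul_prod_erase univ _ (mem_univ i), abs_mul]
        exact mul_le_of_le_one_right (abs_nonneg _) (prod_T_le f _ v _)
      refine h2.trans (h1.trans ?_)
      have hkd : (k : ℝ) * (d : ℝ) ^ 2 ≤ X := by
        have : k ≤ X / d ^ 2 := by omega
        rw [Nat.le_div_iff_mul_le (by have := hd.pos; positivity)] at this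
        exact_mod_cast this
      have hk0 : (0 : ℝ) < k := by exact_mod_cast hko.pos
      have h3 : (k : ℝ) ^ (1 / 2 + η) * (d : ℝ) ^ η ≤ (X : ℝ) ^ (1 / 2 + η) * (d : ℝ)⁻¹ := by
        rw [← div_eq_mul_inv, le_div_iff₀ (by linarith)]
        calc (k : ℝ) ^ (1 / 2 + η) * (d : ℝ) ^ η * d ≤ (k : ℝ) ^ (1 / 2 + η) * (d : ℝ) ^ (2 * η) * d := by
              gcongr
              linarith
          _ = (k : ℝ) ^ (1 / 2 + η) * ((d : ℝ) ^ 2) ^ (1 / 2 + η) := by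
              rw [← Real.rpow_natCast (d : ℝ) 2, ← Real.rpow_mul (by linarith)]
              rw [show ((2 : ℕ) : ℝ) * (1 / 2 + η) = 2 * η + 1 by push_cast; ring, Real.rpow_add (by linarith) (2 * η) 1,
                Real.rpow_one]
              ring
          _ = ((k : ℝ) * (d : ℝ) ^ 2) ^ (1 / 2 + η) := by rw [Real.mul_rpow (by positivity) (by positivity)]
          _ ≤ _ := by gcongr
      gcongr ?_ / _
      rw [mul_assoc, mul_assoc]
      gcongr
    refine (Finset.sum_le_card_nsmul _ _ _ hb).trans ?_
    rw [nsmul_eq_mul]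
    have hc : ((((range (Z + 1)).filter (fun k => k % 8 = a)).filter (fun k => ¬ IsSquare k)).card : ℝ) ≤
        X * ((d : ℝ) ^ 2)⁻¹ := by
      calc _ ≤ (Z : ℝ) := by exact_mod_cast (Finset.card_filter_le _ _).trans (class_count Z a ha)
        _ ≤ _ := (div_bounds X d hd.pos).1
    have hX : (X : ℝ) * (X : ℝ) ^ (1 / 2 + η) = (X : ℝ) ^ (3 / 2 + η) := by
      rcases Nat.eq_zero_or_pos X with h | h
      · rw [h, Nat.cast_zero, zero_mul, Real.zero_rpow (by positivity)]
      · have : (0 : ℝ) < X := by exact_mod_cast h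
        rw [show 3 / 2 + η = 1 + (1 / 2 + η) by ring, Real.rpow_add this 1 (1 / 2 + η), Real.rpow_one]
    calc _ ≤ (X * ((d : ℝ) ^ 2)⁻¹) * (C * (X : ℝ) ^ (1 / 2 + η) * (d : ℝ)⁻¹ / 2 ^ (f i)) := by gcongr
      _ = _ := by rw [← hX]; ring
  · refine (Finset.sum_le_card_nsmul _ _ 1 fun k _ => prod_T_le f univ v _).trans ?_
    rw [nsmul_eq_mul, mul_one]
    calc _ ≤ (Nat.sqrt Z : ℝ) := by exact_mod_cast sq_count Z a ha
      _ ≤ _ := sqrt_div_le X d hd.pos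

/-- F2 -/
theorem Q2_single (η : ℝ) (hη : 0 < η) : ∃ C : ℝ, 1 ≤ C ∧
    ∀ {ι : Type} [Fintype ι] [DecidableEq ι] (f : ι → ℕ) (i : ι) (v a X : ℕ), (v = 1 ∨ v = 2) → Odd a →
    Q2 f {i} v a X ≤ C * (X : ℝ) ^ (2 + η) / (2 ^ (f i)) ^ 2 + (X : ℝ) ^ (1 / 2 : ℝ) := by
  obtain ⟨C, hC1, hC⟩ := T_pv (η / 2) (by positivity)
  refine ⟨C ^ 2, one_le_pow₀ hC1, ?_⟩
  intro ι _ _ f i v a X hv ha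
  unfold Q2
  simp_rw [Finset.prod_singleton]
  rw [← Finset.sum_filter_add_sum_filter_not _ IsSquare, add_comm]
  refine add_le_add ?_ ?_
  · have hb : ∀ k ∈ ((range (X + 1)).filter (fun k => k % 8 = a)).filter (fun k => ¬ IsSquare k),
        T v (f i) k ^ 2 ≤ C ^ 2 * (X : ℝ) ^ (1 + η) / (2 ^ (f i)) ^ 2 := by
      intro k hk
      simp only [mem_filter, mem_range] at hk
      have hko : Odd k := by rw [Nat.odd_iff] at ha ⊢; omega
      have h1 := hC v k 1 (f i) hv hko hk.2 odd_one
      simp only [one_pow, mul_one, Nat.cast_one, Real.one_rpow] at h1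
      rw [← sq_abs]
      have hkX : (k : ℝ) ≤ X := by exact_mod_cast (by omega : k ≤ X)
      calc |T v (f i) k| ^ 2 ≤ (C * (k : ℝ) ^ (1 / 2 + η / 2) / 2 ^ (f i)) ^ 2 := by gcongr
        _ ≤ (C * (X : ℝ) ^ (1 / 2 + η / 2) / 2 ^ (f i)) ^ 2 := by gcongr
        _ = _ := by
          rw [div_pow, mul_pow, ← Real.rpow_natCast ((X : ℝ) ^ _), ← Real.rpow_mul (by positivity)]
          congr 3; push_cast; ring
    refine (Finset.sum_le_card_nsmul _ _ _ hb).trans ?_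
    rw [nsmul_eq_mul]
    have hX : (X : ℝ) * (X : ℝ) ^ (1 + η) = (X : ℝ) ^ (2 + η) := by
      rcases Nat.eq_zero_or_pos X with h | h
      · rw [h, Nat.cast_zero, zero_mul, Real.zero_rpow (by positivity)]
      · have : (0 : ℝ) < X := by exact_mod_cast h
        rw [show 2 + η = 1 + (1 + η) by ring, Real.rpow_add this 1 (1 + η), Real.rpow_one]
    have hc : ((((range (X + 1)).filter (fun k => k % 8 = a)).filter (fun k => ¬ IsSquare k)).card : ℝ) ≤ X := by
      exact_mod_cast (Finset.card_filter_le _ _).trans (class_count X a ha)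
    calc _ ≤ (X : ℝ) * (C ^ 2 * (X : ℝ) ^ (1 + η) / (2 ^ (f i)) ^ 2) := by gcongr
      _ = _ := by rw [← hX]; ring
  · refine (Finset.sum_le_card_nsmul _ _ 1 fun k _ => ?_).trans ?_
    · rw [sq_le_one_iff_abs_le_one]; exact T_le_one _ _ _
    rw [nsmul_eq_mul, mul_one]
    have h := sqrt_div_le X 1 one_pos
    simp only [one_pow, Nat.div_one, Nat.cast_one, inv_one, mul_one] at h
    calc _ ≤ (Nat.sqrt X : ℝ) := by exact_mod_cast sq_count X a ha
      _ ≤ _ := h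

end box
end Mom

namespace Mom
open Finset

lemma tail_sq (n : ℕ) (D : ℝ) (hD : 1 ≤ D) :
    ∑ d ∈ (range n).filter (fun d : ℕ => Odd d ∧ D < d), ((d : ℝ) ^ 2)⁻¹ ≤ 2 / D := by
  have hsub : (range n).filter (fun d : ℕ => Odd d ∧ D < d) ⊆ Ioo ⌊D⌋₊ n := by
    intro d hd
    simp only [mem_filter, mem_range] at hd
    rw [mem_Ioo]
    exact ⟨(Nat.floor_lt (by linarith)).2 hd.2.2, hd.1⟩
  refine (Finset.sum_le_sum_of_subset_of_nonneg hsub fun d _ _ => by positivity).trans ?_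
  refine (sum_Ioo_inv_sq_le (α := ℝ) _ _).trans ?_
  gcongr
  exact (Nat.lt_floor_add_one D).le

lemma tail_inv (η : ℝ) (hη : 0 < η) : ∃ C : ℝ, 1 ≤ C ∧ ∀ (X : ℕ) (D : ℝ), 1 ≤ X →
    ∑ d ∈ (range (X + 1)).filter (fun d : ℕ => Odd d ∧ D < d), (d : ℝ)⁻¹ ≤ C * (X : ℝ) ^ η := by
  refine ⟨1 + 1 / η, by have : 0 < 1 / η := by positivity
                        linarith, ?_⟩
  intro X D hX
  have hX1 : (1 : ℝ) ≤ X := by exact_mod_cast hX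
  have h1 : ∑ d ∈ (range (X + 1)).filter (fun d : ℕ => Odd d ∧ D < d), (d : ℝ)⁻¹ ≤ ∑ d ∈ Icc 1 X, (d : ℝ)⁻¹ := by
    apply Finset.sum_le_sum_of_subset_of_nonneg
    · intro d hd
      simp only [mem_filter, mem_range] at hd
      rw [mem_Icc]
      exact ⟨hd.2.1.pos, by omega⟩
    · intros; positivity
  have h2 := harmonic_le_one_add_log X
  rw [harmonic_eq_sum_Icc] at h2
  push_cast at h2
  have h3 := Real.log_le_rpow_div (x := (X : ℝ)) (by positivity) hη
  have h4 : 1 ≤ (X : ℝ) ^ η := Real.one_le_rpow hX1 hη.le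
  calc _ ≤ _ := h1
    _ ≤ _ := h2
    _ ≤ (X : ℝ) ^ η + (X : ℝ) ^ η / η := by linarith
    _ = _ := by ring

lemma two_mono {x y : ℝ} (h : x ≤ y) : (2 : ℝ) ^ x ≤ (2 : ℝ) ^ y :=
  Real.rpow_le_rpow_of_exponent_le (by norm_num) h

lemma bN_eq {ι : Type} [Fintype ι] [DecidableEq ι] (f : ι → ℕ) : bN f = (2 : ℝ) ^ (∑ i, (f i : ℝ)) := by
  unfold bN
  rw [← Real.rpow_natCast]; push_cast; rfl

lemma bN_rpow {ι : Type} [Fintype ι] [DecidableEq ι] (f : ι → ℕ) (x : ℝ) :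
    bN f ^ x = (2 : ℝ) ^ ((∑ i, (f i : ℝ)) * x) := by
  rw [bN_eq, ← Real.rpow_mul (by norm_num)]

set_option maxHeartbeats 4000000 in
theorem box_final (r : ℕ) (ε : ℝ) (hε : 0 < ε) : ∃ C : ℝ, 1 ≤ C ∧
    ∀ (f : Fin r → ℕ) (v a X : ℕ) (L : ℝ), (v = 1 ∨ v = 2) → a < 8 → Odd a → 0 ≤ L → (X : ℝ) = 2 ^ L →
      (∀ i, (f i : ℝ) ≤ 5 / 6 * L) →
      |Sf f v a X - X * Mf f| ≤ C * (2 : ℝ) ^ ((2 / 3 + ε) * L) := by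
  set η : ℝ := ε / (r + 2) with hηdef
  have hη : 0 < η := by positivity
  have hηr : η * (r + 2) = ε := by rw [hηdef]; field_simp
  obtain ⟨C1, hC1, h1⟩ := sieve_bound (Fin r) η hη
  obtain ⟨C2, hC2, h2⟩ := Mf_le (Fin r) η hη
  obtain ⟨C3, hC3, h3⟩ := Q2_bound (Fin r) η hη
  obtain ⟨C4, hC4, h4⟩ := Q2_single η hη
  obtain ⟨C5, hC5, h5⟩ := Wd_pv η hη
  obtain ⟨C6, hC6, h6⟩ := tail_inv η hη
  set CC := 2 * C1 + 2 + 2 * C5 + C6 + C2 + 2 * C3 + (C4 + 1) with hCC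
  refine ⟨CC, by linarith, ?_⟩
  intro f v a X L hv ha hao hL hX hf
  set F := ∑ i, (f i : ℝ) with hF
  set U := (2 : ℝ) ^ ((2 / 3 + ε) * L) with hU
  have hU0 : 0 < U := by positivity
  have hX1 : 1 ≤ X := by
    have : (1 : ℝ) ≤ X := by rw [hX]; exact Real.one_le_rpow (by norm_num) hL
    exact_mod_cast this
  have hF0 : 0 ≤ F := Finset.sum_nonneg fun _ _ => by positivity
  have hFr : F ≤ r * L := by
    calc F ≤ ∑ _i : Fin r, L := Finset.sum_le_sum fun i _ => (hf i).trans (by linarith)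
      _ = _ := by simp
  have hηF : η * F ≤ ε * L := by nlinarith
  have hηF2 : η * F + 2 * (η * L) ≤ ε * L := by nlinarith
  have hηL : 0 ≤ η * L := by positivity
  have hηF0 : 0 ≤ η * F := by positivity
  have hM : 2 * L / 3 ≤ F → X * Mf f ≤ C2 * U := by
    intro h
    calc X * Mf f ≤ 2 ^ L * (C2 * bN f ^ (-(1 / 2) + η)) := by rw [hX]; gcongr; exact h2 f
      _ = C2 * 2 ^ (L + F * (-(1 / 2) + η)) := by rw [bN_rpow, Real.rpow_add (by norm_num)]; ring
      _ ≤ C2 * U := by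
        gcongr
        apply two_mono; nlinarith
  have hM0 : 0 ≤ X * Mf f := mul_nonneg (by positivity) (Mf_nonneg f)
  have fromS : 2 * L / 3 ≤ F → |Sf f v a X| ≤ (2 * C3 + (C4 + 1)) * U → |Sf f v a X - X * Mf f| ≤ CC * U := by
    intro h hS
    have := hM h
    have t1 : 0 ≤ C1 * U := by positivity
    have t2 : 0 ≤ C5 * U := by positivity
    have t3 : 0 ≤ C6 * U := by positivity
    rw [abs_le] at hS ⊢
    rw [hCC]
    constructor <;> linarith [hS.1, hS.2]
  have hQ : ∀ S, pg f L S → Q2 f S v a X ≤ (2 * C3 + (C4 + 1)) * U := by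
    intro S hS
    have t4 : 0 ≤ C4 * U := by positivity
    have t3 : 0 ≤ C3 * U := by positivity
    rcases hS with ⟨ha1, ha2⟩ | ⟨i, rfl, hi⟩
    · have := h3 f S v a X L hv ha hX
      set x := ∑ i ∈ S, (f i : ℝ)
      have b1 : (2 : ℝ) ^ (L - x) * (2 : ℝ) ^ (η * F) ≤ U := by
        rw [← Real.rpow_add (by norm_num)]; apply two_mono; nlinarith
      have b2 : (2 : ℝ) ^ x * (2 : ℝ) ^ (η * F) ≤ U := by
        rw [← Real.rpow_add (by norm_num)]; apply two_mono; nlinarith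
      have b3 := mul_le_mul_of_nonneg_left (add_le_add b1 b2) (by linarith : 0 ≤ C3)
      linarith
    · have := h4 f i v a X hv hao
      have b1 : (X : ℝ) ^ (2 + η) / (2 ^ (f i)) ^ 2 ≤ U := by
        rw [← pow_mul, ← Real.rpow_natCast 2 (f i * 2), hX, ← Real.rpow_mul (by norm_num), ← Real.rpow_sub (by norm_num)]
        apply two_mono; push_cast; nlinarith
      have b2 : (X : ℝ) ^ (1 / 2 : ℝ) ≤ U := by
        rw [hX, ← Real.rpow_mul (by norm_num)]; apply two_mono; nlinarith
      rw [mul_div_assoc] at this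
      have b3 := mul_le_mul_of_nonneg_left b1 (by linarith : 0 ≤ C4)
      linarith
  -- main sieve with D
  have hsieve : F ≤ 7 / 6 * L → |Sf f v a X - X * Mf f| ≤ 2 * C1 * U +
      ∑ d ∈ (range (X + 1)).filter (fun d : ℕ => Odd d ∧ (2 : ℝ) ^ (2 * L / 3 - F / 2) < d),
        |Wd f v a (X / d ^ 2) d| := by
    intro h
    have hD : 1 ≤ (2 : ℝ) ^ (2 * L / 3 - F / 2) := Real.one_le_rpow (by norm_num) (by linarith)
    have := h1 f v a X _ hv ha hao hD
    refine this.trans ?_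
    gcongr
    have b1 : (2 : ℝ) ^ (2 * L / 3 - F / 2) * bN f ^ (1 / 2 + η) ≤ U := by
      rw [bN_rpow, ← Real.rpow_add (by norm_num)]; apply two_mono; nlinarith
    have b2 : X / (2 : ℝ) ^ (2 * L / 3 - F / 2) * bN f ^ (-(1 / 2) + η) ≤ U := by
      rw [bN_rpow, hX, ← Real.rpow_sub (by norm_num), ← Real.rpow_add (by norm_num)]; apply two_mono; nlinarith
    have b3 := mul_le_mul_of_nonneg_left (add_le_add b1 b2) (by linarith : 0 ≤ C1)
    linarith
  rcases comb_cases f L hL with ⟨S, S', hd, hS, hS'⟩ | ⟨i, hi⟩ | hT | ⟨hT1, hT2, S, hS⟩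
  · -- two good groups
    have hFb : 2 * L / 3 ≤ F := by
      have t1 := pg_lower hL hS
      have t2 := pg_lower hL hS'
      have : ∑ i ∈ S ∪ S', (f i : ℝ) ≤ F :=
        Finset.sum_le_sum_of_subset_of_nonneg (subset_univ _) fun _ _ _ => by positivity
      rw [Finset.sum_union hd] at this
      linarith
    refine fromS hFb (Sf_cauchy f S S' hd v a X _ (by positivity) ?_)
    rw [pow_two]
    exact mul_le_mul (hQ S hS) (hQ S' hS') (Q2_nonneg _ _ _ _ _) (by positivity)
  · -- one large
    have hFi : F = f i + ∑ j ∈ univ.erase i, (f j : ℝ) := by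
      rw [hF, Finset.add_sum_erase univ (fun j => (f j : ℝ)) (mem_univ i)]
    have hfi := hf i
    refine (hsieve (by linarith)).trans ?_
    set D := (2 : ℝ) ^ (2 * L / 3 - F / 2) with hDdef
    have hD : 1 ≤ D := Real.one_le_rpow (by norm_num) (by linarith)
    have hb : ∀ d ∈ (range (X + 1)).filter (fun d : ℕ => Odd d ∧ D < d), |Wd f v a (X / d ^ 2) d| ≤
        C5 * (X : ℝ) ^ (3 / 2 + η) / 2 ^ (f i) * D⁻¹ * ((d : ℝ) ^ 2)⁻¹ + (X : ℝ) ^ (1 / 2 : ℝ) * (d : ℝ)⁻¹ := by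
      intro d hd
      simp only [mem_filter] at hd
      refine (h5 f i v a X d hv hao hd.2.1).trans ?_
      rw [← mul_assoc]
      have := hd.2.2
      gcongr
    have hsum := Finset.sum_le_sum hb
    rw [Finset.sum_add_distrib, ← Finset.mul_sum, ← Finset.mul_sum] at hsum
    have k1 : C5 * (X : ℝ) ^ (3 / 2 + η) / 2 ^ (f i) * D⁻¹ *
        ∑ d ∈ (range (X + 1)).filter (fun d : ℕ => Odd d ∧ D < d), ((d : ℝ) ^ 2)⁻¹ ≤ 2 * C5 * U := by
      calc _ ≤ C5 * (X : ℝ) ^ (3 / 2 + η) / 2 ^ (f i) * D⁻¹ * (2 / D) := by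
            gcongr; exact tail_sq _ D hD
        _ = 2 * C5 * ((X : ℝ) ^ (3 / 2 + η) / 2 ^ (f i) / (D * D)) := by field_simp
        _ ≤ _ := by
          gcongr
          rw [hDdef, hX, ← Real.rpow_natCast 2 (f i), ← Real.rpow_mul (by norm_num), ← Real.rpow_sub (by norm_num),
            ← Real.rpow_add (by norm_num), ← Real.rpow_sub (by norm_num)]
          apply two_mono; nlinarith
    have k2 : (X : ℝ) ^ (1 / 2 : ℝ) * ∑ d ∈ (range (X + 1)).filter (fun d : ℕ => Odd d ∧ D < d), (d : ℝ)⁻¹ ≤ C6 * U := by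
      calc _ ≤ (X : ℝ) ^ (1 / 2 : ℝ) * (C6 * (X : ℝ) ^ η) := by
            gcongr; exact h6 X D hX1
        _ = C6 * ((X : ℝ) ^ (1 / 2 : ℝ) * (X : ℝ) ^ η) := by ring
        _ ≤ _ := by
          gcongr
          rw [hX, ← Real.rpow_mul (by norm_num), ← Real.rpow_mul (by norm_num), ← Real.rpow_add (by norm_num)]
          apply two_mono; nlinarith
    have t2 : 0 ≤ C2 * U := by positivity
    have t3 : 0 ≤ C3 * U := by positivity
    have t4 : 0 ≤ C4 * U := by positivity
    rw [hCC]
    linarith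
  · -- small total
    refine (hsieve (by linarith)).trans ?_
    set D := (2 : ℝ) ^ (2 * L / 3 - F / 2) with hDdef
    have hD : 1 ≤ D := Real.one_le_rpow (by norm_num) (by linarith)
    have hb : ∀ d ∈ (range (X + 1)).filter (fun d : ℕ => Odd d ∧ D < d), |Wd f v a (X / d ^ 2) d| ≤
        X * ((d : ℝ) ^ 2)⁻¹ := by
      intro d hd
      simp only [mem_filter] at hd
      exact Wd_trivial f v a X d hao hd.2.1.pos
    have hsum := Finset.sum_le_sum hb
    rw [← Finset.mul_sum] at hsum
    have k1 : X * ∑ d ∈ (range (X + 1)).filter (fun d : ℕ => Odd d ∧ D < d), ((d : ℝ) ^ 2)⁻¹ ≤ 2 * U := by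
      calc _ ≤ X * (2 / D) := by gcongr; exact tail_sq _ D hD
        _ = 2 * (X / D) := by ring
        _ ≤ _ := by
          gcongr
          rw [hDdef, hX, ← Real.rpow_sub (by norm_num)]
          apply two_mono; nlinarith
    have t2 : 0 ≤ C2 * U := by positivity
    have t3 : 0 ≤ C3 * U := by positivity
    have t4 : 0 ≤ C4 * U := by positivity
    have t5 : 0 ≤ C5 * U := by positivity
    have t6 : 0 ≤ C6 * U := by positivity
    rw [hCC]
    linarith
  · -- middle case
    refine fromS hT1 (Sf_cauchy f S Sᶜ disjoint_compl_right v a X _ (by positivity) ?_)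
    have q1 := h3 f S v a X L hv ha hX
    have q2 := h3 f Sᶜ v a X L hv ha hX
    have hxy := Finset.sum_add_sum_compl S (fun i => (f i : ℝ))
    set x := ∑ i ∈ S, (f i : ℝ)
    set y := ∑ i ∈ Sᶜ, (f i : ℝ)
    rw [abs_le] at hS
    calc _ ≤ (C3 * ((2 : ℝ) ^ (L - x) + 2 ^ x) * 2 ^ (η * F)) * (C3 * ((2 : ℝ) ^ (L - y) + 2 ^ y) * 2 ^ (η * F)) :=
          mul_le_mul q1 q2 (Q2_nonneg _ _ _ _ _) (by positivity)
      _ = C3 ^ 2 * (((2 : ℝ) ^ (L - x) * 2 ^ (L - y) + (2 : ℝ) ^ (L - x) * 2 ^ y + 2 ^ x * 2 ^ (L - y)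
            + 2 ^ x * 2 ^ y) * (2 ^ (η * F) * 2 ^ (η * F))) := by ring
      _ ≤ C3 ^ 2 * (((2 : ℝ) ^ (4 / 3 * L) + 2 ^ (4 / 3 * L) + 2 ^ (4 / 3 * L) + 2 ^ (4 / 3 * L)) *
            (2 ^ (ε * L) * 2 ^ (ε * L))) := by
          gcongr
          · rw [← Real.rpow_add (by norm_num)]; apply two_mono; linarith
          · rw [← Real.rpow_add (by norm_num)]; apply two_mono; linarith
          · rw [← Real.rpow_add (by norm_num)]; apply two_mono; linarith
          · rw [← Real.rpow_add (by norm_num)]; apply two_mono; linarith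
          · norm_num
          · norm_num
      _ = (2 * C3 * U) ^ 2 := by
          have : U ^ 2 = 2 ^ (4 / 3 * L) * (2 ^ (ε * L) * 2 ^ (ε * L)) := by
            rw [hU, ← Real.rpow_natCast, ← Real.rpow_mul (by norm_num), ← Real.rpow_add (by norm_num),
              ← Real.rpow_add (by norm_num)]
            congr 1; push_cast; ring
          rw [mul_pow, this]; ring
      _ ≤ _ := by
          gcongr; linarith

end Mom

namespace Mom
open Finset

lemma pow_diff_le (r : ℕ) (a b B : ℝ) (ha : |a| ≤ B) (hb : |b| ≤ B) :
    |a ^ r - b ^ r| ≤ r * B ^ (r - 1) * |a - b| := by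
  have hB : 0 ≤ B := (abs_nonneg a).trans ha
  rw [← (Commute.all a b).geom_sum₂_mul, abs_mul]
  refine mul_le_mul_of_nonneg_right ?_ (abs_nonneg _)
  refine (Finset.abs_sum_le_sum_abs _ _).trans ?_
  have : ∀ i ∈ range r, |a ^ i * b ^ (r - 1 - i)| ≤ B ^ (r - 1) := by
    intro i hi
    rw [mem_range] at hi
    rw [abs_mul, abs_pow, abs_pow]
    calc |a| ^ i * |b| ^ (r - 1 - i) ≤ B ^ i * B ^ (r - 1 - i) := by gcongr
      _ = B ^ (r - 1) := by rw [← pow_add]; congr 1; omega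
  refine (Finset.sum_le_card_nsmul _ _ _ this).trans ?_
  rw [nsmul_eq_mul, card_range]

noncomputable def kap (r J : ℕ) : ℝ := ∑ f ∈ Fintype.piFinset (fun _ : Fin r => range J), Mf f

lemma kappa (r : ℕ) : ∃ κ C : ℝ, 0 < κ ∧ 1 ≤ C ∧ ∀ J : ℕ, |κ - kap r J| ≤ C * (2 : ℝ) ^ (-(2 / 5 : ℝ) * J) := by
  obtain ⟨C, hC1, hC⟩ := Mf_le (Fin r) (1 / 10) (by norm_num)
  set x : ℝ := (2 : ℝ) ^ (-(2 / 5 : ℝ)) with hx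
  have hx0 : 0 < x := by positivity
  have hx1 : x < 1 := Real.rpow_lt_one_of_one_lt_of_neg (by norm_num) (by norm_num)
  set S : ℕ → ℝ := fun J => ∑ j ∈ range J, x ^ j with hS
  set B := 1 / (1 - x) with hB
  have hB0 : 0 < B := by rw [hB]; have := sub_pos.2 hx1; positivity
  have hS0 : ∀ J, 0 ≤ S J := fun J => Finset.sum_nonneg fun _ _ => by positivity
  have hSB : ∀ J, S J = B * (1 - x ^ J) := by
    intro J
    have := sub_pos.2 hx1
    rw [hS, hB]
    simp only
    rw [geom_sum_eq hx1.ne]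
    rw [show x ^ J - 1 = - (1 - x ^ J) by ring, show x - 1 = -(1 - x) by ring, neg_div_neg_eq]; ring
  have hSle : ∀ J, |S J| ≤ B := by
    intro J
    rw [abs_of_nonneg (hS0 J), hSB]
    have : 0 ≤ x ^ J := by positivity
    nlinarith
  have hM : ∀ f : Fin r → ℕ, Mf f ≤ C * ∏ i, x ^ (f i) := by
    intro f
    refine (hC f).trans (le_of_eq ?_)
    rw [bN_rpow, Finset.prod_pow_eq_pow_sum, hx, ← Real.rpow_natCast, ← Real.rpow_mul (by norm_num)]
    congr 2; push_cast; ring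
  have hsub : ∀ {J J' : ℕ}, J ≤ J' → Fintype.piFinset (fun _ : Fin r => range J) ⊆
      Fintype.piFinset (fun _ : Fin r => range J') := fun h =>
    Fintype.piFinset_subset _ _ fun _ => range_mono h
  have hdiff : ∀ J J', J ≤ J' → kap r J ≤ kap r J' ∧
      kap r J' - kap r J ≤ (C * r * B ^ r + 1) * x ^ J := by
    intro J J' h
    have e1 : kap r J' - kap r J = ∑ f ∈ Fintype.piFinset (fun _ : Fin r => range J') \
        Fintype.piFinset (fun _ : Fin r => range J), Mf f := by
      unfold kap; rw [Finset.sum_sdiff_eq_sub (hsub h)]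
    constructor
    · rw [← sub_nonneg, e1]
      exact Finset.sum_nonneg fun f _ => Mf_nonneg f
    · rw [e1]
      have e2 : ∀ J, ∑ f ∈ Fintype.piFinset (fun _ : Fin r => range J), ∏ i, x ^ (f i) = S J ^ r := by
        intro J
        rw [← Finset.prod_univ_sum (fun _ : Fin r => range J) (fun _ j => x ^ j)]
        simp [hS]
      calc _ ≤ ∑ f ∈ Fintype.piFinset (fun _ : Fin r => range J') \
              Fintype.piFinset (fun _ : Fin r => range J), C * ∏ i, x ^ (f i) :=
            Finset.sum_le_sum fun f _ => hM f
        _ = C * (S J' ^ r - S J ^ r) := by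
            rw [← Finset.mul_sum, Finset.sum_sdiff_eq_sub (hsub h), e2, e2]
        _ ≤ C * (r * B ^ (r - 1) * |S J' - S J|) := by
            gcongr
            exact (le_abs_self _).trans (pow_diff_le r _ _ _ (hSle _) (hSle _))
        _ ≤ C * (r * B ^ (r - 1) * (B * x ^ J)) := by
            gcongr
            rw [hSB, hSB, ← mul_sub, abs_mul, abs_of_pos hB0]
            have : x ^ J' ≤ x ^ J := pow_le_pow_of_le_one hx0.le hx1.le h
            have : 0 < x ^ J' := by positivity
            gcongr
            rw [abs_le]; constructor <;> linarith
        _ ≤ _ := by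
            rcases Nat.eq_zero_or_pos r with rfl | hr
            · simp; positivity
            · have : B ^ r = B ^ (r - 1) * B := by rw [← pow_succ]; congr 1; omega
              rw [this]
              have : 0 < x ^ J := by positivity
              nlinarith
  have hmono : Monotone (kap r) := fun J J' h => (hdiff J J' h).1
  have hbdd : BddAbove (Set.range (kap r)) := by
    refine ⟨kap r 0 + (C * r * B ^ r + 1), ?_⟩
    rintro _ ⟨J, rfl⟩
    have := (hdiff 0 J (Nat.zero_le _)).2
    simp at this ⊢; linarith
  have htend := tendsto_atTop_ciSup hmono hbdd
  refine ⟨⨆ J, kap r J, C * r * B ^ r + 1, ?_, ?_, ?_⟩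
  · have h1 : kap r 1 ≤ ⨆ J, kap r J := le_ciSup hbdd 1
    have h2 : 1 / 24 ≤ kap r 1 := by
      unfold kap
      refine (Mf_zero_pos (fun _ : Fin r => 0) fun _ => rfl).trans ?_
      refine Finset.single_le_sum (f := fun f : Fin r → ℕ => Mf f) (fun f _ => Mf_nonneg f) ?_
      simp
    linarith
  · have : 0 ≤ C * r * B ^ r := by positivity
    linarith
  · intro J
    have h1 : kap r J ≤ ⨆ J, kap r J := le_ciSup hbdd J
    rw [abs_of_nonneg (by linarith)]
    have h2 : (⨆ J, kap r J) ≤ kap r J + (C * r * B ^ r + 1) * x ^ J := by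
      refine ciSup_le fun J' => ?_
      rcases le_total J J' with h | h
      · linarith [(hdiff J J' h).2]
      · have := hmono h
        have : 0 ≤ (C * r * B ^ r + 1) * x ^ J := by positivity
        linarith
    have : x ^ J = (2 : ℝ) ^ (-(2 / 5 : ℝ) * J) := by
      rw [hx, ← Real.rpow_natCast, ← Real.rpow_mul (by norm_num)]
    rw [← this]; linarith

noncomputable def Hfun (v m : ℕ) : ℝ := ∑' j, T v j m

lemma sqfree_not_sq {m : ℕ} (h : Squarefree m) (h2 : 2 ≤ m) : ¬ IsSquare m := by
  rintro ⟨k, rfl⟩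
  have := h k dvd_rfl
  rw [Nat.isUnit_iff] at this
  subst this; omega

theorem H_tail (η : ℝ) (hη : 0 < η) : ∃ C : ℝ, 1 ≤ C ∧ ∀ v m J : ℕ, (v = 1 ∨ v = 2) → Odd m → ¬ IsSquare m →
    Summable (fun j => T v j m) ∧
    |Hfun v m - ∑ j ∈ range J, T v j m| ≤ C * (m : ℝ) ^ (1 / 2 + η) / 2 ^ J := by
  obtain ⟨C, hC1, hC⟩ := T_pv η hη
  refine ⟨2 * C, by linarith, fun v m J hv hm hms => ?_⟩
  have hb : ∀ j, |T v j m| ≤ C * (m : ℝ) ^ (1 / 2 + η) * (1 / 2) ^ j := by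
    intro j
    have := hC v m 1 j hv hm hms odd_one
    simp only [one_pow, mul_one, Nat.cast_one, Real.one_rpow] at this
    rw [one_div, inv_pow, ← div_eq_mul_inv]
    simpa using this
  have hs0 : Summable (fun j : ℕ => C * (m : ℝ) ^ (1 / 2 + η) * (1 / 2 : ℝ) ^ j) :=
    summable_geometric_two.mul_left _
  have hs : Summable (fun j => T v j m) :=
    Summable.of_norm_bounded hs0 (fun j => by simpa using hb j)
  refine ⟨hs, ?_⟩
  have h1 : Hfun v m - ∑ j ∈ range J, T v j m = ∑' j, T v (j + J) m := by
    rw [Hfun, ← hs.sum_add_tsum_nat_add J]; ring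
  rw [h1]
  have h2 : HasSum (fun j : ℕ => C * (m : ℝ) ^ (1 / 2 + η) * (1 / 2 : ℝ) ^ J * (1 / 2 : ℝ) ^ j)
      (C * (m : ℝ) ^ (1 / 2 + η) * (1 / 2 : ℝ) ^ J * 2) := hasSum_geometric_two.mul_left _
  have := tsum_of_norm_bounded h2 (f := fun j => T v (j + J) m) (fun j => by
    rw [Real.norm_eq_abs]
    refine (hb _).trans (le_of_eq ?_)
    rw [pow_add]; ring)
  rw [Real.norm_eq_abs] at this
  refine this.trans (le_of_eq ?_)
  rw [one_div, inv_pow]; field_simp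
end Mom

namespace Mom
open Finset

lemma log_pow_bound (r : ℕ) (A ε : ℝ) (hA : 1 ≤ A) (hε : 0 < ε) : ∃ C : ℝ, 1 ≤ C ∧ ∀ L : ℝ, 0 ≤ L →
    (L + A) ^ r ≤ C * (2 : ℝ) ^ (ε * L) := by
  set c : ℝ := ε * Real.log 2 / (r + 1) with hc
  have hl : 0 < Real.log 2 := Real.log_pos (by norm_num)
  have hc0 : 0 < c := by positivity
  have hD : 1 ≤ A + 1 / c := by have : 0 < 1 / c := by positivity
                                linarith
  refine ⟨(A + 1 / c) ^ r, one_le_pow₀ hD, fun L hL => ?_⟩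
  have h1 : L + A ≤ (A + 1 / c) * Real.exp (c * L) := by
    have h := Real.add_one_le_exp (c * L)
    have h2 : 1 ≤ Real.exp (c * L) := Real.one_le_exp (by positivity)
    have h3 : L ≤ 1 / c * Real.exp (c * L) := by
      rw [div_mul_eq_mul_div, le_div_iff₀ hc0]; linarith
    have h4 : A ≤ A * Real.exp (c * L) := le_mul_of_one_le_right (by linarith) h2
    linarith
  calc (L + A) ^ r ≤ ((A + 1 / c) * Real.exp (c * L)) ^ r := by gcongr
    _ = (A + 1 / c) ^ r * Real.exp (r * (c * L)) := by rw [mul_pow, ← Real.exp_nat_mul]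
    _ ≤ (A + 1 / c) ^ r * (2 : ℝ) ^ (ε * L) := by
      rw [Real.rpow_def_of_pos (by norm_num)]
      have : 0 ≤ A + 1 / c := by linarith
      refine mul_le_mul_of_nonneg_left (Real.exp_le_exp.2 ?_) (by positivity)
      have : (r : ℝ) * c ≤ ε * Real.log 2 := by
        rw [hc, ← mul_div_assoc, div_le_iff₀ (by positivity)]
        have : 0 < ε * Real.log 2 := by positivity
        nlinarith
      nlinarith

noncomputable def SH (r v a X : ℕ) : ℝ :=
  ∑ m ∈ (range (X + 1)).filter (fun m => m % 8 = a ∧ Squarefree m ∧ 2 ≤ m), Hfun v m ^ r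

lemma pow_sum_T (r v m J : ℕ) : (∑ j ∈ range J, T v j m) ^ r =
    ∑ f ∈ Fintype.piFinset (fun _ : Fin r => range J), ∏ i, T v (f i) m := by
  rw [← Finset.prod_univ_sum (fun _ : Fin r => range J) (fun _ j => T v j m)]
  simp

lemma sum_T_le (v m J : ℕ) : |∑ j ∈ range J, T v j m| ≤ J := by
  refine (Finset.abs_sum_le_sum_abs _ _).trans ?_
  refine (Finset.sum_le_card_nsmul _ _ 1 fun j _ => T_le_one v j m).trans ?_
  simp

set_option maxHeartbeats 1000000 in
theorem theoremA (r : ℕ) : ∃ κ : ℝ, 0 < κ ∧ ∀ ε : ℝ, 0 < ε → ∃ C : ℝ, 1 ≤ C ∧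
    ∀ v a X : ℕ, (v = 1 ∨ v = 2) → a < 8 → Odd a → 1 ≤ X →
      |SH r v a X - κ * X| ≤ C * (X : ℝ) ^ (2 / 3 + ε) := by
  obtain ⟨κ, C1, hκ, hC1, h1⟩ := kappa r
  refine ⟨κ, hκ, fun ε hε => ?_⟩
  set η : ℝ := min (ε / 2) (1 / 3) with hη
  have hη0 : 0 < η := by rw [hη]; positivity
  have hη1 : η ≤ ε / 2 := min_le_left _ _
  have hη2 : η ≤ 1 / 3 := min_le_right _ _
  obtain ⟨C2, hC2, h2⟩ := box_final r η hη0
  obtain ⟨C3, hC3, h3⟩ := H_tail η hη0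
  obtain ⟨C4, hC4, h4⟩ := log_pow_bound r 1 η le_rfl hη0
  obtain ⟨C5, hC5, h5⟩ := log_pow_bound (r - 1) (1 + C3) η (by linarith) hη0
  refine ⟨C4 * C2 + C1 + 2 * (r * C5 * C3) + C4, ?_, ?_⟩
  · have : 0 ≤ C4 * C2 := by positivity
    have : 0 ≤ 2 * (r * C5 * C3) := by positivity
    linarith
  intro v a X hv ha hao hX
  have hX0 : (0 : ℝ) < X := by exact_mod_cast hX
  have hX1 : (1 : ℝ) ≤ X := by exact_mod_cast hX
  set L := Real.logb 2 X with hL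
  have hL0 : 0 ≤ L := Real.logb_nonneg (by norm_num) hX1
  have hXL : (X : ℝ) = 2 ^ L := (Real.rpow_logb (by norm_num) (by norm_num) hX0).symm
  set J : ℕ := ⌊5 / 6 * L⌋₊ + 1 with hJ
  have hJ1 : 5 / 6 * L ≤ J := by rw [hJ]; push_cast; exact (Nat.lt_floor_add_one _).le
  have hJ2 : (J : ℝ) ≤ L + 1 := by
    rw [hJ]; push_cast
    have := Nat.floor_le (by positivity : 0 ≤ 5 / 6 * L)
    linarith
  have hJf : ∀ j ∈ range J, (j : ℝ) ≤ 5 / 6 * L := by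
    intro j hj
    rw [mem_range, hJ] at hj
    exact (Nat.le_floor_iff (by positivity)).1 (by omega)
  have hJp : (J : ℝ) ^ r ≤ C4 * (2 : ℝ) ^ (η * L) :=
    (pow_le_pow_left₀ (by positivity) hJ2 r).trans (h4 L hL0)
  set U := (2 : ℝ) ^ ((2 / 3 + ε) * L) with hU
  have hUX : (X : ℝ) ^ (2 / 3 + ε) = U := by rw [hXL, ← Real.rpow_mul (by norm_num), mul_comm]
  rw [hUX]
  have hU0 : 0 < U := by positivity
  set P : ℕ → ℝ := fun m => ∑ j ∈ range J, T v j m with hP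
  set SP : ℝ := ∑ m ∈ (range (X + 1)).filter (fun m => m % 8 = a), if Squarefree m then P m ^ r else 0 with hSP
  have hel : ∀ m : ℝ, m ≤ ε → (2 : ℝ) ^ (m * L) ≤ 2 ^ (ε * L) := fun m hm => two_mono (by nlinarith)
  -- part 1
  have p1 : |SP - X * kap r J| ≤ C4 * C2 * U := by
    have e : SP - X * kap r J = ∑ f ∈ Fintype.piFinset (fun _ : Fin r => range J), (Sf f v a X - X * Mf f) := by
      rw [Finset.sum_sub_distrib, kap, Finset.mul_sum]
      congr 1
      unfold Sf
      rw [Finset.sum_comm, hSP]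
      refine Finset.sum_congr rfl fun m _ => ?_
      split_ifs
      · exact pow_sum_T r v m J
      · simp
    rw [e]
    refine (Finset.abs_sum_le_sum_abs _ _).trans ?_
    refine (Finset.sum_le_card_nsmul _ _ (C2 * (2 : ℝ) ^ ((2 / 3 + η) * L)) fun f hf => ?_).trans ?_
    · refine h2 f v a X L hv ha hao hL0 hXL fun i => hJf _ ?_
      exact Fintype.mem_piFinset.1 hf i
    · rw [nsmul_eq_mul, Fintype.card_piFinset]
      simp only [card_range, prod_const, card_univ, Fintype.card_fin]
      push_cast
      calc (J : ℝ) ^ r * (C2 * (2 : ℝ) ^ ((2 / 3 + η) * L)) ≤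
          (C4 * (2 : ℝ) ^ (η * L)) * (C2 * (2 : ℝ) ^ ((2 / 3 + η) * L)) := by gcongr
        _ = C4 * C2 * (2 : ℝ) ^ (η * L + (2 / 3 + η) * L) := by rw [Real.rpow_add (by norm_num)]; ring
        _ ≤ C4 * C2 * U := by gcongr; apply two_mono; nlinarith
  -- part 2
  have p2 : |X * kap r J - κ * X| ≤ C1 * U := by
    rw [show (X : ℝ) * kap r J - κ * X = - (X * (κ - kap r J)) by ring, abs_neg, abs_mul, abs_of_pos hX0]
    calc (X : ℝ) * |κ - kap r J| ≤ X * (C1 * (2 : ℝ) ^ (-(2 / 5 : ℝ) * J)) := by gcongr; exact h1 J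
      _ = C1 * 2 ^ (L + -(2 / 5 : ℝ) * J) := by rw [Real.rpow_add (by norm_num), ← hXL]; ring
      _ ≤ C1 * U := by gcongr; apply two_mono; nlinarith
  -- part 3
  set SP' : ℝ := ∑ m ∈ (range (X + 1)).filter (fun m => m % 8 = a ∧ Squarefree m ∧ 2 ≤ m), P m ^ r with hSP'
  have p3 : |SP' - SP| ≤ C4 * U := by
    have e : |SP' - SP| ≤ |P 1| ^ r := by
      have : SP = ∑ m ∈ (range (X + 1)).filter (fun m => m % 8 = a ∧ Squarefree m), P m ^ r := by
        rw [hSP, ← Finset.sum_filter, Finset.filter_filter]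
      rw [this, hSP', ← Finset.sum_filter_add_sum_filter_not ((range (X + 1)).filter (fun m => m % 8 = a ∧ Squarefree m))
        (fun m => 2 ≤ m), Finset.filter_filter, Finset.filter_filter]
      simp only [and_assoc, sub_add_cancel_left, abs_neg]
      have : (range (X + 1)).filter (fun m => m % 8 = a ∧ Squarefree m ∧ ¬ 2 ≤ m) ⊆ {1} := by
        intro m hm
        rw [mem_filter] at hm
        obtain ⟨_, _, h, h'⟩ := hm
        have := h.ne_zero
        rw [mem_singleton]; omega
      refine (Finset.abs_sum_le_sum_abs _ _).trans ?_
      refine (Finset.sum_le_sum_of_subset_of_nonneg this fun _ _ _ => abs_nonneg _).trans ?_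
      simp [abs_pow]
    refine e.trans ?_
    calc |P 1| ^ r ≤ (J : ℝ) ^ r := by gcongr; exact sum_T_le _ _ _
      _ ≤ C4 * (2 : ℝ) ^ (η * L) := hJp
      _ ≤ C4 * U := by gcongr; apply two_mono; nlinarith
  -- part 4
  have p4 : |SH r v a X - SP'| ≤ 2 * (r * C5 * C3) * U := by
    unfold SH
    rw [hSP', ← Finset.sum_sub_distrib]
    refine (Finset.abs_sum_le_sum_abs _ _).trans ?_
    have key : ∀ m ∈ (range (X + 1)).filter (fun m => m % 8 = a ∧ Squarefree m ∧ 2 ≤ m),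
        |Hfun v m ^ r - P m ^ r| ≤ r * (C5 * (2 : ℝ) ^ (η * L)) * (C3 * (2 : ℝ) ^ ((-(1 / 3) + η) * L)) := by
      intro m hm
      rw [mem_filter, mem_range] at hm
      obtain ⟨hmX, hma, hms, hm2⟩ := hm
      have hmodd : Odd m := by rw [Nat.odd_iff] at hao ⊢; omega
      have ht := (h3 v m J hv hmodd (sqfree_not_sq hms hm2)).2
      have ht' : |Hfun v m - P m| ≤ C3 * (2 : ℝ) ^ ((-(1 / 3) + η) * L) := by
        refine ht.trans ?_
        have hmX' : (m : ℝ) ≤ X := by exact_mod_cast Nat.lt_succ_iff.1 hmX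
        calc C3 * (m : ℝ) ^ (1 / 2 + η) / 2 ^ J ≤ C3 * (X : ℝ) ^ (1 / 2 + η) / 2 ^ J := by gcongr
          _ = C3 * (2 : ℝ) ^ (L * (1 / 2 + η) - J) := by
            rw [Real.rpow_sub (by norm_num), Real.rpow_mul (by norm_num), ← hXL, Real.rpow_natCast]; ring
          _ ≤ _ := mul_le_mul_of_nonneg_left (two_mono (by nlinarith)) (by linarith)
      have hP1 : |P m| ≤ L + (1 + C3) := by
        have : |P m| ≤ J := sum_T_le _ _ _
        linarith
      have h2' : C3 * (2 : ℝ) ^ ((-(1 / 3) + η) * L) ≤ C3 := by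
        have : (2 : ℝ) ^ ((-(1 / 3) + η) * L) ≤ 1 := by
          have := two_mono (show (-(1 / 3) + η) * L ≤ 0 by nlinarith)
          simpa using this
        nlinarith
      have hP2 : |Hfun v m| ≤ L + (1 + C3) := by
        have : |P m| ≤ J := sum_T_le _ _ _
        have : |Hfun v m| ≤ |Hfun v m - P m| + |P m| := by
          have := abs_add_le (Hfun v m - P m) (P m)
          simpa using this
        linarith
      refine (pow_diff_le r _ _ _ hP2 hP1).trans ?_
      gcongr
      exact h5 L hL0
    refine (Finset.sum_le_card_nsmul _ _ _ key).trans ?_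
    rw [nsmul_eq_mul]
    have hcard : ((((range (X + 1)).filter (fun m => m % 8 = a ∧ Squarefree m ∧ 2 ≤ m)).card : ℕ) : ℝ) ≤ 2 * X := by
      have := Finset.card_filter_le (range (X + 1)) (fun m => m % 8 = a ∧ Squarefree m ∧ 2 ≤ m)
      rw [card_range] at this
      have h' : (((range (X + 1)).filter (fun m => m % 8 = a ∧ Squarefree m ∧ 2 ≤ m)).card) ≤ 2 * X := by omega
      exact_mod_cast h'
    calc _ ≤ 2 * (X : ℝ) * (r * (C5 * (2 : ℝ) ^ (η * L)) * (C3 * (2 : ℝ) ^ ((-(1 / 3) + η) * L))) := by gcongr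
      _ = 2 * (r * C5 * C3) * (2 : ℝ) ^ (L + η * L + (-(1 / 3) + η) * L) := by
        rw [Real.rpow_add (by norm_num), Real.rpow_add (by norm_num), ← hXL]; ring
      _ ≤ _ := by gcongr; apply two_mono; nlinarith
  have : SH r v a X - κ * X = (SH r v a X - SP') + (SP' - SP) + (SP - X * kap r J) + (X * kap r J - κ * X) := by ring
  rw [this]
  have q1 := abs_add_le ((SH r v a X - SP') + (SP' - SP) + (SP - X * kap r J)) (X * kap r J - κ * X)
  have q2 := abs_add_le ((SH r v a X - SP') + (SP' - SP)) (SP - X * kap r J)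
  have q3 := abs_add_le (SH r v a X - SP') (SP' - SP)
  linarith
end Mom

namespace Mom
open Finset

/-- Abel summation against an increasing weight. -/
lemma abel_incr (b g : ℕ → ℝ) (B : ℝ) (N : ℕ) (hg0 : ∀ n, 0 ≤ g n) (hg : ∀ n, g n ≤ g (n + 1))
    (hB : ∀ n ≤ N, |∑ i ∈ range (n + 1), b i| ≤ B) :
    |∑ i ∈ range (N + 1), g i * b i| ≤ 2 * B * g N := by
  have hB0 : 0 ≤ B := (abs_nonneg _).trans (hB 0 (Nat.zero_le _))
  have key : ∀ n, n ≤ N → |∑ i ∈ range (n + 1), g i * b i - g n * ∑ i ∈ range (n + 1), b i| ≤ B * g n := by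
    intro n
    induction n with
    | zero => intro _; simp; exact mul_nonneg hB0 (hg0 0)
    | succ n ih =>
      intro hn
      have h1 := ih (by omega)
      have h2 := hB n (by omega)
      rw [Finset.sum_range_succ _ (n + 1), Finset.sum_range_succ b (n + 1)]
      have e : ∑ i ∈ range (n + 1), g i * b i + g (n + 1) * b (n + 1) -
          g (n + 1) * (∑ i ∈ range (n + 1), b i + b (n + 1)) =
          (∑ i ∈ range (n + 1), g i * b i - g n * ∑ i ∈ range (n + 1), b i) -
          (g (n + 1) - g n) * ∑ i ∈ range (n + 1), b i := by ring
      rw [e]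
      have h3 := abs_sub (∑ i ∈ range (n + 1), g i * b i - g n * ∑ i ∈ range (n + 1), b i)
          ((g (n + 1) - g n) * ∑ i ∈ range (n + 1), b i)
      have h0 := sub_nonneg.2 (hg n)
      rw [abs_mul, abs_of_nonneg h0] at h3
      have := mul_le_mul_of_nonneg_left h2 h0
      linarith
  have h1 := key N le_rfl
  have h2 := hB N le_rfl
  have h3 := abs_add_le (∑ i ∈ range (N + 1), g i * b i - g N * ∑ i ∈ range (N + 1), b i)
    (g N * ∑ i ∈ range (N + 1), b i)
  rw [sub_add_cancel, abs_mul, abs_of_nonneg (hg0 N)] at h3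
  have := mul_le_mul_of_nonneg_left h2 (hg0 N)
  linarith

lemma sum_rpow_bounds (α : ℝ) (hα : 0 < α) (N : ℕ) :
    |∑ m ∈ range (N + 1), (m : ℝ) ^ α - (N : ℝ) ^ (α + 1) / (α + 1)| ≤ (N : ℝ) ^ α := by
  have hm : MonotoneOn (fun x : ℝ => x ^ α) (Set.Icc ((0 : ℕ) : ℝ) (N : ℕ)) := by
    intro x hx y hy h
    simp only [Nat.cast_zero, Set.mem_Icc] at hx
    exact Real.rpow_le_rpow hx.1 h hα.le
  have h1 := hm.sum_le_integral_Ico (Nat.zero_le N)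
  have h2 := hm.integral_le_sum_Ico (Nat.zero_le N)
  have h_integral : ∫ x in ((0 : ℕ) : ℝ)..(N : ℕ), x ^ α = (N : ℝ) ^ (α + 1) / (α + 1) := by
    rw [integral_rpow (Or.inl (by linarith))]
    simp [Real.zero_rpow (by linarith : α + 1 ≠ 0)]
  rw [h_integral] at h1 h2
  rw [Finset.sum_range_succ]
  have h3 : ∑ i ∈ Ico 0 N, ((i + 1 : ℕ) : ℝ) ^ α = ∑ m ∈ range N, (m : ℝ) ^ α + (N : ℝ) ^ α := by
    rw [← Finset.sum_range_succ, Finset.sum_range_succ', ← Finset.range_eq_Ico]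
    simp [Real.zero_rpow hα.ne']
  rw [h3] at h2
  rw [← Finset.range_eq_Ico] at h1
  have h4 : 0 ≤ (N : ℝ) ^ α := by positivity
  rw [abs_le]; constructor <;> linarith

theorem partial_sum (h : ℕ → ℝ) (κ C α θ : ℝ) (hκ : 0 ≤ κ) (hC : 0 ≤ C) (hα : 0 < α) (hθ : 0 < θ) (h0 : h 0 = 0)
    (hA : ∀ X : ℕ, 1 ≤ X → |∑ m ∈ range (X + 1), h m - κ * X| ≤ C * (X : ℝ) ^ θ) (N : ℕ) (hN : 1 ≤ N) :
    |∑ m ∈ range (N + 1), (m : ℝ) ^ α * h m - κ / (α + 1) * (N : ℝ) ^ (α + 1)| ≤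
      (2 * C + κ) * (N : ℝ) ^ (α + θ) := by
  have hN1 : (1 : ℝ) ≤ N := by exact_mod_cast hN
  set b : ℕ → ℝ := fun m => h m - if m = 0 then 0 else κ with hb
  have hbs : ∀ n, ∑ i ∈ range (n + 1), b i = ∑ m ∈ range (n + 1), h m - κ * n := by
    intro n
    rw [hb, Finset.sum_sub_distrib]
    congr 1
    rw [Finset.sum_range_succ']
    simp; ring
  have h1 := abel_incr b (fun m => (m : ℝ) ^ α) (C * (N : ℝ) ^ θ) N (fun n => by positivity)
    (fun n => Real.rpow_le_rpow (by positivity) (by push_cast; linarith) hα.le) (by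
      intro n hn
      rw [hbs]
      rcases Nat.eq_zero_or_pos n with rfl | hp
      · simp [h0]; positivity
      · refine (hA n hp).trans ?_
        gcongr)
  have e1 : ∑ i ∈ range (N + 1), (i : ℝ) ^ α * b i = ∑ m ∈ range (N + 1), (m : ℝ) ^ α * h m -
      κ * ∑ m ∈ range (N + 1), (m : ℝ) ^ α := by
    rw [Finset.mul_sum, ← Finset.sum_sub_distrib]
    refine Finset.sum_congr rfl fun m _ => ?_
    rw [hb]
    simp only
    split_ifs with hm
    · subst hm; simp [Real.zero_rpow hα.ne']
    · ring
  rw [e1] at h1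
  have h2 := sum_rpow_bounds α hα N
  have h3 := mul_le_mul_of_nonneg_left h2 hκ
  rw [← abs_of_nonneg hκ, ← abs_mul, abs_of_nonneg hκ] at h3
  have h4 := abs_add_le (∑ m ∈ range (N + 1), (m : ℝ) ^ α * h m - κ * ∑ m ∈ range (N + 1), (m : ℝ) ^ α)
    (κ * (∑ m ∈ range (N + 1), (m : ℝ) ^ α - (N : ℝ) ^ (α + 1) / (α + 1)))
  have e2 : ∑ m ∈ range (N + 1), (m : ℝ) ^ α * h m - κ * ∑ m ∈ range (N + 1), (m : ℝ) ^ α +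
    (κ * (∑ m ∈ range (N + 1), (m : ℝ) ^ α - (N : ℝ) ^ (α + 1) / (α + 1))) =
    ∑ m ∈ range (N + 1), (m : ℝ) ^ α * h m - κ / (α + 1) * (N : ℝ) ^ (α + 1) := by ring
  rw [e2] at h4
  have h5 : (N : ℝ) ^ α ≤ (N : ℝ) ^ (α + θ) := Real.rpow_le_rpow_of_exponent_le hN1 (by linarith)
  have h6 : 2 * (C * (N : ℝ) ^ θ) * (N : ℝ) ^ α = 2 * C * (N : ℝ) ^ (α + θ) := by
    rw [Real.rpow_add (by linarith)]; ring
  have h7 := mul_le_mul_of_nonneg_left h5 hκ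
  linarith

lemma floor_rpow (α y : ℝ) (hα : 0 < α) (hy : 1 ≤ y) :
    |(⌊y⌋₊ : ℝ) ^ (α + 1) / (α + 1) - y ^ (α + 1) / (α + 1)| ≤ y ^ α := by
  have hy0 : 0 < y := by linarith
  have h1 := Nat.floor_le hy0.le
  have h2 := Nat.lt_floor_add_one y
  have h3 := Real.rpow_le_rpow (by positivity) h1 (by linarith : 0 ≤ α + 1)
  set X : ℝ := (⌊y⌋₊ : ℝ) with hX
  have hX0 : 0 ≤ X := by positivity
  have h4 := one_add_mul_self_le_rpow_one_add (s := X / y - 1) (p := α + 1)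
    (by have : 0 ≤ X / y := by positivity
        linarith) (by linarith)
  rw [add_sub_cancel, Real.div_rpow hX0 hy0.le, le_div_iff₀ (by positivity)] at h4
  have h5 : y ^ (α + 1) = y ^ α * y := by rw [Real.rpow_add hy0, Real.rpow_one]
  have h6 : (1 + (α + 1) * (X / y - 1)) * y ^ (α + 1) = y ^ (α + 1) - (α + 1) * ((y - X) * y ^ α) := by
    rw [h5]; field_simp; ring
  rw [h6] at h4
  have hp : 0 < y ^ α := by positivity
  have h7 : (y - X) * y ^ α ≤ y ^ α := by nlinarith
  rw [← sub_div, abs_div, abs_of_pos (by linarith : 0 < α + 1), div_le_iff₀ (by linarith)]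
  rw [abs_le]
  constructor
  · nlinarith
  · have : 0 < y ^ α * (α + 1) := by positivity
    linarith

noncomputable def Fam (r v a c : ℕ) (Y : ℝ) : ℝ :=
  ∑ m ∈ (range (⌊Y / c⌋₊ + 1)).filter (fun m => m % 8 = a ∧ Squarefree m ∧ 2 ≤ m),
    (m : ℝ) ^ ((r : ℝ) / 2) * Hfun v m ^ r

theorem fam_asymp (r : ℕ) (hr : 1 ≤ r) : ∃ κ : ℝ, 0 < κ ∧ ∀ ε : ℝ, 0 < ε → ∃ C : ℝ, 1 ≤ C ∧
    ∀ (v a c : ℕ) (Y : ℝ), (v = 1 ∨ v = 2) → a < 8 → Odd a → 1 ≤ c → 1 ≤ Y →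
      |Fam r v a c Y - κ * (Y / c) ^ ((r : ℝ) / 2 + 1)| ≤ C * Y ^ ((r : ℝ) / 2 + 2 / 3 + ε) := by
  obtain ⟨κ, hκ, h⟩ := theoremA r
  set α : ℝ := (r : ℝ) / 2 with hαd
  have hα : 0 < α := by have : (0 : ℝ) < r := by exact_mod_cast hr
                        positivity
  refine ⟨κ / (α + 1), by positivity, fun ε hε => ?_⟩
  obtain ⟨C, hC1, hC⟩ := h ε hε
  refine ⟨2 * C + 2 * κ, by linarith, ?_⟩
  intro v a c Y hv ha hao hc hY
  have hc1 : (1 : ℝ) ≤ c := by exact_mod_cast hc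
  set y := Y / c with hy
  have hyY : y ≤ Y := div_le_self (by linarith) hc1
  have hy0 : 0 < y := by positivity
  have hF : Fam r v a c Y = ∑ m ∈ range (⌊y⌋₊ + 1), (m : ℝ) ^ α *
      (if m % 8 = a ∧ Squarefree m ∧ 2 ≤ m then Hfun v m ^ r else 0) := by
    unfold Fam
    rw [Finset.sum_filter]
    refine Finset.sum_congr rfl fun m _ => ?_
    split_ifs <;> simp [hαd]
  rw [hF, add_assoc]
  have hexp : (1 : ℝ) ≤ Y ^ (α + (2 / 3 + ε)) := Real.one_le_rpow hY (by linarith)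
  rcases lt_or_ge y 1 with h1 | h1
  · rw [Nat.floor_eq_zero.2 h1]
    simp only [zero_add, Finset.range_one, Finset.sum_singleton]
    rw [if_neg (by simp), mul_zero, zero_sub, abs_neg, abs_of_nonneg (by positivity)]
    have t1 : y ^ (α + 1) ≤ 1 := Real.rpow_le_one hy0.le h1.le (by linarith)
    have t2 : κ / (α + 1) ≤ κ := div_le_self hκ.le (by linarith)
    have t3 : κ / (α + 1) * y ^ (α + 1) ≤ κ * 1 := mul_le_mul t2 t1 (by positivity) hκ.le
    have t4 := mul_le_mul_of_nonneg_left hexp (by linarith : 0 ≤ 2 * C + 2 * κ)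
    linarith
  · have hfl : 1 ≤ ⌊y⌋₊ := Nat.one_le_floor_iff _ |>.2 h1
    have p1 := partial_sum (fun m => if m % 8 = a ∧ Squarefree m ∧ 2 ≤ m then Hfun v m ^ r else 0) κ C α (2 / 3 + ε)
      hκ.le (by linarith) hα (by linarith) (by simp) (by
        intro X hX
        have := hC v a X hv ha hao hX
        rw [SH, Finset.sum_filter] at this
        exact this) ⌊y⌋₊ hfl
    have p2 := mul_le_mul_of_nonneg_left (floor_rpow α y hα h1) hκ.le
    rw [← abs_of_nonneg hκ.le, ← abs_mul, abs_of_nonneg hκ.le] at p2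
    set S := ∑ m ∈ range (⌊y⌋₊ + 1), (m : ℝ) ^ α *
      (if m % 8 = a ∧ Squarefree m ∧ 2 ≤ m then Hfun v m ^ r else 0) with hS
    have q := abs_add_le (S - κ / (α + 1) * (⌊y⌋₊ : ℝ) ^ (α + 1))
      (κ * ((⌊y⌋₊ : ℝ) ^ (α + 1) / (α + 1) - y ^ (α + 1) / (α + 1)))
    have e : (S - κ / (α + 1) * (⌊y⌋₊ : ℝ) ^ (α + 1)) +
      (κ * ((⌊y⌋₊ : ℝ) ^ (α + 1) / (α + 1) - y ^ (α + 1) / (α + 1))) = S - κ / (α + 1) * y ^ (α + 1) := by ring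
    rw [e] at q
    have t1 : (⌊y⌋₊ : ℝ) ^ (α + (2 / 3 + ε)) ≤ Y ^ (α + (2 / 3 + ε)) :=
      Real.rpow_le_rpow (by positivity) ((Nat.floor_le hy0.le).trans hyY) (by linarith)
    have t2 : y ^ α ≤ Y ^ (α + (2 / 3 + ε)) :=
      (Real.rpow_le_rpow hy0.le hyY hα.le).trans (Real.rpow_le_rpow_of_exponent_le hY (by linarith))
    have t3 := mul_le_mul_of_nonneg_left t1 (by linarith : 0 ≤ 2 * C + κ)
    have t4 := mul_le_mul_of_nonneg_left t2 hκ.le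
    linarith
end Mom

namespace Mom
open Finset NumberField

lemma exists_theta (K : Type) [Field K] [NumberField K] (h2 : Module.finrank ℚ K = 2) :
    ∃ (θ : 𝓞 K) (t n : ℤ), θ * θ = t * θ - n ∧ (∀ x : 𝓞 K, ∃ a b : ℤ, x = a + b * θ) ∧
      (∀ a b : ℤ, (a : 𝓞 K) + b * θ = 0 → a = 0 ∧ b = 0) ∧ t ^ 2 - 4 * n = NumberField.discr K := by
  have hr : Module.finrank ℤ (𝓞 K) = 2 := by rw [RingOfIntegers.rank]; exact h2
  set B : Module.Basis (Fin 2) ℤ (𝓞 K) := Module.finBasisOfFinrankEq ℤ (𝓞 K) hr with hB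
  have hrep : ∀ z : 𝓞 K, z = B.repr z 0 * B 0 + B.repr z 1 * B 1 := by
    intro z
    conv_lhs => rw [← B.sum_repr z]
    simp [Fin.sum_univ_two]
  have hind : ∀ a b : ℤ, (a : 𝓞 K) * B 0 + b * B 1 = 0 → a = 0 ∧ b = 0 := by
    intro a b h
    have := Fintype.linearIndependent_iff.1 B.linearIndependent ![a, b] (by
      simpa [Fin.sum_univ_two] using h)
    exact ⟨this 0, this 1⟩
  obtain ⟨x, y, h1⟩ : ∃ x y : ℤ, (1 : 𝓞 K) = x * B 0 + y * B 1 := ⟨_, _, hrep 1⟩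
  have hg : IsCoprime x y := by
    rw [Int.isCoprime_iff_gcd_eq_one]
    set g := Int.gcd x y with hgd
    obtain ⟨x', hx'⟩ : (g : ℤ) ∣ x := Int.gcd_dvd_left ..
    obtain ⟨y', hy'⟩ : (g : ℤ) ∣ y := Int.gcd_dvd_right ..
    have hu : IsUnit (g : 𝓞 K) := by
      apply IsUnit.of_mul_eq_one (x' * B 0 + y' * B 1)
      rw [h1, hx', hy']; push_cast; ring
    have := Ideal.absNorm_span_natCast (S := 𝓞 K) g
    rw [Ideal.span_singleton_eq_top.2 hu, Ideal.absNorm_top, hr] at this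
    nlinarith
  obtain ⟨w, u', hwu⟩ := hg
  set θ : 𝓞 K := (-u' : ℤ) * B 0 + w * B 1 with hθ
  have hdet : (w : 𝓞 K) * x + u' * y = 1 := by exact_mod_cast hwu
  have hb0 : B 0 = w - y * θ := by
    rw [hθ]; push_cast
    linear_combination (-(w : 𝓞 K)) * h1 - B 0 * hdet
  have hb1 : B 1 = u' + x * θ := by
    rw [hθ]; push_cast
    linear_combination (-(u' : 𝓞 K)) * h1 - B 1 * hdet
  have hspan : ∀ z : 𝓞 K, ∃ a b : ℤ, z = a + b * θ := by
    intro z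
    refine ⟨B.repr z 0 * w + B.repr z 1 * u', - B.repr z 0 * y + B.repr z 1 * x, ?_⟩
    push_cast
    linear_combination hrep z + (B.repr z 0 : 𝓞 K) * hb0 + (B.repr z 1 : 𝓞 K) * hb1
  have hli : ∀ a b : ℤ, (a : 𝓞 K) + b * θ = 0 → a = 0 ∧ b = 0 := by
    intro a b h
    obtain ⟨e1, e2⟩ := hind (a * x - b * u') (a * y + b * w) (by
      push_cast
      rw [hθ] at h; push_cast at h
      linear_combination h - (a : 𝓞 K) * h1)
    constructor
    · linear_combination (-a) * hwu + w * e1 + u' * e2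
    · linear_combination (-b) * hwu - y * e1 + x * e2
  obtain ⟨n', t, hn⟩ := hspan (θ * θ)
  refine ⟨θ, t, -n', by rw [hn]; push_cast; ring, hspan, hli, ?_⟩
  have hLI : LinearIndependent ℤ ![(1 : 𝓞 K), θ] := by
    rw [LinearIndependent.pair_iff]
    intro a b h
    exact hli a b (by simpa using h)
  have hsp : ⊤ ≤ Submodule.span ℤ (Set.range ![(1 : 𝓞 K), θ]) := by
    intro z _
    obtain ⟨a, b, rfl⟩ := hspan z
    simp only [Matrix.range_cons, Matrix.range_empty, Set.union_empty, Set.singleton_union]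
    rw [Submodule.mem_span_pair]
    exact ⟨a, b, by simp⟩
  set E : Module.Basis (Fin 2) ℤ (𝓞 K) := Module.Basis.mk hLI hsp with hE
  have hE0 : E 0 = 1 := by simp [hE]
  have hE1 : E 1 = θ := by simp [hE]
  rw [← discr_eq_discr K E, Algebra.discr_def, Matrix.det_fin_two]
  simp only [Algebra.traceMatrix_apply, Algebra.traceForm_apply, hE0, hE1, one_mul, mul_one]
  have hrp : ∀ a b : ℤ, E.repr ((a : 𝓞 K) + b * θ) = Finsupp.single 0 a + Finsupp.single 1 b := by
    intro a b
    have : (a : 𝓞 K) + b * θ = a • E 0 + b • E 1 := by rw [hE0, hE1]; simp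
    rw [this, map_add, map_smul, map_smul, Module.Basis.repr_self, Module.Basis.repr_self,
      Finsupp.smul_single_one, Finsupp.smul_single_one]
  have htr1 : Algebra.trace ℤ (𝓞 K) 1 = 2 := by
    have := Algebra.trace_algebraMap (S := 𝓞 K) (1 : ℤ)
    rw [hr] at this
    simpa using this
  have htr : Algebra.trace ℤ (𝓞 K) θ = t := by
    rw [Algebra.trace_eq_matrix_trace E, Matrix.trace_fin_two, Algebra.leftMulMatrix_eq_repr_mul,
      Algebra.leftMulMatrix_eq_repr_mul, hE0, hE1, hn, hrp]
    have : θ * 1 = ((0 : ℤ) : 𝓞 K) + ((1 : ℤ) : 𝓞 K) * θ := by push_cast; ring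
    rw [this, hrp]
    simp
  have htr2 : Algebra.trace ℤ (𝓞 K) (θ * θ) = 2 * n' + t * t := by
    rw [hn]
    have : (n' : 𝓞 K) + t * θ = n' • (1 : 𝓞 K) + t • θ := by simp
    rw [this, map_add, map_smul, map_smul, htr1, htr]
    simp; ring
  rw [htr1, htr, htr2]; ring
end Mom

namespace Mom
open Finset NumberField

noncomputable def cnt (K : Type) [Field K] [NumberField K] (N : ℕ) : ℕ :=
  Nat.card {I : Ideal (𝓞 K) // Ideal.absNorm I = N}

section
variable {K : Type} [Field K] [NumberField K]

lemma finite_cnt (N : ℕ) : Finite {I : Ideal (𝓞 K) // Ideal.absNorm I = N} :=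
  Ideal.finite_setOfPred_absNorm_eq N

lemma sup_span_mul {m n : ℕ} (hmn : Nat.Coprime m n) (I : Ideal (𝓞 K)) (hI : ((m * n : ℕ) : 𝓞 K) ∈ I) :
    (I ⊔ Ideal.span {(m : 𝓞 K)}) * (I ⊔ Ideal.span {(n : 𝓞 K)}) = I := by
  have hcop : ∃ u v : 𝓞 K, u * m + v * n = 1 := by
    obtain ⟨u, v, h⟩ := Nat.isCoprime_iff_coprime.2 hmn
    exact ⟨u, v, by exact_mod_cast h⟩
  obtain ⟨u, v, huv⟩ := hcop
  apply le_antisymm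
  · rw [Ideal.sup_mul, Ideal.mul_sup, Ideal.mul_sup, Ideal.span_singleton_mul_span_singleton]
    refine sup_le (sup_le Ideal.mul_le_left Ideal.mul_le_left) (sup_le Ideal.mul_le_right ?_)
    rw [Ideal.span_singleton_le_iff_mem]
    exact_mod_cast hI
  · intro x hx
    have : x = x * (v * n) + (u * m) * x := by linear_combination (-x) * huv
    rw [this]
    refine Ideal.add_mem _ ?_ ?_
    · refine Ideal.mul_mem_mul (Ideal.mem_sup_left hx) (Ideal.mem_sup_right ?_)
      exact Ideal.mul_mem_left _ _ (Ideal.mem_span_singleton_self _)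
    · refine Ideal.mul_mem_mul (Ideal.mem_sup_right ?_) (Ideal.mem_sup_left hx)
      exact Ideal.mul_mem_left _ _ (Ideal.mem_span_singleton_self _)

lemma mul_sup_span {m n : ℕ} (hmn : Nat.Coprime m n) (A B : Ideal (𝓞 K)) (hA : (m : 𝓞 K) ∈ A) (hB : (n : 𝓞 K) ∈ B) :
    A * B ⊔ Ideal.span {(m : 𝓞 K)} = A := by
  have hcop : ∃ u v : 𝓞 K, u * m + v * n = 1 := by
    obtain ⟨u, v, h⟩ := Nat.isCoprime_iff_coprime.2 hmn
    exact ⟨u, v, by exact_mod_cast h⟩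
  obtain ⟨u, v, huv⟩ := hcop
  apply le_antisymm
  · refine sup_le Ideal.mul_le_left ?_
    rwa [Ideal.span_singleton_le_iff_mem]
  · intro x hx
    have : x = x * (v * n) + (u * x) * m := by linear_combination (-x) * huv
    rw [this]
    refine Ideal.add_mem _ (Ideal.mem_sup_left ?_) (Ideal.mem_sup_right ?_)
    · exact Ideal.mul_mem_mul hx (Ideal.mul_mem_left _ _ hB)
    · exact Ideal.mul_mem_left _ _ (Ideal.mem_span_singleton_self _)

lemma norm_sup_span {m n : ℕ} (hm : m ≠ 0) (hn : n ≠ 0) (hmn : Nat.Coprime m n) (I : Ideal (𝓞 K)) (hI : Ideal.absNorm I = m * n) :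
    Ideal.absNorm (I ⊔ Ideal.span {(m : 𝓞 K)}) = m ∧ Ideal.absNorm (I ⊔ Ideal.span {(n : 𝓞 K)}) = n := by
  have hmem : ((m * n : ℕ) : 𝓞 K) ∈ I := by rw [← hI]; exact Ideal.absNorm_mem I
  have hprod := congrArg Ideal.absNorm (sup_span_mul hmn I hmem)
  rw [map_mul, hI] at hprod
  have hA : Ideal.absNorm (I ⊔ Ideal.span {(m : 𝓞 K)}) ∣ m ^ Module.finrank ℤ (𝓞 K) := by
    rw [← Ideal.absNorm_span_natCast]; exact Ideal.absNorm_dvd_absNorm_of_le le_sup_right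
  have hB : Ideal.absNorm (I ⊔ Ideal.span {(n : 𝓞 K)}) ∣ n ^ Module.finrank ℤ (𝓞 K) := by
    rw [← Ideal.absNorm_span_natCast]; exact Ideal.absNorm_dvd_absNorm_of_le le_sup_right
  set A := Ideal.absNorm (I ⊔ Ideal.span {(m : 𝓞 K)})
  set B := Ideal.absNorm (I ⊔ Ideal.span {(n : 𝓞 K)})
  have cA : Nat.Coprime A n := Nat.Coprime.coprime_dvd_left hA (hmn.pow_left _)
  have cB : Nat.Coprime B m := Nat.Coprime.coprime_dvd_left hB (hmn.symm.pow_left _)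
  have dA : A ∣ m := cA.dvd_of_dvd_mul_right (hprod ▸ Dvd.intro _ rfl)
  have dB : B ∣ n := cB.dvd_of_dvd_mul_left (hprod ▸ Dvd.intro_left _ rfl)
  have lA := Nat.le_of_dvd (Nat.pos_of_ne_zero hm) dA
  have lB := Nat.le_of_dvd (Nat.pos_of_ne_zero hn) dB
  have pm := Nat.pos_of_ne_zero hm
  have pn := Nat.pos_of_ne_zero hn
  constructor <;> nlinarith

lemma cnt_mul {m n : ℕ} (hm : m ≠ 0) (hn : n ≠ 0) (hmn : Nat.Coprime m n) :
    cnt K (m * n) = cnt K m * cnt K n := by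
  unfold cnt
  rw [← Nat.card_prod]
  refine Nat.card_congr ⟨fun I => (⟨_, (norm_sup_span hm hn hmn I.1 I.2).1⟩, ⟨_, (norm_sup_span hm hn hmn I.1 I.2).2⟩),
    fun P => ⟨P.1.1 * P.2.1, by rw [map_mul, P.1.2, P.2.2]⟩, ?_, ?_⟩
  · rintro ⟨I, hI⟩
    ext1
    exact sup_span_mul hmn I (by rw [← hI]; exact Ideal.absNorm_mem I)
  · rintro ⟨⟨A, hA⟩, ⟨B, hB⟩⟩
    have h1 : (m : 𝓞 K) ∈ A := by rw [← hA]; exact Ideal.absNorm_mem A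
    have h2 : (n : 𝓞 K) ∈ B := by rw [← hB]; exact Ideal.absNorm_mem B
    ext1 <;> ext1
    · exact mul_sup_span hmn A B h1 h2
    · simp only
      rw [mul_comm]
      exact mul_sup_span hmn.symm B A h2 h1

lemma cnt_one : cnt K 1 = 1 := by
  unfold cnt
  have : Unique {I : Ideal (𝓞 K) // Ideal.absNorm I = 1} :=
    ⟨⟨⟨⊤, Ideal.absNorm_top⟩⟩, fun I => Subtype.ext (Ideal.absNorm_eq_one_iff.1 I.2)⟩
  exact Nat.card_unique

/-- multiplication by a nonzero ideal is injective, and onto the ideals below it. -/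
lemma cnt_shift (P : Ideal (𝓞 K)) (N M : ℕ) (hP : Ideal.absNorm P = N) (hN : N ≠ 0)
    (hdiv : ∀ I : Ideal (𝓞 K), Ideal.absNorm I = N * M → I ≤ P) : cnt K (N * M) = cnt K M := by
  have hP0 : P ≠ 0 := by
    intro h; rw [h] at hP; simp at hP; exact hN hP.symm
  unfold cnt
  symm
  refine Nat.card_congr (Equiv.ofBijective (fun I => ⟨P * I.1, by rw [map_mul, hP, I.2]⟩) ⟨?_, ?_⟩)
  · intro I J h
    have := congrArg Subtype.val h
    exact Subtype.ext (mul_left_cancel₀ hP0 this)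
  · rintro ⟨I, hI⟩
    obtain ⟨J, rfl⟩ := Ideal.dvd_iff_le.2 (hdiv I hI)
    refine ⟨⟨J, ?_⟩, rfl⟩
    rw [map_mul, hP] at hI
    exact Nat.eq_of_mul_eq_mul_left (Nat.pos_of_ne_zero hN) hI

lemma exists_max_of_norm {p k : ℕ} (hp : p.Prime) (I : Ideal (𝓞 K)) (hI : Ideal.absNorm I = p ^ (k + 1)) :
    ∃ M : Ideal (𝓞 K), M.IsMaximal ∧ I ≤ M ∧ (p : 𝓞 K) ∈ M := by
  have hne : I ≠ ⊤ := by
    intro h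
    rw [h, Ideal.absNorm_top] at hI
    exact (Nat.one_lt_pow (by omega) hp.one_lt).ne hI
  obtain ⟨M, hM, hIM⟩ := Ideal.exists_le_maximal I hne
  refine ⟨M, hM, hIM, ?_⟩
  have : ((p ^ (k + 1) : ℕ) : 𝓞 K) ∈ M := by rw [← hI]; exact hIM (Ideal.absNorm_mem I)
  push_cast at this
  exact hM.isPrime.mem_of_pow_mem _ this

lemma cnt_inert {p : ℕ} (hp : p.Prime) (h2 : Module.finrank ℤ (𝓞 K) = 2)
    (h : ∀ M : Ideal (𝓞 K), M.IsMaximal → (p : 𝓞 K) ∈ M → M = Ideal.span {(p : 𝓞 K)}) (k : ℕ) :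
    cnt K (p ^ k) = if Even k then 1 else 0 := by
  have hN : Ideal.absNorm (Ideal.span {(p : 𝓞 K)}) = p ^ 2 := by rw [Ideal.absNorm_span_natCast, h2]
  have hle : ∀ k, ∀ I : Ideal (𝓞 K), Ideal.absNorm I = p ^ (k + 1) → I ≤ Ideal.span {(p : 𝓞 K)} := by
    intro k I hI
    obtain ⟨M, hM, hIM, hpM⟩ := exists_max_of_norm hp I hI
    rw [← h M hM hpM]; exact hIM
  induction k using Nat.strong_induction_on with
  | _ k ih =>
    match k with
    | 0 => simp [cnt_one]
    | 1 =>
      rw [if_neg (by decide)]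
      unfold cnt
      rw [Nat.card_eq_zero]
      left
      refine ⟨fun I => ?_⟩
      have h1 := hle 0 I.1 (by simpa using I.2)
      have h3 := Ideal.absNorm_dvd_absNorm_of_le h1
      rw [hN, I.2] at h3
      have := (Nat.pow_dvd_pow_iff_le_right hp.one_lt).1 h3
      omega
    | (k + 2) =>
      have := cnt_shift (Ideal.span {(p : 𝓞 K)}) (p ^ 2) (p ^ k) hN (pow_ne_zero _ hp.ne_zero) (by
        intro I hI
        exact hle (k + 1) I (by rw [hI]; ring))
      rw [show p ^ (k + 2) = p ^ 2 * p ^ k by ring, this, ih k (by omega)]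
      simp [Nat.even_add]

lemma below_root {p : ℕ} (P Q : Ideal (𝓞 K)) (hp : p.Prime) (hP : Ideal.absNorm P = p) (hQ : Ideal.absNorm Q = p)
    (hPQ : P * Q ≤ Ideal.span {(p : 𝓞 K)}) (h2 : Module.finrank ℤ (𝓞 K) = 2)
    (k : ℕ) (I : Ideal (𝓞 K)) (hI : Ideal.absNorm I = p ^ (k + 1)) :
    I ≤ P ∨ I ≤ Q := by
  have hN : Ideal.absNorm (Ideal.span {(p : 𝓞 K)}) = p ^ 2 := by rw [Ideal.absNorm_span_natCast, h2]
  have hPp : P.IsPrime := Ideal.isPrime_of_irreducible_absNorm (by rw [hP]; exact hp)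
  have hQp : Q.IsPrime := Ideal.isPrime_of_irreducible_absNorm (by rw [hQ]; exact hp)
  have nb : ∀ P : Ideal (𝓞 K), Ideal.absNorm P = p → P ≠ ⊥ := by
    rintro P hP rfl
    rw [Ideal.absNorm_bot] at hP; exact hp.ne_zero hP.symm
  have hPm : P.IsMaximal := hPp.isMaximal (nb P hP)
  have hQm : Q.IsMaximal := hQp.isMaximal (nb Q hQ)
  obtain ⟨M, hM, hIM, hpM⟩ := exists_max_of_norm hp I hI
  have : P * Q ≤ M := hPQ.trans ((Ideal.span_singleton_le_iff_mem _).2 hpM)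
  rcases (Ideal.IsPrime.mul_le hM.isPrime).1 this with h | h
  · left; rw [hPm.eq_of_le hM.ne_top h]; exact hIM
  · right; rw [hQm.eq_of_le hM.ne_top h]; exact hIM

lemma cnt_ram {p : ℕ} (P : Ideal (𝓞 K)) (hp : p.Prime) (hP : Ideal.absNorm P = p)
    (hPQ : P * P ≤ Ideal.span {(p : 𝓞 K)}) (h2 : Module.finrank ℤ (𝓞 K) = 2) (k : ℕ) :
    cnt K (p ^ k) = 1 := by
  induction k with
  | zero => simp [cnt_one]
  | succ k ih =>
    rw [pow_succ', cnt_shift P p (p ^ k) hP hp.ne_zero, ih]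
    intro I hI
    rcases below_root P P hp hP hP hPQ h2 k I (by rw [hI]; ring) with h | h <;> exact h

lemma cnt_split {p : ℕ} (P Q : Ideal (𝓞 K)) (hne : P ≠ Q) (hp : p.Prime) (hP : Ideal.absNorm P = p)
    (hQ : Ideal.absNorm Q = p)
    (hPQ : P * Q ≤ Ideal.span {(p : 𝓞 K)}) (h2 : Module.finrank ℤ (𝓞 K) = 2) (k : ℕ) :
    cnt K (p ^ k) = k + 1 := by
  have hsurj : ∀ k, ∀ I : Ideal (𝓞 K), Ideal.absNorm I = p ^ k → ∃ i ≤ k, I = P ^ i * Q ^ (k - i) := by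
    intro k
    induction k with
    | zero =>
      intro I hI
      refine ⟨0, le_rfl, ?_⟩
      rw [pow_zero, Ideal.absNorm_eq_one_iff] at hI
      simp [hI]
    | succ k ih =>
      intro I hI
      rcases below_root P Q hp hP hQ hPQ h2 k I hI with h | h
      · obtain ⟨J, rfl⟩ := Ideal.dvd_iff_le.2 h
        rw [map_mul, hP, pow_succ'] at hI
        obtain ⟨i, hi, rfl⟩ := ih J (Nat.eq_of_mul_eq_mul_left hp.pos hI)
        refine ⟨i + 1, by omega, ?_⟩
        rw [show k + 1 - (i + 1) = k - i by omega, pow_succ']; ring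
      · obtain ⟨J, rfl⟩ := Ideal.dvd_iff_le.2 h
        rw [map_mul, hQ, pow_succ'] at hI
        obtain ⟨i, hi, rfl⟩ := ih J (Nat.eq_of_mul_eq_mul_left hp.pos hI)
        refine ⟨i, by omega, ?_⟩
        rw [show k + 1 - i = (k - i) + 1 by omega, pow_succ' Q]; ring
  have nb : ∀ P : Ideal (𝓞 K), Ideal.absNorm P = p → P ≠ ⊥ := by
    rintro P hP rfl
    rw [Ideal.absNorm_bot] at hP; exact hp.ne_zero hP.symm
  have hPp : P.IsPrime := Ideal.isPrime_of_irreducible_absNorm (by rw [hP]; exact hp)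
  have hQp : Q.IsPrime := Ideal.isPrime_of_irreducible_absNorm (by rw [hQ]; exact hp)
  have hPm : P.IsMaximal := hPp.isMaximal (nb P hP)
  have hQm : Q.IsMaximal := hQp.isMaximal (nb Q hQ)
  have hinj : ∀ i j : ℕ, i ≤ k → j ≤ k → i < j → P ^ i * Q ^ (k - i) ≠ P ^ j * Q ^ (k - j) := by
    intro i j hi hj hij h
    rw [show j = i + (j - i) by omega, pow_add, show k - i = (k - (i + (j - i))) + (j - i) by omega, pow_add] at h
    have h' : (P ^ i * Q ^ (k - (i + (j - i)))) * Q ^ (j - i) = (P ^ i * Q ^ (k - (i + (j - i)))) * P ^ (j - i) := by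
      rw [mul_assoc, h]; ring
    have h'' := mul_left_cancel₀ (mul_ne_zero (pow_ne_zero _ (nb P hP)) (pow_ne_zero _ (nb Q hQ))) h'
    have : Q ^ (j - i) ≤ P := by
      rw [h'']; exact Ideal.pow_le_self (by omega)
    exact hne (hQm.eq_of_le hPm.ne_top (hPp.le_of_pow_le this)).symm
  have e : (Fin (k + 1)) ≃ {I : Ideal (𝓞 K) // Ideal.absNorm I = p ^ k} := by
    refine Equiv.ofBijective (fun i => ⟨P ^ (i : ℕ) * Q ^ (k - i), ?_⟩) ⟨?_, ?_⟩
    · rw [map_mul, map_pow, map_pow, hP, hQ, ← pow_add]; congr 1; omega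
    · intro i j h
      have h := congrArg Subtype.val h
      simp only at h
      rcases lt_trichotomy (i : ℕ) j with hl | hl | hl
      · exact absurd h (hinj i j (by omega) (by omega) hl)
      · exact Fin.ext hl
      · exact absurd h.symm (hinj j i (by omega) (by omega) hl)
    · rintro ⟨I, hI⟩
      obtain ⟨i, hi, rfl⟩ := hsurj k I hI
      exact ⟨⟨i, by omega⟩, rfl⟩
  unfold cnt
  rw [← Nat.card_congr e]; simp
end
end Mom

namespace Mom
open Finset NumberField

def chi2 (Δ : ℤ) : ℤ := if Δ % 8 = 1 then 1 else if Δ % 8 = 5 then -1 else 0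

def chip (Δ : ℤ) (p : ℕ) : ℤ := if p = 2 then chi2 Δ else jacobiSym Δ p

lemma chip_cases (Δ : ℤ) (p : ℕ) : chip Δ p = 0 ∨ chip Δ p = 1 ∨ chip Δ p = -1 := by
  unfold chip chi2
  split_ifs <;> first | exact jacobiSym.trichotomy Δ p | simp

lemma chip_root (t n : ℤ) (p : ℕ) (hp : p.Prime) :
    (chip (t ^ 2 - 4 * n) p = -1 → ∀ b : ℤ, ¬ (p : ℤ) ∣ b ^ 2 - t * b + n) ∧
    (chip (t ^ 2 - 4 * n) p ≠ -1 → ∃ b : ℤ, (p : ℤ) ∣ b ^ 2 - t * b + n) ∧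
    (chip (t ^ 2 - 4 * n) p = 0 ↔ (p : ℤ) ∣ t ^ 2 - 4 * n) := by
  by_cases h2 : p = 2
  · subst h2
    have hc : chip (t ^ 2 - 4 * n) 2 = chi2 (t ^ 2 - 4 * n) := rfl
    rw [hc]
    have par : t % 2 = 0 ∨ t % 2 = 1 := by omega
    rcases par with ht | ht
    · obtain ⟨s, rfl⟩ : ∃ s, t = 2 * s := ⟨t / 2, by omega⟩
      have h1 : ((2 * s) ^ 2 - 4 * n) = 4 * (s ^ 2 - n) := by ring
      have : chi2 ((2 * s) ^ 2 - 4 * n) = 0 := by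
        rw [h1]; unfold chi2; rw [if_neg (by omega), if_neg (by omega)]
      rw [this]
      refine ⟨by norm_num, fun _ => ⟨n, ?_⟩, ?_⟩
      · have := (Int.even_mul_succ_self n).two_dvd
        have e : n ^ 2 - 2 * s * n + n = n * (n + 1) - 2 * (s * n) := by ring
        rw [e]; push_cast; omega
      · simp only [true_iff]; rw [h1]; push_cast; omega
    · obtain ⟨s, rfl⟩ : ∃ s, t = 2 * s + 1 := ⟨t / 2, by omega⟩
      obtain ⟨u, hu⟩ := (Int.even_mul_succ_self s).two_dvd
      have h1 : ((2 * s + 1) ^ 2 - 4 * n) = 8 * u + 1 - 4 * n := by linear_combination 4 * hu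
      rcases (by omega : n % 2 = 0 ∨ n % 2 = 1) with hn | hn
      · have : chi2 ((2 * s + 1) ^ 2 - 4 * n) = 1 := by
          rw [h1]; unfold chi2; rw [if_pos (by omega)]
        rw [this]
        refine ⟨by norm_num, fun _ => ⟨0, ?_⟩, ?_⟩
        · push_cast; omega
        · constructor
          · norm_num
          · intro h; rw [h1] at h; push_cast at h; omega
      · have : chi2 ((2 * s + 1) ^ 2 - 4 * n) = -1 := by
          rw [h1]; unfold chi2; rw [if_neg (by omega), if_pos (by omega)]
        rw [this]
        refine ⟨fun _ b hb => ?_, by norm_num, ?_⟩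
        · obtain ⟨w, hw⟩ := (Int.even_mul_pred_self b).two_dvd
          have e : b ^ 2 - (2 * s + 1) * b + n = b * (b - 1) - 2 * (s * b) + n := by ring
          rw [e, hw] at hb; push_cast at hb; omega
        · constructor
          · norm_num
          · intro h; rw [h1] at h; push_cast at h; omega
  · have hf : Fact p.Prime := ⟨hp⟩
    have hc : chip (t ^ 2 - 4 * n) p = legendreSym p (t ^ 2 - 4 * n) := by
      unfold chip; rw [if_neg h2, jacobiSym.legendreSym.to_jacobiSym]
    rw [hc]
    have hpo : p % 2 = 1 := by rcases hp.eq_two_or_odd with h | h; exact absurd h h2; exact h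
    refine ⟨fun h b hb => ?_, fun h => ?_, ?_⟩
    · rw [legendreSym.eq_neg_one_iff] at h
      apply h
      refine ⟨((2 * b - t : ℤ) : ZMod p), ?_⟩
      have h0 : ((b ^ 2 - t * b + n : ℤ) : ZMod p) = 0 := (ZMod.intCast_zmod_eq_zero_iff_dvd _ _).2 hb
      push_cast at h0 ⊢
      linear_combination (-4) * h0
    · have hs : IsSquare ((t ^ 2 - 4 * n : ℤ) : ZMod p) := by
        by_contra hns
        exact h ((legendreSym.eq_neg_one_iff p).2 hns)
      obtain ⟨y, hy⟩ := hs
      have h2u : (2 : ZMod p) ≠ 0 := by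
        intro h0
        have : ((2 : ℕ) : ZMod p) = 0 := by exact_mod_cast h0
        rw [ZMod.natCast_eq_zero_iff] at this
        exact h2 ((Nat.prime_dvd_prime_iff_eq hp Nat.prime_two).1 this)
      obtain ⟨b, hb⟩ := ZMod.intCast_surjective ((t + y) / 2 : ZMod p)
      refine ⟨b, ?_⟩
      rw [← ZMod.intCast_zmod_eq_zero_iff_dvd]
      push_cast at hy ⊢
      rw [hb]
      field_simp
      linear_combination (-1 : ZMod p) * hy
    · rw [legendreSym.eq_zero_iff, ZMod.intCast_zmod_eq_zero_iff_dvd]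

section
variable {K : Type} [Field K] [NumberField K]

lemma mem_span_p {θ : 𝓞 K} (hspan : ∀ x : 𝓞 K, ∃ a b : ℤ, x = a + b * θ)
    (hli : ∀ a b : ℤ, (a : 𝓞 K) + b * θ = 0 → a = 0 ∧ b = 0) (p : ℕ) (a c : ℤ)
    (h : (a : 𝓞 K) + c * θ ∈ Ideal.span {(p : 𝓞 K)}) : (p : ℤ) ∣ a ∧ (p : ℤ) ∣ c := by
  rw [Ideal.mem_span_singleton] at h
  obtain ⟨z, hz⟩ := h
  obtain ⟨a', c', rfl⟩ := hspan z
  obtain ⟨h1, h2⟩ := hli (a - p * a') (c - p * c') (by push_cast; linear_combination hz)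
  exact ⟨⟨a', by linarith⟩, ⟨c', by linarith⟩⟩

noncomputable def idP (p : ℕ) (θ : 𝓞 K) (b : ℤ) : Ideal (𝓞 K) := Ideal.span {(p : 𝓞 K), θ - b}

lemma one_notMem {θ : 𝓞 K} {t n : ℤ} (hθ : θ * θ = t * θ - n) (hspan : ∀ x : 𝓞 K, ∃ a b : ℤ, x = a + b * θ)
    (hli : ∀ a b : ℤ, (a : 𝓞 K) + b * θ = 0 → a = 0 ∧ b = 0) (p : ℕ) (hp : p.Prime) (b : ℤ)
    (hb : (p : ℤ) ∣ b ^ 2 - t * b + n) : (1 : 𝓞 K) ∉ idP p θ b := by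
  intro h
  obtain ⟨x, y, hxy⟩ := Ideal.mem_span_pair.1 h
  obtain ⟨k, hk⟩ := hb
  have hk' : (b : 𝓞 K) ^ 2 - t * b + n = p * k := by exact_mod_cast hk
  have : ((b - t : ℤ) : 𝓞 K) + ((1 : ℤ) : 𝓞 K) * θ ∈ Ideal.span {(p : 𝓞 K)} := by
    rw [Ideal.mem_span_singleton]
    refine ⟨x * (θ + b - t) - y * k, ?_⟩
    push_cast
    linear_combination (-1 : 𝓞 K) * (θ + b - t) * hxy + y * hθ - y * hk'
  have := (mem_span_p hspan hli p _ _ this).2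
  have h1 := Int.le_of_dvd (by norm_num) this
  have := hp.two_le
  omega

lemma norm_idP {θ : 𝓞 K} {t n : ℤ} (hθ : θ * θ = t * θ - n) (hspan : ∀ x : 𝓞 K, ∃ a b : ℤ, x = a + b * θ)
    (hli : ∀ a b : ℤ, (a : 𝓞 K) + b * θ = 0 → a = 0 ∧ b = 0) (h2 : Module.finrank ℤ (𝓞 K) = 2)
    (p : ℕ) (hp : p.Prime) (b : ℤ) (hb : (p : ℤ) ∣ b ^ 2 - t * b + n) : Ideal.absNorm (idP p θ b) = p := by
  have hN : Ideal.absNorm (Ideal.span {(p : 𝓞 K)}) = p ^ 2 := by rw [Ideal.absNorm_span_natCast, h2]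
  have hle : Ideal.span {(p : 𝓞 K)} ≤ idP p θ b := by
    rw [Ideal.span_singleton_le_iff_mem]; exact Ideal.subset_span (by simp)
  have hd := Ideal.absNorm_dvd_absNorm_of_le hle
  rw [hN, Nat.dvd_prime_pow hp] at hd
  obtain ⟨k, hk, hk'⟩ := hd
  have h0 : k ≠ 0 := by
    rintro rfl
    rw [pow_zero, Ideal.absNorm_eq_one_iff] at hk'
    exact one_notMem hθ hspan hli p hp b hb (by rw [hk']; trivial)
  have h2' : k ≠ 2 := by
    rintro rfl
    obtain ⟨J, hJ⟩ := Ideal.dvd_iff_le.2 hle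
    have := congrArg Ideal.absNorm hJ
    rw [map_mul, hk', hN] at this
    have hJ1 : Ideal.absNorm J = 1 := by
      have hp2 : 0 < p ^ 2 := pow_pos hp.pos 2
      nlinarith
    rw [Ideal.absNorm_eq_one_iff] at hJ1
    rw [hJ1, Ideal.mul_top] at hJ
    have hm : ((-b : ℤ) : 𝓞 K) + ((1 : ℤ) : 𝓞 K) * θ ∈ Ideal.span {(p : 𝓞 K)} := by
      rw [hJ]
      have : ((-b : ℤ) : 𝓞 K) + ((1 : ℤ) : 𝓞 K) * θ = θ - b := by push_cast; ring
      rw [this]; exact Ideal.subset_span (by simp)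
    have := (mem_span_p hspan hli p _ _ hm).2
    have h1 := Int.le_of_dvd (by norm_num) this
    have := hp.two_le
    omega
  have : k = 1 := by omega
  rw [hk', this, pow_one]

lemma int_mem {I : Ideal (𝓞 K)} (hI : (1 : 𝓞 K) ∉ I) {p : ℕ} (hp : p.Prime) (hpI : (p : 𝓞 K) ∈ I) (a : ℤ)
    (ha : (a : 𝓞 K) ∈ I) : (p : ℤ) ∣ a := by
  by_contra h
  have hc : IsCoprime (p : ℤ) a := (Nat.prime_iff_prime_int.1 hp).coprime_iff_not_dvd.2 h
  obtain ⟨u, v, huv⟩ := hc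
  apply hI
  have : (1 : 𝓞 K) = u * p + v * a := by exact_mod_cast huv.symm
  rw [this]
  exact I.add_mem (I.mul_mem_left _ hpI) (I.mul_mem_left _ ha)

theorem cnt_prime_pow (h2 : Module.finrank ℚ K = 2) (p : ℕ) (hp : p.Prime) (k : ℕ) :
    (cnt K (p ^ k) : ℤ) = ∑ i ∈ range (k + 1), chip (NumberField.discr K) p ^ i := by
  obtain ⟨θ, t, n, hθ, hspan, hli, hdisc⟩ := exists_theta K h2
  rw [← hdisc]
  have hr : Module.finrank ℤ (𝓞 K) = 2 := by rw [RingOfIntegers.rank]; exact h2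
  obtain ⟨c1, c2, c3⟩ := chip_root t n p hp
  by_cases hm : chip (t ^ 2 - 4 * n) p = -1
  · rw [hm, neg_one_geom_sum]
    rw [cnt_inert hp hr]
    · split_ifs with h1 h2 h2
      · exact absurd h1 (Nat.even_add_one.1 h2)
      · rfl
      · rfl
      · exact absurd (Nat.even_add_one.2 h1) h2
    · intro M hM hpM
      by_contra hne
      have h1M : (1 : 𝓞 K) ∉ M := fun h => hM.ne_top ((Ideal.eq_top_iff_one M).2 h)
      have hle : Ideal.span {(p : 𝓞 K)} ≤ M := (Ideal.span_singleton_le_iff_mem _).2 hpM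
      obtain ⟨z, hzM, hz⟩ := SetLike.exists_of_lt (lt_of_le_of_ne hle (Ne.symm hne))
      obtain ⟨x, y, rfl⟩ := hspan z
      have hy : ¬ (p : ℤ) ∣ y := by
        rintro ⟨y', rfl⟩
        have hx : (x : 𝓞 K) ∈ M := by
          have h3 := M.sub_mem hzM (M.mul_mem_left ((y' : 𝓞 K) * θ) hpM)
          have e : (x : 𝓞 K) + ((p * y' : ℤ) : 𝓞 K) * θ - (y' : 𝓞 K) * θ * p = x := by push_cast; ring
          rwa [e] at h3
        obtain ⟨x', rfl⟩ := int_mem h1M hp hpM x hx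
        apply hz
        rw [Ideal.mem_span_singleton]
        exact ⟨x' + y' * θ, by push_cast; ring⟩
      obtain ⟨u, v, huv⟩ : IsCoprime (p : ℤ) y := (Nat.prime_iff_prime_int.1 hp).coprime_iff_not_dvd.2 hy
      have huv' : (u : 𝓞 K) * p + v * y = 1 := by exact_mod_cast huv
      have hθM : θ + v * x ∈ M := by
        have h3 := M.add_mem (M.mul_mem_left (v : 𝓞 K) hzM) (M.mul_mem_left ((u : 𝓞 K) * θ) hpM)
        have e : (v : 𝓞 K) * (x + y * θ) + u * θ * p = θ + v * x := by linear_combination θ * huv'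
        rwa [e] at h3
      have hf : (((-(v * x)) ^ 2 - t * (-(v * x)) + n : ℤ) : 𝓞 K) ∈ M := by
        have h3 := M.mul_mem_left (-(θ - v * x - t)) hθM
        have e : -(θ - v * x - t) * (θ + v * x) = (((-(v * x)) ^ 2 - t * (-(v * x)) + n : ℤ) : 𝓞 K) := by
          push_cast; linear_combination (-1 : 𝓞 K) * hθ
        rwa [e] at h3
      exact c1 hm _ (int_mem h1M hp hpM _ hf)
  · obtain ⟨b, hb⟩ := c2 hm
    have hb' : (p : ℤ) ∣ (t - b) ^ 2 - t * (t - b) + n := by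
      have : (t - b) ^ 2 - t * (t - b) + n = b ^ 2 - t * b + n := by ring
      rwa [this]
    have hP := norm_idP hθ hspan hli hr p hp b hb
    have hQ := norm_idP hθ hspan hli hr p hp (t - b) hb'
    have hPQ : idP p θ b * idP p θ (t - b) ≤ Ideal.span {(p : 𝓞 K)} := by
      unfold idP
      rw [Ideal.span_mul_span', Ideal.span_le]
      rintro _ ⟨x, hx, y, hy, rfl⟩
      simp only [Set.mem_insert_iff, Set.mem_singleton_iff] at hx hy
      rw [SetLike.mem_coe, Ideal.mem_span_singleton]
      rcases hx with rfl | rfl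
      · exact Dvd.intro _ rfl
      · rcases hy with rfl | rfl
        · exact Dvd.intro_left _ rfl
        · obtain ⟨k, hk⟩ := hb
          have hk' : (b : 𝓞 K) ^ 2 - t * b + n = p * k := by exact_mod_cast hk
          refine ⟨-k, ?_⟩
          push_cast
          linear_combination hθ - hk'
    have hsq : (2 * b - t) ^ 2 = 4 * (b ^ 2 - t * b + n) + (t ^ 2 - 4 * n) := by ring
    by_cases hz : chip (t ^ 2 - 4 * n) p = 0
    · have hpd := c3.1 hz
      have h3 : (p : ℤ) ∣ (2 * b - t) := by
        apply (Nat.prime_iff_prime_int.1 hp).dvd_of_dvd_pow (n := 2)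
        rw [hsq]; exact dvd_add (Dvd.dvd.mul_left hb _) hpd
      have hPQe : idP p θ (t - b) = idP p θ b := by
        obtain ⟨l, hl⟩ := h3
        have hl' : 2 * (b : 𝓞 K) - t = p * l := by exact_mod_cast hl
        unfold idP
        apply le_antisymm
        · rw [Ideal.span_le]
          rintro x (rfl | rfl)
          · exact Ideal.subset_span (by simp)
          · rw [SetLike.mem_coe, Ideal.mem_span_pair]
            exact ⟨l, 1, by push_cast; linear_combination (-1 : 𝓞 K) * hl'⟩
        · rw [Ideal.span_le]
          rintro x (rfl | rfl)
          · exact Ideal.subset_span (by simp)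
          · rw [SetLike.mem_coe, Ideal.mem_span_pair]
            exact ⟨-l, 1, by push_cast; linear_combination hl'⟩
      rw [hPQe] at hPQ
      rw [cnt_ram _ hp hP hPQ hr, hz]
      rw [Finset.sum_range_succ']
      simp
    · have hone : chip (t ^ 2 - 4 * n) p = 1 := by
        rcases chip_cases (t ^ 2 - 4 * n) p with h | h | h
        · exact absurd h hz
        · exact h
        · exact absurd h hm
      have hne : idP p θ b ≠ idP p θ (t - b) := by
        intro he
        apply hz
        rw [c3]
        have m1 : θ - b ∈ idP p θ b := Ideal.subset_span (by simp)
        have m2 : θ - ((t - b : ℤ) : 𝓞 K) ∈ idP p θ b := by rw [he]; exact Ideal.subset_span (by simp)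
        have m3 := Ideal.sub_mem _ m2 m1
        have e : θ - ((t - b : ℤ) : 𝓞 K) - (θ - b) = ((2 * b - t : ℤ) : 𝓞 K) := by push_cast; ring
        rw [e] at m3
        have h4 := int_mem (one_notMem hθ hspan hli p hp b hb) hp (Ideal.subset_span (by simp)) _ m3
        have h5 : (p : ℤ) ∣ (2 * b - t) ^ 2 := Dvd.dvd.pow h4 (by norm_num)
        rw [hsq] at h5
        exact (Int.dvd_add_right (Dvd.dvd.mul_left hb _)).1 h5
      rw [cnt_split _ _ hne hp hP hQ hPQ hr, hone]
      simp
end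
end Mom

namespace Mom
open Finset NumberField Filter Topology

/-- The Kronecker symbol of `Δ` as an arithmetic function. -/
noncomputable def XX (Δ : ℤ) : ArithmeticFunction ℤ :=
  ⟨fun n => if n = 0 then 0 else
    chi2 Δ ^ (n.factorization 2) * jacobiSym Δ (n / 2 ^ (n.factorization 2)), by simp⟩

lemma XX_apply {Δ : ℤ} {n : ℕ} (hn : n ≠ 0) :
    XX Δ n = chi2 Δ ^ (n.factorization 2) * jacobiSym Δ (n / 2 ^ (n.factorization 2)) := by
  change (if n = 0 then 0 else _) = _
  rw [if_neg hn]

lemma XX_mul (Δ : ℤ) (m n : ℕ) : XX Δ (m * n) = XX Δ m * XX Δ n := by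
  by_cases hm : m = 0
  · subst hm; simp
  by_cases hn : n = 0
  · subst hn; simp
  rw [XX_apply hm, XX_apply hn, XX_apply (mul_ne_zero hm hn), Nat.ordCompl_mul,
    Nat.factorization_mul hm hn]
  have h1 := (Nat.ordCompl_pos 2 hm).ne'
  have h2 := (Nat.ordCompl_pos 2 hn).ne'
  haveI : NeZero (m / 2 ^ m.factorization 2) := ⟨h1⟩
  haveI : NeZero (n / 2 ^ n.factorization 2) := ⟨h2⟩
  rw [jacobiSym.mul_right, Finsupp.add_apply, pow_add]
  ring

lemma XX_one (Δ : ℤ) : XX Δ 1 = 1 := by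
  rw [XX_apply one_ne_zero]; simp

lemma XX_two (Δ : ℤ) : XX Δ 2 = chi2 Δ := by
  rw [XX_apply two_ne_zero]; simp [Nat.prime_two.factorization]

lemma XX_odd (Δ : ℤ) (n : ℕ) (hn : Odd n) : XX Δ n = jacobiSym Δ n := by
  rw [XX_apply hn.pos.ne', Nat.factorization_eq_zero_of_not_dvd]
  · simp
  · intro h; exact (Nat.not_even_iff_odd.2 hn) (even_iff_two_dvd.2 h)

lemma XX_prime (Δ : ℤ) (p : ℕ) (hp : p.Prime) : XX Δ p = chip Δ p := by
  unfold chip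
  split_ifs with h
  · subst h; exact XX_two Δ
  · exact XX_odd Δ p (hp.odd_of_ne_two h)

lemma XX_pow (Δ : ℤ) (n k : ℕ) : XX Δ (n ^ k) = XX Δ n ^ k := by
  induction k with
  | zero => simp [XX_one]
  | succ k ih => rw [pow_succ, XX_mul, ih, pow_succ]

lemma XX_isMul (Δ : ℤ) : (XX Δ).IsMultiplicative := ⟨XX_one Δ, fun _ => XX_mul Δ _ _⟩

lemma XX_abs (Δ : ℤ) (n : ℕ) : |XX Δ n| ≤ 1 := by
  by_cases hn : n = 0
  · subst hn; simp
  rw [XX_apply hn, abs_mul, abs_pow]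
  have h1 : |chi2 Δ| ≤ 1 := by unfold chi2; split_ifs <;> simp
  have h2 : |jacobiSym Δ (n / 2 ^ n.factorization 2)| ≤ 1 := by
    rcases jacobiSym.trichotomy Δ (n / 2 ^ n.factorization 2) with h | h | h <;> rw [h] <;> simp
  have h3 : |chi2 Δ| ^ n.factorization 2 ≤ 1 := pow_le_one₀ (abs_nonneg _) h1
  calc _ ≤ 1 * (1 : ℤ) := mul_le_mul h3 h2 (abs_nonneg _) (by norm_num)
    _ = 1 := by norm_num

noncomputable def cntA (K : Type) [Field K] [NumberField K] : ArithmeticFunction ℤ :=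
  ⟨fun n => if n = 0 then 0 else (cnt K n : ℤ), by simp⟩

variable {K : Type} [Field K] [NumberField K]

lemma cntA_apply {n : ℕ} (hn : n ≠ 0) : cntA K n = cnt K n := by
  change (if n = 0 then 0 else _) = _
  rw [if_neg hn]

lemma cntA_eq (h2 : Module.finrank ℚ K = 2) :
    cntA K = ((ArithmeticFunction.zeta : ArithmeticFunction ℕ) : ArithmeticFunction ℤ) * XX (discr K) := by
  have hm : (cntA K).IsMultiplicative := by
    rw [ArithmeticFunction.IsMultiplicative.iff_ne_zero]
    refine ⟨by rw [cntA_apply one_ne_zero, cnt_one]; rfl, ?_⟩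
    intro m n hm hn hmn
    rw [cntA_apply hm, cntA_apply hn, cntA_apply (mul_ne_zero hm hn), cnt_mul hm hn hmn]
    push_cast; rfl
  rw [ArithmeticFunction.IsMultiplicative.eq_iff_eq_on_prime_powers _ hm _
    (ArithmeticFunction.isMultiplicative_zeta.natCast.mul (XX_isMul _))]
  intro p i hp
  rw [cntA_apply (pow_ne_zero _ hp.ne_zero), cnt_prime_pow h2 p hp i,
    ArithmeticFunction.coe_zeta_mul_apply, Nat.sum_divisors_prime_pow hp]
  refine Finset.sum_congr rfl fun k _ => ?_
  rw [XX_pow, XX_prime _ _ hp]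

/-- the real L-series -/
noncomputable def Lr (Δ : ℤ) (s : ℝ) : ℝ := ∑' n : ℕ, (XX Δ n : ℝ) / (n : ℝ) ^ s

lemma Lr_summable (Δ : ℤ) {s : ℝ} (hs : 1 < s) : Summable fun n : ℕ => (XX Δ n : ℝ) / (n : ℝ) ^ s := by
  refine Summable.of_norm_bounded (Real.summable_one_div_nat_rpow.2 hs) fun n => ?_
  rw [norm_div, Real.norm_eq_abs, Real.norm_eq_abs, abs_of_nonneg (Real.rpow_nonneg (Nat.cast_nonneg n) s)]
  have : |(XX Δ n : ℝ)| ≤ 1 := by exact_mod_cast XX_abs Δ n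
  gcongr

lemma LSeries_XX (Δ : ℤ) {s : ℝ} (hs : 1 < s) :
    LSeriesSummable (fun n => ((XX Δ n : ℤ) : ℂ)) s ∧
    LSeries (fun n => ((XX Δ n : ℤ) : ℂ)) s = (Lr Δ s : ℂ) := by
  have key : ∀ n : ℕ, LSeries.term (fun n => ((XX Δ n : ℤ) : ℂ)) s n
      = (((XX Δ n : ℝ) / (n : ℝ) ^ s : ℝ) : ℂ) := by
    intro n
    by_cases hn : n = 0
    · subst hn; simp
    · rw [LSeries.term_of_ne_zero hn]
      push_cast
      rw [Complex.ofReal_cpow (Nat.cast_nonneg n)]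
      simp
  constructor
  · unfold LSeriesSummable
    rw [show LSeries.term (fun n => ((XX Δ n : ℤ) : ℂ)) s = _ from funext key]
    exact Complex.summable_ofReal.2 (Lr_summable Δ hs)
  · unfold LSeries Lr
    rw [Complex.ofReal_tsum]
    exact tsum_congr key

lemma dedekind_eq (h2 : Module.finrank ℚ K = 2) {s : ℝ} (hs : 1 < s) :
    dedekindZeta K s = riemannZeta s * (Lr (discr K) s : ℂ) := by
  have hs' : 1 < (s : ℂ).re := by simpa using hs
  have hz := ArithmeticFunction.LSeriesSummable_zeta_iff.mpr hs'
  rw [← (LSeries_XX (discr K) hs).2, ← ArithmeticFunction.LSeries_zeta_eq_riemannZeta hs',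
    ← LSeries_convolution' hz (LSeries_XX (discr K) hs).1]
  unfold dedekindZeta
  refine LSeries_congr (fun {n} hn => ?_) _
  have h := congrArg (fun f => f n) (cntA_eq h2)
  rw [cntA_apply hn] at h
  have h' : ((cnt K n : ℤ) : ℂ) = (((((ArithmeticFunction.zeta : ArithmeticFunction ℕ) :
    ArithmeticFunction ℤ) * XX (discr K)) n : ℤ) : ℂ) := by rw [h]
  rw [ArithmeticFunction.mul_apply] at h'
  rw [LSeries.convolution_def]
  unfold cnt at h'
  rw [Int.cast_natCast] at h'
  rw [h']
  push_cast
  refine Finset.sum_congr rfl fun x _ => ?_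
  simp

lemma Lr_tendsto (h2 : Module.finrank ℚ K = 2) :
    Tendsto (fun s : ℝ => Lr (discr K) s) (𝓝[>] 1) (𝓝 (dedekindZeta_residue K)) := by
  have h1 := tendsto_sub_one_mul_dedekindZeta_nhdsGT K
  have hmap : Tendsto (fun s : ℝ => (s : ℂ)) (𝓝[>] (1:ℝ)) (𝓝[≠] (1:ℂ)) := by
    refine tendsto_nhdsWithin_iff.2 ⟨?_, ?_⟩
    · have := (Complex.continuous_ofReal.tendsto (1:ℝ))
      rw [Complex.ofReal_one] at this
      exact this.mono_left nhdsWithin_le_nhds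
    · filter_upwards [self_mem_nhdsWithin] with s hs
      simp only [Set.mem_compl_iff, Set.mem_singleton_iff]
      intro h
      have : s = 1 := by exact_mod_cast h
      rw [this] at hs; exact lt_irrefl _ (Set.mem_Ioi.1 hs)
  have h3 := riemannZeta_residue_one.comp hmap
  have h4 := h1.div h3 one_ne_zero
  rw [div_one] at h4
  suffices hh : Tendsto (fun s : ℝ => ((Lr (discr K) s : ℝ) : ℂ)) (𝓝[>] 1) (𝓝 ((dedekindZeta_residue K : ℝ) : ℂ)) by
    have := (Complex.continuous_re.tendsto _).comp hh
    simpa [Function.comp_def] using this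
  refine h4.congr' ?_
  have hne := h3.eventually_ne one_ne_zero
  filter_upwards [self_mem_nhdsWithin, hne] with s hs hn
  simp only [Pi.div_apply, Function.comp_apply] at hn ⊢
  rw [dedekind_eq h2 hs, ← mul_assoc, mul_div_cancel_left₀ _ hn]

lemma torsion_two (h : 0 < InfinitePlace.nrRealPlaces K) : Units.torsionOrder K = 2 := by
  classical
  have key : ∀ x : Units.torsion K, (x : (𝓞 K)ˣ) = 1 ∨ (x : (𝓞 K)ˣ) = -1 := by
    intro x
    by_cases! hc : 2 < orderOf (x : (𝓞 K)ˣ)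
    · have hc2 : 2 < orderOf ((x.1 : (𝓞 K)ˣ) : K) := by
        have e : orderOf (((x.1 : (𝓞 K)ˣ) : 𝓞 K) : K) = orderOf ((x.1 : (𝓞 K)ˣ)) := by
          rw [← orderOf_units]
          exact orderOf_injective (algebraMap (𝓞 K) K).toMonoidHom
            (RingOfIntegers.coe_injective) _
        rw [← e] at hc; exact hc
      linarith [NumberField.InfinitePlace.IsPrimitiveRoot.nrRealPlaces_eq_zero_of_two_lt hc2 (IsPrimitiveRoot.orderOf (x.1 : K))]
    · interval_cases hi : orderOf (x : (𝓞 K)ˣ)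
      · linarith [orderOf_pos_iff.2 ((CommGroup.mem_torsion x.1).1 x.2)]
      · exact Or.intro_left _ (orderOf_eq_one_iff.1 hi)
      · rw [← orderOf_units, CharP.orderOf_eq_two_iff 0 (by decide)] at hi
        simp [← Units.val_inj, ← Units.val_inj, Units.val_neg, Units.val_one, hi]
  let := Fintype.ofFinite (Units.torsion K)
  rw [Units.torsionOrder, Nat.card_eq_fintype_card]
  refine (Finset.card_eq_two.2 ⟨1, ⟨-1, neg_one_mem_torsion⟩,
    by simp [← Subtype.coe_ne_coe], Finset.ext fun x ↦ ⟨fun _ ↦ ?_, fun _ ↦ Finset.mem_univ _⟩⟩)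
  rw [Finset.mem_insert, Finset.mem_singleton, ← Subtype.val_inj, ← Subtype.val_inj]
  exact key x

lemma residue_eq (h2 : Module.finrank ℚ K = 2) (hd : 0 < discr K) :
    dedekindZeta_residue K = 2 * (classNumber K * Units.regulator K) / Real.sqrt (discr K) := by
  have hs := sign_discr K
  rw [Int.sign_eq_one_of_pos hd] at hs
  have hc := InfinitePlace.card_add_two_mul_card_eq_rank K
  rw [h2] at hc
  have h0 : InfinitePlace.nrComplexPlaces K = 0 := by
    rcases (by omega : InfinitePlace.nrComplexPlaces K = 0 ∨ InfinitePlace.nrComplexPlaces K = 1) with h | h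
    · exact h
    · rw [h] at hs; norm_num at hs
  have hr : InfinitePlace.nrRealPlaces K = 2 := by omega
  rw [dedekindZeta_residue_def, h0, hr, torsion_two (by omega), abs_of_pos (show (0:ℝ) < (discr K : ℝ) by exact_mod_cast hd)]
  push_cast
  have : Real.sqrt (discr K : ℝ) ≠ 0 := (Real.sqrt_pos.2 (by exact_mod_cast hd)).ne'
  field_simp

lemma hR_tendsto (Δ : ℤ) (h2 : Module.finrank ℚ K = 2) (hΔ : discr K = Δ) (hd : 0 < Δ) :
    Tendsto (fun s : ℝ => Lr Δ s) (𝓝[>] 1)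
      (𝓝 (2 * (classNumber K * Units.regulator K) / Real.sqrt Δ)) := by
  subst hΔ
  rw [← residue_eq h2 hd]
  exact Lr_tendsto h2

end Mom

namespace Mom
open Finset NumberField Filter Topology

noncomputable def aa (v m n : ℕ) : ℝ := if Odd n then (jacobiSym ((v * m : ℕ) : ℤ) n : ℝ) else 0

lemma aa_abs (v m n : ℕ) : |aa v m n| ≤ 1 := by
  unfold aa; split_ifs
  · exact jac_abs_le _ _
  · simp

lemma sum_aa (v m J : ℕ) : ∑ n ∈ range (2 ^ J), aa v m n / n = ∑ j ∈ range J, T v j m := by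
  induction J with
  | zero => simp [aa]
  | succ J ih =>
    rw [Finset.sum_range_succ, ← ih, ← Finset.sum_range_add_sum_Ico _ (Nat.pow_le_pow_right two_pos (Nat.le_succ J))]
    congr 1
    unfold T blk
    rw [Finset.sum_filter]
    refine Finset.sum_congr rfl fun n _ => ?_
    unfold aa
    split_ifs <;> simp

noncomputable def Mr (v m : ℕ) (s : ℝ) : ℝ := ∑' n : ℕ, aa v m n / (n : ℝ) ^ s

lemma Mr_summable (v m : ℕ) {s : ℝ} (hs : 1 < s) : Summable fun n : ℕ => aa v m n / (n : ℝ) ^ s := by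
  refine Summable.of_norm_bounded (Real.summable_one_div_nat_rpow.2 hs) fun n => ?_
  rw [norm_div, Real.norm_eq_abs, Real.norm_eq_abs, abs_of_nonneg (Real.rpow_nonneg (Nat.cast_nonneg n) s)]
  have := aa_abs v m n
  gcongr

lemma Mr_tail (v m : ℕ) (B : ℝ) (hB : ∀ N, |∑ i ∈ range N, aa v m i| ≤ B) {s : ℝ} (hs : 1 < s) (J : ℕ) :
    |Mr v m s - ∑ n ∈ range (2 ^ J), aa v m n / (n : ℝ) ^ s| ≤ 2 * B / 2 ^ J := by
  have hB0 : 0 ≤ B := (abs_nonneg _).trans (hB 0)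
  have ht := (Mr_summable v m hs).hasSum.tendsto_sum_nat
  have ht2 := ((ht.sub_const (∑ n ∈ range (2 ^ J), aa v m n / (n : ℝ) ^ s)).abs)
  refine le_of_tendsto ht2 ?_
  filter_upwards [eventually_ge_atTop (2 ^ J)] with M hM
  rw [← Finset.sum_range_add_sum_Ico _ hM, add_sub_cancel_left]
  have h := abel_bound (aa v m) (fun n => 1 / (n : ℝ) ^ s) (2 ^ J) M hM B hB
    (fun n _ => by positivity) (fun n hn => by
      have h1 : (0:ℝ) < n := by exact_mod_cast lt_of_lt_of_le (by positivity) hn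
      push_cast
      gcongr
      linarith)
  simp only [mul_one_div] at h
  refine h.trans ?_
  have h3 : (2 : ℝ) ^ J ≤ ((2 ^ J : ℕ) : ℝ) ^ s := by
    push_cast
    exact Real.self_le_rpow_of_one_le (one_le_pow₀ (by norm_num)) hs.le
  gcongr

lemma Mr_tendsto (v m : ℕ) (hv : v = 1 ∨ v = 2) (hm : Odd m) (hsq : ¬ IsSquare m) :
    Tendsto (fun s : ℝ => Mr v m s) (𝓝[>] 1) (𝓝 (Hfun v m)) := by
  obtain ⟨C1, h11, hC1⟩ := pv_dual 1 one_pos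
  obtain ⟨C2, h21, hC2⟩ := H_tail 1 one_pos
  set B := C1 * (m : ℝ) ^ ((1:ℝ) / 2 + 1) with hBdef
  set D := C2 * (m : ℝ) ^ ((1:ℝ) / 2 + 1) with hDdef
  have hB : ∀ N, |∑ i ∈ range N, aa v m i| ≤ B := by
    intro N
    have := hC1 v m 1 N hv hm hsq odd_one
    simpa [aa, hBdef] using this
  have hB0 : 0 ≤ B := (abs_nonneg _).trans (hB 0)
  have hD0 : 0 ≤ D := by positivity
  rw [Metric.tendsto_nhds]
  intro ε hε
  obtain ⟨J, hJ⟩ : ∃ J : ℕ, (2 * B + D) / 2 ^ J < ε / 2 := by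
    have h1 : Tendsto (fun J : ℕ => (2 * B + D) * (1 / 2 : ℝ) ^ J) atTop (𝓝 ((2 * B + D) * 0)) :=
      (tendsto_pow_atTop_nhds_zero_of_lt_one (by norm_num) (by norm_num)).const_mul _
    rw [mul_zero] at h1
    obtain ⟨J, hJ⟩ := (h1.eventually (gt_mem_nhds (half_pos hε))).exists
    refine ⟨J, ?_⟩
    rw [one_div, inv_pow, ← div_eq_mul_inv] at hJ
    exact hJ
  have hcont : Tendsto (fun s : ℝ => ∑ n ∈ range (2 ^ J), aa v m n / (n : ℝ) ^ s) (𝓝[>] 1)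
      (𝓝 (∑ n ∈ range (2 ^ J), aa v m n / (n : ℝ) ^ (1:ℝ))) := by
    refine tendsto_finsetSum _ fun n _ => ?_
    by_cases hn : n = 0
    · subst hn; simp [aa]
    · have hn' : (0:ℝ) < n := by exact_mod_cast Nat.pos_of_ne_zero hn
      refine Tendsto.div tendsto_const_nhds ?_ (by positivity)
      refine Tendsto.mono_left ?_ nhdsWithin_le_nhds
      exact (Real.continuous_const_rpow hn'.ne').tendsto 1
  simp only [Real.rpow_one] at hcont
  rw [sum_aa] at hcont
  rw [Metric.tendsto_nhds] at hcont
  filter_upwards [self_mem_nhdsWithin, hcont (ε / 2) (half_pos hε)] with s hs h3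
  have h1 := Mr_tail v m B hB (Set.mem_Ioi.1 hs) J
  have h2 := (hC2 v m J hv hm hsq).2
  rw [← hDdef] at h2
  rw [Real.dist_eq] at h3 ⊢
  have e : (2 * B + D) / 2 ^ J = 2 * B / 2 ^ J + D / 2 ^ J := by ring
  rw [abs_lt] at h3 ⊢
  rw [abs_le] at h1 h2
  constructor <;> linarith [h1.1, h1.2, h2.1, h2.2, h3.1, h3.2]

lemma tsum_eo (f : ℕ → ℝ) (hf : Summable f) : ∑' k, f (2 * k) + ∑' k, f (2 * k + 1) = ∑' n, f n := by
  have i2 : Function.Injective (fun k : ℕ => 2 * k) := fun a b h => by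
    have : 2 * a = 2 * b := h
    omega
  have i3 : Function.Injective (fun k : ℕ => 2 * k + 1) := fun a b h => by
    have : 2 * a + 1 = 2 * b + 1 := h
    omega
  exact tsum_even_add_odd (hf.comp_injective i2) (hf.comp_injective i3)

lemma Lr_Mr (Δ : ℤ) (v m : ℕ) (h : ∀ n : ℕ, Odd n → jacobiSym Δ n = jacobiSym ((v * m : ℕ) : ℤ) n)
    {s : ℝ} (hs : 1 < s) : (1 - chi2 Δ * (2:ℝ) ^ (-s)) * Lr Δ s = Mr v m s := by
  have h0 : ∑' k : ℕ, aa v m (2 * k) / ((2 * k : ℕ) : ℝ) ^ s = 0 := by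
    rw [← tsum_zero (α := ℝ) (β := ℕ)]
    refine tsum_congr fun k => ?_
    have : ¬ Odd (2 * k) := by simp
    simp [aa, this]
  have h1 : ∑' k : ℕ, (XX Δ (2 * k) : ℝ) / ((2 * k : ℕ) : ℝ) ^ s = chi2 Δ * (2:ℝ) ^ (-s) * Lr Δ s := by
    unfold Lr
    rw [← tsum_mul_left]
    refine tsum_congr fun k => ?_
    rw [XX_mul, XX_two]
    push_cast
    rw [Real.mul_rpow (by norm_num) (by positivity), Real.rpow_neg (by norm_num)]
    ring
  have h2 : ∑' k : ℕ, (XX Δ (2 * k + 1) : ℝ) / ((2 * k + 1 : ℕ) : ℝ) ^ s =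
      ∑' k : ℕ, aa v m (2 * k + 1) / ((2 * k + 1 : ℕ) : ℝ) ^ s := by
    refine tsum_congr fun k => ?_
    have ho : Odd (2 * k + 1) := ⟨k, rfl⟩
    rw [XX_odd _ _ ho, h _ ho, aa, if_pos ho]
  have e1' : ∑' k : ℕ, (XX Δ (2 * k) : ℝ) / ((2 * k : ℕ) : ℝ) ^ s + ∑' k : ℕ, (XX Δ (2 * k + 1) : ℝ) / ((2 * k + 1 : ℕ) : ℝ) ^ s = Lr Δ s :=
    tsum_eo (fun n : ℕ => (XX Δ n : ℝ) / (n : ℝ) ^ s) (Lr_summable Δ hs)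
  have e2' : ∑' k : ℕ, aa v m (2 * k) / ((2 * k : ℕ) : ℝ) ^ s + ∑' k : ℕ, aa v m (2 * k + 1) / ((2 * k + 1 : ℕ) : ℝ) ^ s = Mr v m s :=
    tsum_eo (fun n : ℕ => aa v m n / (n : ℝ) ^ s) (Mr_summable v m hs)
  rw [h0] at e2'
  rw [h1] at e1'
  linarith

lemma jac_mul_sq (c m n : ℕ) (hn : Odd n) (hc : c = 1 ∨ c = 4 ∨ c = 8) :
    jacobiSym ((c * m : ℕ) : ℤ) n = jacobiSym (((if c = 8 then 2 else 1) * m : ℕ) : ℤ) n := by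
  have h2 : Int.gcd 2 (n : ℤ) = 1 := by
    have := (Nat.coprime_two_left.2 hn)
    simpa [Int.gcd] using this
  have h4 : jacobiSym ((2:ℤ) ^ 2) n = 1 := by
    rw [jacobiSym.pow_left]; exact jacobiSym.sq_one h2
  rcases hc with rfl | rfl | rfl
  · simp
  · have e : ((4 * m : ℕ) : ℤ) = 2 ^ 2 * m := by push_cast; ring
    rw [e, jacobiSym.mul_left, h4]; simp
  · have e : ((8 * m : ℕ) : ℤ) = 2 ^ 2 * ((2 * m : ℕ) : ℤ) := by push_cast; ring
    rw [e, jacobiSym.mul_left, h4]; simp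

variable {K : Type} [Field K] [NumberField K]

/-- The class number formula, in final form. -/
lemma hR_eq (c m : ℕ) (hc : c = 1 ∨ c = 4 ∨ c = 8) (hm : Odd m) (hsf : Squarefree m) (hm2 : 2 ≤ m)
    (h2 : Module.finrank ℚ K = 2) (hΔ : discr K = ((c * m : ℕ) : ℤ)) :
    (classNumber K : ℝ) * Units.regulator K =
      Real.sqrt c * Real.sqrt m / 2 * (1 - (chi2 ((c * m : ℕ) : ℤ) : ℝ) / 2)⁻¹ * Hfun (if c = 8 then 2 else 1) m := by
  set Δ : ℤ := ((c * m : ℕ) : ℤ) with hΔd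
  set v := if c = 8 then 2 else 1 with hv
  have hv' : v = 1 ∨ v = 2 := by rw [hv]; split_ifs <;> simp
  have hcm : 0 < c * m := Nat.mul_pos (by omega) (by omega)
  have hd : 0 < Δ := by rw [hΔd]; exact_mod_cast hcm
  have t1 := hR_tendsto Δ h2 hΔ hd
  have t2 := Mr_tendsto v m hv' hm (sqfree_not_sq hsf hm2)
  have t3 : Tendsto (fun s : ℝ => (1 - chi2 Δ * (2:ℝ) ^ (-s))) (𝓝[>] 1) (𝓝 (1 - chi2 Δ * (2:ℝ) ^ (-1:ℝ))) := by
    refine Tendsto.mono_left ?_ nhdsWithin_le_nhds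
    have hcn : Continuous (fun s : ℝ => (1 - chi2 Δ * (2:ℝ) ^ (-s))) :=
      continuous_const.sub (continuous_const.mul ((Real.continuous_const_rpow (by norm_num)).comp continuous_neg))
    exact hcn.tendsto 1
  have t4 := t3.mul t1
  have t5 : Tendsto (fun s : ℝ => Mr v m s) (𝓝[>] 1) _ := t4.congr' (by
    filter_upwards [self_mem_nhdsWithin] with s hs
    exact Lr_Mr Δ v m (fun n hn => jac_mul_sq c m n hn hc) (Set.mem_Ioi.1 hs))
  have key := tendsto_nhds_unique t5 t2
  rw [Real.rpow_neg_one, ← div_eq_mul_inv] at key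
  have hchi : (1 - (chi2 Δ : ℝ) / 2) ≠ 0 := by
    unfold chi2; split_ifs <;> norm_num
  have hs : Real.sqrt (Δ : ℝ) = Real.sqrt c * Real.sqrt m := by
    rw [hΔd]; push_cast; rw [Real.sqrt_mul (by positivity)]
  have hs0 : 0 < Real.sqrt c * Real.sqrt m := by
    rw [← hs]; exact Real.sqrt_pos.2 (by exact_mod_cast hd)
  rw [hs] at key
  rw [← key, ← div_eq_mul_inv]
  set q := Real.sqrt c * Real.sqrt m with hq
  set u := 1 - (chi2 Δ : ℝ) / 2 with hu
  have hq0 := hs0.ne'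
  field_simp

/-- value at 8 -/
lemma hR_eight : ∃ w : ℝ, ∀ (K : Type) [Field K] [NumberField K], Module.finrank ℚ K = 2 →
    discr K = 8 → (classNumber K : ℝ) * Units.regulator K = w := by
  refine ⟨limUnder (𝓝[>] (1:ℝ)) (fun s : ℝ => Lr 8 s) * Real.sqrt 8 / 2, ?_⟩
  intro K _ _ h2 hd
  have t := hR_tendsto 8 h2 hd (by norm_num)
  rw [t.limUnder_eq]
  have : Real.sqrt 8 ≠ 0 := (Real.sqrt_pos.2 (by norm_num)).ne'
  push_cast
  field_simp

end Mom

namespace Mom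
open Finset

/-- The families `Δ = c m`, `m ≡ a mod 8`. -/
def LL : Finset (ℕ × ℕ) := {(1, 1), (1, 5), (4, 3), (4, 7), (8, 1), (8, 3), (8, 5), (8, 7)}

lemma LL_cases {c a : ℕ} (h : (c, a) ∈ LL) :
    (c = 1 ∨ c = 4 ∨ c = 8) ∧ (c = 1 → a % 4 = 1) ∧ (c = 4 → a % 4 = 3) ∧ a % 2 = 1 ∧ a < 8 := by
  simp only [LL, mem_insert, mem_singleton, Prod.mk.injEq] at h
  omega

noncomputable def MM (c a : ℕ) (Y : ℝ) : Finset ℕ :=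
  (range (⌊Y / c⌋₊ + 1)).filter (fun m => m % 8 = a ∧ Squarefree m ∧ 2 ≤ m)

lemma mem_MM {c a m : ℕ} {Y : ℝ} (hc : 1 ≤ c) (hY : 1 ≤ Y) :
    m ∈ MM c a Y ↔ (c * m : ℝ) ≤ Y ∧ m % 8 = a ∧ Squarefree m ∧ 2 ≤ m := by
  unfold MM
  have hc' : (0:ℝ) < c := by exact_mod_cast hc
  rw [mem_filter, mem_range, Nat.lt_succ_iff, Nat.le_floor_iff (by positivity), le_div_iff₀ hc', mul_comm]

lemma fund_of {c a m : ℕ} (h : (c, a) ∈ LL) (hm : m % 8 = a) (hs : Squarefree m) (h2 : 2 ≤ m) :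
    IsFundamentalDiscriminant ((c * m : ℕ) : ℤ) := by
  obtain ⟨hc, h1, h4, ha, -⟩ := LL_cases h
  rcases hc with rfl | rfl | rfl
  · refine ⟨by omega, Or.inl ⟨by omega, ?_⟩⟩
    rw [one_mul]
    exact Int.squarefree_natCast.2 hs
  · refine ⟨by omega, Or.inr ⟨m, by push_cast; ring, Int.squarefree_natCast.2 hs, by omega⟩⟩
  · refine ⟨by omega, Or.inr ⟨((2 * m : ℕ) : ℤ), by push_cast; ring, Int.squarefree_natCast.2 ?_, by omega⟩⟩
    rw [Nat.squarefree_mul (Nat.coprime_two_left.2 (Nat.odd_iff.2 (by omega)))]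
    exact ⟨Nat.prime_two.squarefree, hs⟩

lemma of_fund {Δ : ℤ} (h : IsFundamentalDiscriminant Δ) (h0 : 0 < Δ) (h8 : Δ ≠ 8) :
    ∃ c a m : ℕ, (c, a) ∈ LL ∧ m % 8 = a ∧ Squarefree m ∧ 2 ≤ m ∧ Δ = ((c * m : ℕ) : ℤ) := by
  obtain ⟨h1, h | ⟨k, rfl, hk, hk4⟩⟩ := h
  · lift Δ to ℕ using h0.le
    rw [Int.squarefree_natCast] at h
    refine ⟨1, Δ % 8, Δ, ?_, rfl, h.2, by omega, by simp⟩
    have : Δ % 8 = 1 ∨ Δ % 8 = 5 := by omega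
    rcases this with e | e <;> rw [e] <;> decide
  · lift k to ℕ using (by omega)
    rw [Int.squarefree_natCast] at hk
    rcases hk4 with hk4 | hk4
    · obtain ⟨m, rfl⟩ : ∃ m, k = 2 * m := ⟨k / 2, by omega⟩
      refine ⟨8, m % 8, m, ?_, rfl, hk.of_mul_right, by omega, by push_cast; ring⟩
      have : m % 8 = 1 ∨ m % 8 = 3 ∨ m % 8 = 5 ∨ m % 8 = 7 := by omega
      rcases this with e | e | e | e <;> rw [e] <;> decide
    · refine ⟨4, k % 8, k, ?_, rfl, hk, by omega, by push_cast; ring⟩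
      have : k % 8 = 3 ∨ k % 8 = 7 := by omega
      rcases this with e | e <;> rw [e] <;> decide

lemma fund_eight : IsFundamentalDiscriminant 8 :=
  ⟨by norm_num, Or.inr ⟨2, by norm_num, Int.prime_two.squarefree, by norm_num⟩⟩

open scoped Classical in
lemma sum_fund (f : ℤ → ℝ) (Y : ℝ) (hY : 1 ≤ Y) :
    ∑ Δ ∈ Finset.Icc (1 : ℤ) ⌊Y⌋, (if IsFundamentalDiscriminant Δ then f Δ else 0) =
      ∑ p ∈ LL, ∑ m ∈ MM p.1 p.2 Y, f ((p.1 * m : ℕ) : ℤ) + if 8 ≤ Y then f 8 else 0 := by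
  set S := (Finset.Icc (1 : ℤ) ⌊Y⌋).filter IsFundamentalDiscriminant with hS
  rw [← Finset.sum_filter]
  have e1 : ∑ Δ ∈ S, f Δ = ∑ Δ ∈ S.filter (fun Δ => Δ ≠ 8), f Δ + ∑ Δ ∈ S.filter (fun Δ => ¬ Δ ≠ 8), f Δ :=
    (Finset.sum_filter_add_sum_filter_not S _ f).symm
  have e2 : ∑ Δ ∈ S.filter (fun Δ => ¬ Δ ≠ 8), f Δ = if 8 ≤ Y then f 8 else 0 := by
    have : S.filter (fun Δ => ¬ Δ ≠ 8) = if 8 ≤ Y then {8} else ∅ := by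
      ext Δ
      rw [hS, mem_filter, mem_filter, mem_Icc, Int.le_floor]
      constructor
      · rintro ⟨⟨⟨h1, h2⟩, h3⟩, h4⟩
        have : Δ = 8 := not_not.1 h4
        subst this
        rw [if_pos (by exact_mod_cast h2)]; simp
      · intro h
        split_ifs at h with h8
        · rw [mem_singleton] at h
          subst h
          exact ⟨⟨⟨by norm_num, by exact_mod_cast h8⟩, fund_eight⟩, by simp⟩
        · simp at h
    rw [this]
    split_ifs <;> simp
  rw [e1, e2, Finset.sum_sigma']
  congr 1
  symm
  refine Finset.sum_nbij (fun x => ((x.1.1 * x.2 : ℕ) : ℤ)) ?_ ?_ ?_ (fun _ _ => rfl)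
  · rintro ⟨⟨c, a⟩, m⟩ hx
    rw [mem_sigma] at hx
    obtain ⟨hx1, hx2⟩ := hx
    simp only at hx1 hx2 ⊢
    have hL := LL_cases hx1
    rw [mem_MM (by omega) hY] at hx2
    obtain ⟨g1, g2, g3, g4⟩ := hx2
    have hpos : 0 < c * m := Nat.mul_pos (by omega) (by omega)
    rw [hS, mem_filter, mem_filter, mem_Icc, Int.le_floor]
    refine ⟨⟨⟨by exact_mod_cast hpos, by push_cast; exact g1⟩, fund_of hx1 g2 g3 g4⟩, ?_⟩
    intro h
    have h' : c * m = 8 := by exact_mod_cast h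
    rcases hL.1 with rfl | rfl | rfl <;> omega
  · rintro ⟨⟨c, a⟩, m⟩ hx ⟨⟨c', a'⟩, m'⟩ hx' h
    rw [mem_coe, mem_sigma] at hx hx'
    obtain ⟨hx1, hx2⟩ := hx
    obtain ⟨hx1', hx2'⟩ := hx'
    simp only at hx1 hx2 hx1' hx2' h
    have hL := LL_cases hx1
    have hL' := LL_cases hx1'
    rw [mem_MM (by omega) hY] at hx2 hx2'
    have h' : c * m = c' * m' := by exact_mod_cast h
    have hc : c = c' := by
      rcases hL.1 with rfl | rfl | rfl <;> rcases hL'.1 with rfl | rfl | rfl <;> omega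
    subst hc
    have hmm : m = m' := Nat.eq_of_mul_eq_mul_left (by omega) h'
    subst hmm
    have haa : a = a' := by omega
    subst haa
    rfl
  · intro Δ hΔ
    rw [mem_coe, hS, mem_filter, mem_filter, mem_Icc, Int.le_floor] at hΔ
    obtain ⟨⟨⟨h1, h2⟩, h3⟩, h4⟩ := hΔ
    obtain ⟨c, a, m, g1, g2, g3, g4, rfl⟩ := of_fund h3 (by omega) h4
    refine ⟨⟨(c, a), m⟩, ?_, rfl⟩
    rw [mem_coe, mem_sigma]
    have hL := LL_cases g1
    refine ⟨g1, ?_⟩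
    change m ∈ MM c a Y
    rw [mem_MM (by omega) hY]
    push_cast at h2
    exact ⟨h2, g2, g3, g4⟩

noncomputable def ww (r : ℕ) (p : ℕ × ℕ) : ℝ :=
  (Real.sqrt p.1 / 2 * (1 - (chi2 ((p.1 * p.2 : ℕ) : ℤ) : ℝ) / 2)⁻¹) ^ r

lemma ww_pos (r : ℕ) (p : ℕ × ℕ) (hp : p ∈ LL) : 0 < ww r p := by
  obtain ⟨c, a⟩ := p
  have hL := LL_cases hp
  have hc : 0 < c := by omega
  have hchi : 0 < (1 - (chi2 ((c * a : ℕ) : ℤ) : ℝ) / 2) := by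
    unfold chi2; split_ifs <;> norm_num
  have : 0 < Real.sqrt c := Real.sqrt_pos.2 (by exact_mod_cast hc)
  unfold ww
  simp only
  positivity

lemma chi2_congr (c a m : ℕ) (h : m % 8 = a) : chi2 ((c * m : ℕ) : ℤ) = chi2 ((c * a : ℕ) : ℤ) := by
  have : ((c * m : ℕ) : ℤ) % 8 = ((c * a : ℕ) : ℤ) % 8 := by
    rw [← h]
    have : c * m % 8 = c * (m % 8) % 8 := by rw [Nat.mul_mod, Nat.mul_mod c (m % 8), Nat.mod_mod]
    exact_mod_cast this
  unfold chi2; rw [this]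

open scoped Classical in
theorem main_abs (r : ℕ) (hr : 1 ≤ r) (w8 : ℝ) :
    ∃ c : ℝ, 0 < c ∧ ∀ ε : ℝ, 0 < ε → ∃ C : ℝ, 0 < C ∧ ∀ g : ℤ → ℝ,
      (∀ c m : ℕ, (c = 1 ∨ c = 4 ∨ c = 8) → Odd m → Squarefree m → 2 ≤ m →
        IsFundamentalDiscriminant ((c * m : ℕ) : ℤ) →
        g ((c * m : ℕ) : ℤ) = Real.sqrt c * Real.sqrt m / 2 *
          (1 - (chi2 ((c * m : ℕ) : ℤ) : ℝ) / 2)⁻¹ * Hfun (if c = 8 then 2 else 1) m) →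
      g 8 = w8 →
      ∀ Y : ℝ, 1 ≤ Y →
      |(∑ Δ ∈ Finset.Icc (1 : ℤ) ⌊Y⌋, if IsFundamentalDiscriminant Δ then g Δ ^ r else 0)
        - c * Y ^ ((r : ℝ) / 2 + 1)| ≤ C * Y ^ ((r : ℝ) / 2 + 2 / 3 + ε) := by
  obtain ⟨κ, hκ, H⟩ := fam_asymp r hr
  have hw : ∀ p ∈ LL, 0 < ww r p := fun p hp => ww_pos r p hp
  have hne : LL.Nonempty := ⟨(1, 1), by decide⟩
  refine ⟨∑ p ∈ LL, ww r p * (κ / (p.1 : ℝ) ^ ((r : ℝ) / 2 + 1)), ?_, ?_⟩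
  · refine Finset.sum_pos (fun p hp => ?_) hne
    have h1 := hw p hp
    have hL := LL_cases (c := p.1) (a := p.2) hp
    have hc : (0:ℝ) < p.1 := by exact_mod_cast (by omega : 0 < p.1)
    positivity
  intro ε hε
  obtain ⟨C, hC1, hC⟩ := H ε hε
  have hsum : 0 < ∑ p ∈ LL, ww r p := Finset.sum_pos hw hne
  refine ⟨(∑ p ∈ LL, ww r p) * C + |w8| ^ r, by positivity, ?_⟩
  intro g hg h8 Y hY
  have hY0 : 0 < Y := by linarith
  rw [sum_fund (fun Δ => g Δ ^ r) Y hY, h8]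
  have e1 : ∀ p ∈ LL, ∑ m ∈ MM p.1 p.2 Y, g ((p.1 * m : ℕ) : ℤ) ^ r =
      ww r p * Fam r (if p.1 = 8 then 2 else 1) p.2 p.1 Y := by
    rintro ⟨c, a⟩ hp
    have hL := LL_cases hp
    simp only
    unfold Fam
    rw [Finset.mul_sum]
    change ∑ m ∈ MM c a Y, _ = ∑ m ∈ MM c a Y, _
    refine Finset.sum_congr rfl fun m hm => ?_
    rw [mem_MM (by omega) hY] at hm
    obtain ⟨-, g2, g3, g4⟩ := hm
    rw [hg c m hL.1 (Nat.odd_iff.2 (by omega)) g3 g4 (fund_of hp g2 g3 g4), chi2_congr c a m g2]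
    have : (m : ℝ) ^ ((r : ℝ) / 2) = Real.sqrt m ^ r := by
      rw [Real.sqrt_eq_rpow, ← Real.rpow_natCast, ← Real.rpow_mul (by positivity)]
      congr 1; ring
    rw [this]
    unfold ww
    simp only
    rw [← mul_pow, ← mul_pow]
    congr 1; ring
  rw [Finset.sum_congr rfl e1, Finset.sum_mul]
  have e2 : ∀ p ∈ LL, |ww r p * Fam r (if p.1 = 8 then 2 else 1) p.2 p.1 Y -
      ww r p * (κ / (p.1 : ℝ) ^ ((r : ℝ) / 2 + 1)) * Y ^ ((r : ℝ) / 2 + 1)| ≤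
      ww r p * (C * Y ^ ((r : ℝ) / 2 + 2 / 3 + ε)) := by
    rintro ⟨c, a⟩ hp
    have hL := LL_cases hp
    have h := hC (if c = 8 then 2 else 1) a c Y (by split_ifs <;> simp) hL.2.2.2.2
      (Nat.odd_iff.2 hL.2.2.2.1) (by omega) hY
    simp only
    rw [Real.div_rpow hY0.le (by positivity)] at h
    have e : ww r (c, a) * Fam r (if c = 8 then 2 else 1) a c Y -
      ww r (c, a) * (κ / (c : ℝ) ^ ((r : ℝ) / 2 + 1)) * Y ^ ((r : ℝ) / 2 + 1) =
      ww r (c, a) * (Fam r (if c = 8 then 2 else 1) a c Y -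
        κ * (Y ^ ((r : ℝ) / 2 + 1) / (c : ℝ) ^ ((r : ℝ) / 2 + 1))) := by ring
    rw [e, abs_mul, abs_of_pos (hw _ hp)]
    exact mul_le_mul_of_nonneg_left h (hw _ hp).le
  have hYe : 1 ≤ Y ^ ((r : ℝ) / 2 + 2 / 3 + ε) := Real.one_le_rpow hY (by positivity)
  have e3 : |if 8 ≤ Y then w8 ^ r else 0| ≤ |w8| ^ r * Y ^ ((r : ℝ) / 2 + 2 / 3 + ε) := by
    have h0 : 0 ≤ |w8| ^ r := by positivity
    have h1 := mul_le_mul_of_nonneg_left hYe h0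
    split_ifs
    · rw [abs_pow]; linarith
    · rw [abs_zero]; positivity
  rw [add_sub_right_comm, ← Finset.sum_sub_distrib]
  refine (abs_add_le _ _).trans ?_
  refine (add_le_add ((Finset.abs_sum_le_sum_abs _ _).trans (Finset.sum_le_sum e2)) e3).trans ?_
  rw [← Finset.sum_mul]
  apply le_of_eq; ring

end Mom

open scoped Classical in
/-- For every fundamental discriminant `Δ` let `K Δ` be the quadratic number field of
discriminant `Δ`. Then
`∑_{0 < Δ ≤ Y fund.} (h(K_Δ)·R(K_Δ))^r = c·Y^{r/2+1} + O_{r,ε}(Y^{r/2+2/3+ε})`. -/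
theorem statement_2 (r : ℕ) (hr : 1 ≤ r) :
    ∃ c : ℝ, 0 < c ∧ ∀ ε : ℝ, 0 < ε → ∃ C : ℝ, 0 < C ∧
      ∀ (K : ℤ → Type) (instF : ∀ Δ, Field (K Δ)) (instN : ∀ Δ, @NumberField (K Δ) (instF Δ)),
        (∀ Δ, IsFundamentalDiscriminant Δ →
          (letI := instF Δ; letI := instN Δ;
            Module.finrank ℚ (K Δ) = 2 ∧ NumberField.discr (K Δ) = Δ)) →
        ∀ Y : ℝ, 1 ≤ Y →
          |(∑ Δ ∈ Finset.Icc (1 : ℤ) ⌊Y⌋,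
              if IsFundamentalDiscriminant Δ then
                (letI := instF Δ; letI := instN Δ;
                  ((NumberField.classNumber (K Δ) : ℝ)) ^ r *
                    (NumberField.Units.regulator (K Δ)) ^ r)
              else 0) - c * Y ^ ((r : ℝ) / 2 + 1)|
            ≤ C * Y ^ ((r : ℝ) / 2 + 2 / 3 + ε) := by
  obtain ⟨w8, hw8⟩ := Mom.hR_eight
  obtain ⟨c, hc, H⟩ := Mom.main_abs r hr w8
  refine ⟨c, hc, fun ε hε => ?_⟩
  obtain ⟨C, hC, H⟩ := H ε hε
  refine ⟨C, hC, ?_⟩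
  intro K instF instN hK Y hY
  have h := H (fun Δ => (letI := instF Δ; letI := instN Δ;
    (NumberField.classNumber (K Δ) : ℝ) * NumberField.Units.regulator (K Δ))) ?_ ?_ Y hY
  · simp only [mul_pow] at h
    exact h
  · intro c m hc hm hs h2 hf
    exact @Mom.hR_eq _ (instF _) (instN _) c m hc hm hs h2 (hK _ hf).1 (hK _ hf).2
  · exact @hw8 _ (instF 8) (instN 8) (hK 8 Mom.fund_eight).1 (hK 8 Mom.fund_eight).2
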